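/- For each prime p in the set {59, 83, 107, 163}, with the cyclic group C_p of order p acting on ℚ(x₁,…,x_p) by cyclically permuting the indeterminates (the regular action), the fixed field ℚ(x₁,…,x_p)^{C_p} is not rational (not purely transcendental) over ℚ. -/

import Mathlib

universe u

open Finset in
/-- A finite family of valuations on an abelian group with an endomorphism `τ`, permuted by `τ`,
together with a dual family of elements. -/
structure ValuationFrame {U : Type*} [AddCommGroup U] (τ : U →+ U) (S : Type*) where
  perm : Equiv.Perm S
  ord : S → U →+ ℤ
  gen : S → U
  ord_gen_self : ∀ P, ord P (gen P) = 1
  ord_gen_of_ne : ∀ P Q, P ≠ Q → ord P (gen Q) = 0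
  ord_map : ∀ P x, ord (perm P) (τ x) = ord P x

namespace ValuationFrame

open Finset

variable {U : Type*} [AddCommGroup U] {τ : U →+ U} {S : Type*} (D : ValuationFrame τ S)

theorem ord_iterate (k : ℕ) (P : S) (x : U) : D.ord ((D.perm ^ k) P) (τ^[k] x) = D.ord P x := by
  induction k with
  | zero => simp
  | succ k ih =>
    rw [Function.iterate_succ_apply', pow_succ', Equiv.Perm.mul_apply, D.ord_map, ih]

theorem perm_pow_eq_one {n : ℕ} (hτ : ∀ x, τ^[n] x = x) : D.perm ^ n = 1 := by
  ext P
  rw [Equiv.Perm.one_apply]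
  by_contra h
  have := D.ord_iterate n P (D.gen P)
  rw [hτ, D.ord_gen_self, D.ord_gen_of_ne _ _ h] at this
  exact zero_ne_one this

/-- The equivariant homomorphism attached to the orbit of `P` and a root of unity `z`. -/
noncomputable def orbitHom {N : Type*} [CommRing N] (n : ℕ) (z : N) (P : S) : U →+ N :=
  ∑ k ∈ range n,
    (AddMonoidHom.mulRight (z ^ k)).comp ((Int.castAddHom N).comp (D.ord ((D.perm ^ k) P)))

theorem orbitHom_apply {N : Type*} [CommRing N] (n : ℕ) (z : N) (P : S) (x : U) :
    D.orbitHom n z P x = ∑ k ∈ range n, (D.ord ((D.perm ^ k) P) x : N) * z ^ k := by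
  simp [orbitHom, AddMonoidHom.finsetSum_apply]

theorem map_orbitHom {N N' : Type*} [CommRing N] [CommRing N'] (f : N →+* N') (n : ℕ) (z : N)
    (P : S) (x : U) : f (D.orbitHom n z P x) = D.orbitHom n (f z) P x := by
  simp [orbitHom_apply, map_sum]

theorem orbitHom_map {N : Type*} [CommRing N] {n : ℕ} (hτ : ∀ x, τ^[n] x = x) {z : N}
    (hz : z ^ n = 1) (P : S) (x : U) :
    D.orbitHom n z P (τ x) = z * D.orbitHom n z P x := by
  have h1 : ∀ k, D.ord ((D.perm ^ (k + 1)) P) (τ x) = D.ord ((D.perm ^ k) P) x := by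
    intro k
    rw [pow_succ', Equiv.Perm.mul_apply, D.ord_map]
  have h2 := sum_range_succ' (fun k => (D.ord ((D.perm ^ k) P) (τ x) : N) * z ^ k) n
  rw [sum_range_succ] at h2
  simp only [D.perm_pow_eq_one hτ, hz, pow_zero] at h2
  rw [orbitHom_apply, orbitHom_apply, mul_sum, add_right_cancel h2]
  refine sum_congr rfl fun k _ => ?_
  rw [h1]
  ring

/-- The free orbits of a permutation of order dividing `n`. -/
def FreeOrbit (n : ℕ) : Type _ :=
  {c : Quotient (Equiv.Perm.SameCycle.setoid D.perm) //
    ∀ k, 0 < k → k < n → (D.perm ^ k) c.out ≠ c.out}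

noncomputable instance (n : ℕ) [Fintype S] : Fintype (D.FreeOrbit n) := by
  classical
  unfold FreeOrbit
  infer_instance

noncomputable instance (n : ℕ) : DecidableEq (D.FreeOrbit n) := Classical.decEq _

/-- A chosen representative of a free orbit. -/
noncomputable def FreeOrbit.rep {n : ℕ} (c : D.FreeOrbit n) : S := c.1.out

theorem exists_pow_of_sameCycle {n : ℕ} (hn : 0 < n) (h : D.perm ^ n = 1) {P Q : S}
    (hPQ : D.perm.SameCycle P Q) : ∃ k < n, (D.perm ^ k) P = Q := by
  obtain ⟨i, rfl⟩ := hPQ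
  have hn' : (n : ℤ) ≠ 0 := by omega
  refine ⟨(i % n).toNat, ?_, ?_⟩
  · have := Int.emod_lt_of_pos i (by omega : (0 : ℤ) < n)
    have := Int.emod_nonneg i hn'
    omega
  · rw [← zpow_natCast, Int.toNat_of_nonneg (Int.emod_nonneg i hn')]
    conv_rhs => rw [← Int.emod_add_mul_ediv i n]
    rw [zpow_add, zpow_mul, zpow_natCast, h, one_zpow, mul_one]

theorem orbitHom_gen {N : Type*} [CommRing N] {n : ℕ} (hn : 0 < n) (z : N) (c d : D.FreeOrbit n) :
    D.orbitHom n z (c.rep D) (D.gen (d.rep D)) = if c = d then 1 else 0 := by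
  rw [orbitHom_apply]
  split_ifs with h
  · subst h
    rw [sum_eq_single 0]
    · simp [D.ord_gen_self]
    · intro k hk hk0
      have hne : (D.perm ^ k) (c.rep D) ≠ c.rep D :=
        c.2 k (Nat.pos_of_ne_zero hk0) (mem_range.1 hk)
      rw [D.ord_gen_of_ne _ _ hne, Int.cast_zero, zero_mul]
    · simp [hn.ne']
  · refine sum_eq_zero fun k _ => ?_
    rw [D.ord_gen_of_ne, Int.cast_zero, zero_mul]
    intro hk
    refine h (Subtype.ext ?_)
    rw [← Quotient.out_eq c.1, ← Quotient.out_eq d.1]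
    exact Quotient.sound ⟨k, by simpa [FreeOrbit.rep] using hk⟩

theorem eq_sum_ord_mul [Fintype S] {N : Type*} [CommRing N] (h : U →+ N)
    (hker : ∀ x, (∀ P, D.ord P x = 0) → h x = 0) (x : U) :
    h x = ∑ P, (D.ord P x : N) * h (D.gen P) := by
  classical
  have h0 := hker (x - ∑ P, D.ord P x • D.gen P) fun Q => by
    rw [map_sub, map_sum, sum_eq_single Q]
    · simp [D.ord_gen_self]
    · intro P _ hP
      simp [D.ord_gen_of_ne _ _ hP.symm]
    · simp
  rw [map_sub, sub_eq_zero] at h0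
  rw [h0, map_sum]
  simp

theorem map_gen_perm_pow {N : Type*} [CommRing N] {z : N} (h : U →+ N)
    (hτ : ∀ x, h (τ x) = z * h x) (hker : ∀ x, (∀ P, D.ord P x = 0) → h x = 0) (k : ℕ) (P : S) :
    h (D.gen ((D.perm ^ k) P)) = z ^ k * h (D.gen P) := by
  have h1 : ∀ P, h (D.gen (D.perm P)) = z * h (D.gen P) := by
    intro P
    rw [← hτ, ← sub_eq_zero, ← map_sub]
    refine hker _ fun Q => ?_
    obtain ⟨Q, rfl⟩ := D.perm.surjective Q
    rw [map_sub, D.ord_map, sub_eq_zero]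
    by_cases hQ : Q = P
    · subst hQ
      rw [D.ord_gen_self, D.ord_gen_self]
    · rw [D.ord_gen_of_ne _ _ hQ, D.ord_gen_of_ne _ _ (D.perm.injective.ne hQ)]
  induction k with
  | zero => simp
  | succ k ih => rw [pow_succ', Equiv.Perm.mul_apply, h1, ih, pow_succ']; ring

/-- An equivariant homomorphism is determined by its values at representatives of the free
orbits. -/
theorem eq_sum_orbitHom_mul [Fintype S] {N : Type*} [CommRing N] [IsDomain N] {n : ℕ} (hn : 0 < n)
    (hτn : ∀ x, τ^[n] x = x) {z : N} (hz : IsPrimitiveRoot z n) (h : U →+ N)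
    (hτ : ∀ x, h (τ x) = z * h x) (hker : ∀ x, (∀ P, D.ord P x = 0) → h x = 0) (x : U) :
    h x = ∑ c : D.FreeOrbit n, D.orbitHom n z (c.rep D) x * h (D.gen (c.rep D)) := by
  classical
  have hperm := D.perm_pow_eq_one hτn
  have hgen := D.map_gen_perm_pow h hτ hker
  rw [D.eq_sum_ord_mul h hker x,
    ← sum_fiberwise univ (fun P => Quotient.mk (Equiv.Perm.SameCycle.setoid D.perm) P)]
  have hfree : ∀ c : D.FreeOrbit n,
      ∑ P with Quotient.mk (Equiv.Perm.SameCycle.setoid D.perm) P = c.1,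
        (D.ord P x : N) * h (D.gen P) =
      D.orbitHom n z (c.rep D) x * h (D.gen (c.rep D)) := by
    intro c
    rw [orbitHom_apply, sum_mul]
    symm
    refine sum_bij (fun k _ => (D.perm ^ k) (c.rep D)) ?_ ?_ ?_ ?_
    · intro k _
      simp only [mem_filter, mem_univ, true_and]
      conv_rhs => rw [← Quotient.out_eq c.1]
      exact Quotient.sound (Equiv.Perm.SameCycle.symm ⟨k, by simp [FreeOrbit.rep]⟩)
    · have key : ∀ a < n, ∀ b < n, a < b → (D.perm ^ a) (c.rep D) ≠ (D.perm ^ b) (c.rep D) := by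
        intro a ha b hb hab heq
        have hb' : b = a + (b - a) := by omega
        rw [hb', pow_add, Equiv.Perm.mul_apply] at heq
        exact c.2 (b - a) (by omega) (by omega) ((D.perm ^ a).injective heq).symm
      intro a ha b hb heq
      rcases lt_trichotomy a b with hab | hab | hab
      · exact absurd heq (key a (mem_range.1 ha) b (mem_range.1 hb) hab)
      · exact hab
      · exact absurd heq.symm (key b (mem_range.1 hb) a (mem_range.1 ha) hab)
    · intro P hP
      simp only [mem_filter, mem_univ, true_and] at hP
      rw [← Quotient.out_eq c.1] at hP
      obtain ⟨k, hk, hkP⟩ := D.exists_pow_of_sameCycle hn hperm (Quotient.exact hP).symm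
      exact ⟨k, mem_range.2 hk, hkP⟩
    · intro k _
      rw [hgen]
      ring
  have hnonfree : ∀ c : Quotient (Equiv.Perm.SameCycle.setoid D.perm),
      ¬ (∀ k, 0 < k → k < n → (D.perm ^ k) c.out ≠ c.out) →
      ∑ P with Quotient.mk (Equiv.Perm.SameCycle.setoid D.perm) P = c,
        (D.ord P x : N) * h (D.gen P) = 0 := by
    intro c hc
    push Not at hc
    obtain ⟨k, hk0, hkn, hk⟩ := hc
    have h0 : h (D.gen c.out) = 0 := by
      have := hgen k c.out
      rw [hk] at this
      have h1 : (z ^ k - 1) * h (D.gen c.out) = 0 := by rw [sub_mul, ← this]; ring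
      rcases mul_eq_zero.1 h1 with h1 | h1
      · exact absurd (sub_eq_zero.1 h1) (hz.pow_ne_one_of_pos_of_lt hk0.ne' hkn)
      · exact h1
    refine sum_eq_zero fun P hP => ?_
    simp only [mem_filter, mem_univ, true_and] at hP
    rw [← Quotient.out_eq c] at hP
    obtain ⟨i, -, rfl⟩ := D.exists_pow_of_sameCycle hn hperm (Quotient.exact hP).symm
    rw [hgen, h0, mul_zero, mul_zero]
  symm
  refine Fintype.sum_of_injective (fun c : D.FreeOrbit n => c.1) Subtype.val_injective _ _ ?_
    fun c => (hfree c).symm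
  intro c hc
  exact hnonfree c fun h => hc ⟨⟨c, h⟩, rfl⟩

/-- If two valuation frames on `U` are compared by an equivariant map `l`, the values of `l` on the
common kernel of the second frame have a common divisor in the kernel of `φ`. -/
theorem exists_dvd_of_frames {R F : Type*} [CommRing R] [IsDomain R] [CommRing F] [IsDomain F]
    (φ : R →+* F) {n : ℕ} (hn : 0 < n) (hτn : ∀ x, τ^[n] x = x) {z : R} (hz : IsPrimitiveRoot z n)
    (hφz : IsPrimitiveRoot (φ z) n) {A B : Type*} [Finite A] [Finite B]
    (DA : ValuationFrame τ A) (DB : ValuationFrame τ B) (l : U →+ R)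
    (hl : ∀ x, l (τ x) = z * l x) (hlA : ∀ x, (∀ P, DA.ord P x = 0) → l x = 0)
    (hAB : ∀ x, (∀ P, DA.ord P x = 0) → ∀ P, DB.ord P x = 0)
    (hφl : ∀ x, (∀ P, DB.ord P x = 0) → φ (l x) = 0)
    (hl0 : ∃ x, (∀ P, DB.ord P x = 0) ∧ l x ≠ 0)
    (hrank : ∃ N : R, N ≠ 0 ∧ ∀ h : U →+ R, (∀ x, h (τ x) = z * h x) →
      (∀ x, (∀ P, DA.ord P x = 0) → h x = 0) →
      ∃ c, ∀ x, (∀ P, DB.ord P x = 0) → N * h x = c * l x) :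
    ∃ α, φ α = 0 ∧ ∀ x, (∀ P, DB.ord P x = 0) → α ∣ l x := by
  classical
  have := Fintype.ofFinite A
  have := Fintype.ofFinite B
  let I := DA.FreeOrbit n
  let J := DB.FreeOrbit n
  let vA : I → U →+ R := fun c => DA.orbitHom n z (c.rep DA)
  let vB : Option J → U →+ R := fun o => o.elim l fun c => DB.orbitHom n z (c.rep DB)
  have hvA : ∀ c x, vA c (τ x) = z * vA c x := fun c x => DA.orbitHom_map hτn hz.pow_eq_one _ x
  have hvB : ∀ c x, vB c (τ x) = z * vB c x := by
    rintro (_ | c) x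
    · exact hl x
    · exact DB.orbitHom_map hτn hz.pow_eq_one _ x
  have hvAker : ∀ c x, (∀ P, DA.ord P x = 0) → vA c x = 0 := by
    intro c x hx
    simp [vA, orbitHom_apply, hx]
  have hvBker : ∀ c x, (∀ P, DA.ord P x = 0) → vB c x = 0 := by
    rintro (_ | c) x hx
    · exact hlA x hx
    · simp [vB, orbitHom_apply, hAB x hx]
  let G : Matrix (Option J) I R := fun o i => vB o (DA.gen (i.rep DA))
  have hG : ∀ o x, vB o x = ∑ i, G o i * vA i x := by
    intro o x
    rw [DA.eq_sum_orbitHom_mul hn hτn hz (vB o) (hvB o) (hvBker o) x]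
    exact sum_congr rfl fun i _ => mul_comm _ _
  have hvBgen : ∀ c d : J, vB (some c) (DB.gen (d.rep DB)) = if c = d then 1 else 0 :=
    fun c d => DB.orbitHom_gen hn z c d
  have hvB0 : ∀ x, (∀ P, DB.ord P x = 0) → ∀ c : J, vB (some c) x = 0 := by
    intro x hx c
    simp [vB, orbitHom_apply, hx]
  -- a right quasi-inverse of `G`
  let X : U → Matrix I (Option J) R := fun m i o =>
    o.elim (vA i m) fun c => vA i (DB.gen (c.rep DB))
  let Y : U → Matrix (Option J) (Option J) R := fun m o o' =>
    vB o (o'.elim m fun c => DB.gen (c.rep DB))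
  have hGX : ∀ m, G * X m = Y m := by
    intro m
    ext o o'
    rw [Matrix.mul_apply]
    rcases o' with _ | c
    · exact (hG o m).symm
    · exact (hG o _).symm
  have hYdet : ∀ m, (∀ P, DB.ord P m = 0) → (Y m).det = l m := by
    intro m hm
    let e : Option J ≃ J ⊕ Unit := Equiv.optionEquivSumPUnit J
    rw [← Matrix.det_reindex_self e (Y m)]
    have : Matrix.reindex e e (Y m) = Matrix.fromBlocks 1 0
        (Matrix.of fun _ c => vB none (DB.gen (c.rep DB))) (Matrix.of fun _ _ => l m) := by
      ext (a | a) (b | b)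
      · exact hvBgen a b
      · exact hvB0 m hm a
      · rfl
      · rfl
    rw [this, Matrix.det_fromBlocks_zero₁₂]
    simp
  obtain ⟨m₀, hm₀, hlm₀⟩ := hl0
  obtain ⟨N, hN, hrank⟩ := hrank
  -- a left quasi-inverse of `G`
  choose c hc using fun i : I => hrank (vA i) (hvA i) (hvAker i)
  let Z : Matrix I (Option J) R := fun i o =>
    o.elim (c i) fun d => N * vA i (DB.gen (d.rep DB)) - c i * l (DB.gen (d.rep DB))
  have hZ : ∀ i x, N * vA i x = ∑ o, Z i o * vB o x := by
    intro i x
    let h : U →+ R := (AddMonoidHom.mulLeft N).comp (vA i) - (AddMonoidHom.mulLeft (c i)).comp l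
    have hh : ∀ x, h x = N * vA i x - c i * l x := fun x => rfl
    have h1 := DB.eq_sum_orbitHom_mul hn hτn hz h
      (fun x => by rw [hh, hh, hvA, hl]; ring)
      (fun x hx => by rw [hh, hc i x hx, sub_self]) x
    rw [Fintype.sum_option, ← sub_eq_iff_eq_add']
    refine h1.trans (sum_congr rfl fun d _ => ?_)
    rw [hh, mul_comm]
    rfl
  have hZG : Z * G = N • (1 : Matrix I I R) := by
    ext i j
    rw [Matrix.mul_apply, Matrix.smul_apply, ← hZ i (DA.gen (j.rep DA))]
    rw [show vA i (DA.gen (j.rep DA)) = if i = j then 1 else 0 from DA.orbitHom_gen hn z i j]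
    simp [Matrix.one_apply]
  have hcard1 : Fintype.card I ≤ Fintype.card (Option J) := by
    refine card_le_of_injective R G.mulVecLin ((injective_iff_map_eq_zero _).2 fun v hv => ?_)
    have h1 : (Z * G).mulVec v = 0 := by
      rw [← Matrix.mulVec_mulVec, show G.mulVec v = 0 from hv, Matrix.mulVec_zero]
    rw [hZG, Matrix.smul_mulVec, Matrix.one_mulVec] at h1
    exact (smul_eq_zero.1 h1).resolve_left hN
  have hcard2 : Fintype.card (Option J) ≤ Fintype.card I := by
    refine card_le_of_injective R (X m₀).mulVecLin
      ((injective_iff_map_eq_zero _).2 fun v hv => ?_)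
    have h1 : (Y m₀).mulVec v = 0 := by
      rw [← hGX, ← Matrix.mulVec_mulVec, show (X m₀).mulVec v = 0 from hv, Matrix.mulVec_zero]
    by_contra hv0
    exact hlm₀ ((hYdet m₀ hm₀).symm.trans (Matrix.exists_mulVec_eq_zero_iff.1 ⟨v, hv0, h1⟩))
  let e : I ≃ Option J := Fintype.equivOfCardEq (le_antisymm hcard1 hcard2)
  let G' : Matrix (Option J) (Option J) R := G.submatrix id e.symm
  refine ⟨G'.det, ?_, fun m hm => ⟨((X m).submatrix e.symm id).det, ?_⟩⟩
  · rw [RingHom.map_det]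
    let κ : U →+ F := φ.toAddMonoidHom.comp l
    refine Matrix.exists_vecMul_eq_zero_iff.1
      ⟨fun o => o.elim 1 fun d => - κ (DB.gen (d.rep DB)), fun h => ?_, ?_⟩
    · exact one_ne_zero (congrFun h none)
    · ext o
      have h1 := DB.eq_sum_orbitHom_mul hn hτn hφz κ
        (fun x => by simp [κ, hl]) hφl (DA.gen ((e.symm o).rep DA))
      simp only [Matrix.vecMul, dotProduct, Fintype.sum_option, Option.elim]
      rw [Pi.zero_apply, one_mul, ← eq_neg_iff_add_eq_zero, ← sum_neg_distrib]
      refine h1.trans (sum_congr rfl fun d _ => ?_)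
      rw [← map_orbitHom, neg_mul, neg_neg, mul_comm]
      rfl
  · rw [← Matrix.det_mul, Matrix.submatrix_mul_equiv, hGX, Matrix.submatrix_id_id, hYdet m hm]

end ValuationFrame

section OrderAtPrime

variable {D L : Type*} [CommRing D] [IsDomain D] [Field L] [Algebra D L]

theorem multiplicity_mul_of_prime [UniqueFactorizationMonoid D] {f a b : D} (hf : Prime f)
    (ha : a ≠ 0) (hb : b ≠ 0) :
    multiplicity f (a * b) = multiplicity f a + multiplicity f b :=
  multiplicity_mul hf (.of_prime_left hf (mul_ne_zero ha hb))

theorem dvd_of_multiplicity_le [UniqueFactorizationMonoid D] {a : D} :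
    ∀ {b : D}, a ≠ 0 → b ≠ 0 → (∀ f, Prime f → multiplicity f a ≤ multiplicity f b) → a ∣ b := by
  refine UniqueFactorizationMonoid.induction_on_prime
    (P := fun a => ∀ {b : D}, a ≠ 0 → b ≠ 0 →
      (∀ f, Prime f → multiplicity f a ≤ multiplicity f b) → a ∣ b) a ?_ ?_ ?_
  · intro b h
    exact absurd rfl h
  · intro x hx b _ _ _
    exact hx.dvd
  · intro a p ha hp ih b _ hb h
    have h1 := h p hp
    rw [multiplicity_mul_of_prime hp hp.ne_zero ha, multiplicity_self] at h1
    have h2 : p ∣ b := by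
      by_contra hpb
      rw [multiplicity_eq_zero.2 hpb] at h1
      omega
    obtain ⟨b, rfl⟩ := h2
    have hb' : b ≠ 0 := right_ne_zero_of_mul hb
    refine mul_dvd_mul_left p (ih ha hb' fun f hf => ?_)
    have h3 := h f hf
    rw [multiplicity_mul_of_prime hf hp.ne_zero ha, multiplicity_mul_of_prime hf hp.ne_zero hb']
      at h3
    omega

variable (D) in
/-- Nonzero fractions of elements of `D`. -/
def IsNonzeroFraction (x : L) : Prop :=
  ∃ a b : D, a ≠ 0 ∧ b ≠ 0 ∧ x * algebraMap D L b = algebraMap D L a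

theorem IsNonzeroFraction.mul {x y : L} (hx : IsNonzeroFraction D x)
    (hy : IsNonzeroFraction D y) : IsNonzeroFraction D (x * y) := by
  obtain ⟨a, b, ha, hb, h⟩ := hx
  obtain ⟨c, d, hc, hd, h'⟩ := hy
  refine ⟨a * c, b * d, mul_ne_zero ha hc, mul_ne_zero hb hd, ?_⟩
  rw [map_mul, map_mul, ← h, ← h']
  ring

theorem isNonzeroFraction_of_isFractionRing [IsFractionRing D L] {x : L} (hx : x ≠ 0) :
    IsNonzeroFraction D x := by
  obtain ⟨a, b, hb, rfl⟩ := IsFractionRing.div_surjective (A := D) x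
  have hb' : algebraMap D L b ≠ 0 :=
    IsFractionRing.to_map_ne_zero_of_mem_nonZeroDivisors hb
  refine ⟨a, b, ?_, nonZeroDivisors.ne_zero hb, div_mul_cancel₀ _ hb'⟩
  rintro rfl
  simp at hx

open Classical in
/-- The order at `f` of a fraction of elements of `D`. -/
noncomputable def ordAt (f : D) (x : L) : ℤ :=
  if h : IsNonzeroFraction D x then
    (multiplicity f h.choose : ℤ) - multiplicity f h.choose_spec.choose
  else 0

variable [UniqueFactorizationMonoid D] [FaithfulSMul D L]

theorem ordAt_eq {f : D} (hf : Prime f) {x : L} {a b : D} (ha : a ≠ 0) (hb : b ≠ 0)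
    (h : x * algebraMap D L b = algebraMap D L a) :
    ordAt f x = (multiplicity f a : ℤ) - multiplicity f b := by
  have hx : IsNonzeroFraction D x := ⟨a, b, ha, hb, h⟩
  rw [ordAt, dif_pos hx]
  set c := hx.choose
  set d := hx.choose_spec.choose
  obtain ⟨hc, hd, h'⟩ : c ≠ 0 ∧ d ≠ 0 ∧ x * algebraMap D L d = algebraMap D L c :=
    hx.choose_spec.choose_spec
  have h1 : c * b = a * d := by
    apply FaithfulSMul.algebraMap_injective D L
    rw [map_mul, map_mul, ← h, ← h']
    ring
  have h2 := congrArg (multiplicity f) h1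
  rw [multiplicity_mul_of_prime hf hc hb, multiplicity_mul_of_prime hf ha hd] at h2
  change (multiplicity f c : ℤ) - multiplicity f d = _
  omega

theorem ordAt_algebraMap {f : D} (hf : Prime f) {a : D} (ha : a ≠ 0) :
    ordAt f (algebraMap D L a) = multiplicity f a := by
  rw [ordAt_eq hf ha one_ne_zero (by simp), multiplicity_of_one_right hf.not_isUnit]
  simp

theorem ordAt_mul {f : D} (hf : Prime f) {x y : L} (hx : IsNonzeroFraction D x)
    (hy : IsNonzeroFraction D y) : ordAt f (x * y) = ordAt f x + ordAt f y := by
  obtain ⟨a, b, ha, hb, h⟩ := hx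
  obtain ⟨c, d, hc, hd, h'⟩ := hy
  rw [ordAt_eq hf ha hb h, ordAt_eq hf hc hd h',
    ordAt_eq hf (mul_ne_zero ha hc) (mul_ne_zero hb hd)
      (by rw [map_mul, map_mul, ← h, ← h']; ring),
    multiplicity_mul_of_prime hf ha hc, multiplicity_mul_of_prime hf hb hd]
  push_cast
  ring

theorem ordAt_congr_associated {f g : D} (hf : Prime f) (hfg : Associated f g) {x : L}
    (hx : IsNonzeroFraction D x) : ordAt f x = ordAt g x := by
  obtain ⟨a, b, ha, hb, h⟩ := hx
  rw [ordAt_eq hf ha hb h, ordAt_eq (hfg.prime hf) ha hb h,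
    multiplicity_eq_of_associated_left hfg, multiplicity_eq_of_associated_left hfg]

theorem ordAt_map {f : D} (hf : Prime f) (T : L ≃+* L) (TD : D ≃+* D)
    (hT : ∀ a, T (algebraMap D L a) = algebraMap D L (TD a)) {x : L}
    (hx : IsNonzeroFraction D x) : ordAt (TD f) (T x) = ordAt f x := by
  obtain ⟨a, b, ha, hb, h⟩ := hx
  have hTf : Prime (TD f) := (MulEquiv.prime_iff TD.toMulEquiv).2 hf
  rw [ordAt_eq hf ha hb h, ordAt_eq (a := TD a) (b := TD b) hTf (by simpa) (by simpa)
    (by rw [← hT, ← hT, ← map_mul, h]), multiplicity_map_eq, multiplicity_map_eq]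

end OrderAtPrime

/-- The group of units of `R`, as a subgroup of the units of the ambient field. -/
def unitSubgroup {K L : Type*} [CommRing K] [Field L] [Algebra K L] (R : Subalgebra K L) :
    Subgroup Lˣ where
  carrier := {x | (x : L) ∈ R ∧ ((x⁻¹ : Lˣ) : L) ∈ R}
  mul_mem' := by
    rintro x y ⟨hx, hx'⟩ ⟨hy, hy'⟩
    refine ⟨by simpa using mul_mem hx hy, ?_⟩
    rw [mul_inv, Units.val_mul]
    exact mul_mem hx' hy'
  one_mem' := by simp [one_mem]
  inv_mem' := by
    rintro x ⟨hx, hx'⟩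
    exact ⟨hx', by simpa using hx⟩

/-- The units of a localization `R = D[1/s]` of a factorial ring carry a valuation frame indexed
by the prime divisors of `s`. -/
theorem exists_valuationFrame {K : Type*} {L : Type u} [CommRing K] [Field L] [Algebra K L]
    (D R : Subalgebra K L) [UniqueFactorizationMonoid D] (hDR : D ≤ R) {s : L} (hsD : s ∈ D)
    (hs : s ≠ 0) (hsR : s⁻¹ ∈ R) (hR : ∀ x ∈ R, ∃ k : ℕ, x * s ^ k ∈ D) (T : L ≃+* L)
    (hTD : ∀ x, x ∈ D ↔ T x ∈ D) (hTs : T s = s)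
    (τ : Additive (unitSubgroup R) →+ Additive (unitSubgroup R))
    (hτ : ∀ x, ((τ x).toMul : Lˣ) = Units.map (T : L →* L) (x.toMul : Lˣ)) :
    ∃ (S : Type u) (_ : Finite S) (V : ValuationFrame τ S), ∀ x,
      (∀ P, V.ord P x = 0) ↔ (x.toMul : Lˣ) ∈ unitSubgroup D := by
  classical
  let sD : D := ⟨s, hsD⟩
  have hsD0 : sD ≠ 0 := fun h => hs (congrArg Subtype.val h)
  let TD : D ≃+* D := RingEquiv.restrict T D D hTD
  have hTDval : ∀ a : D, T (algebraMap D L a) = algebraMap D L (TD a) := fun a => rfl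
  have hTDs : TD sD = sD := Subtype.ext hTs
  let S := {q : Associates D // Irreducible q ∧ q ∣ Associates.mk sD}
  have hfin : Finite S := by
    have : Fintype (Associates D)ˣ := Fintype.ofFinite _
    have := UniqueFactorizationMonoid.fintypeSubtypeDvd (Associates.mk sD)
      (Associates.mk_ne_zero.2 hsD0)
    exact Finite.of_injective
      (fun q : S => (⟨q.1, q.2.2⟩ : {x : Associates D // x ∣ Associates.mk sD}))
      fun q q' h => Subtype.ext (Subtype.mk.inj h)
  let f : S → D := fun q => Quotient.out q.1
  have hmk : ∀ q, Associates.mk (f q) = q.1 := fun q => Quotient.out_eq q.1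
  have hfp : ∀ q, Prime (f q) := by
    intro q
    rw [← UniqueFactorizationMonoid.irreducible_iff_prime, ← Associates.irreducible_mk, hmk]
    exact q.2.1
  have hfs : ∀ q, f q ∣ sD := by
    intro q
    rw [← Associates.mk_dvd_mk, hmk]
    exact q.2.2
  have hex : ∀ g : D, Prime g → g ∣ sD → ∃ q, Associated (f q) g := by
    intro g hg hgs
    let q : S := ⟨Associates.mk g, Associates.irreducible_mk.2 hg.irreducible,
      Associates.mk_dvd_mk.2 hgs⟩
    exact ⟨q, Associates.mk_eq_mk_iff_associated.1 (hmk q)⟩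
  have huniq : ∀ q q', Associated (f q) (f q') → q = q' := by
    intro q q' h
    exact Subtype.ext (by rw [← hmk, ← hmk]; exact Associates.mk_eq_mk_iff_associated.2 h)
  have hTp : ∀ {g : D}, Prime g → Prime (TD g) :=
    fun hg => (MulEquiv.prime_iff TD.toMulEquiv).2 hg
  choose π hπ using fun q => hex (TD (f q)) (hTp (hfp q)) (hTDs ▸ map_dvd TD (hfs q))
  have hπinj : Function.Injective π := by
    intro q q' h
    have h1 : Associated (TD (f q)) (TD (f q')) := (hπ q).symm.trans (h ▸ hπ q')
    refine huniq _ _ ?_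
    simpa using h1.map TD.symm
  have hfrac : ∀ x : Lˣ, (x : L) ∈ R → ∃ k, ∃ a : D, a ≠ 0 ∧
      (x : L) * algebraMap D L (sD ^ k) = algebraMap D L a := by
    intro x hx
    obtain ⟨k, hk⟩ := hR x hx
    refine ⟨k, ⟨_, hk⟩, fun h => ?_, ?_⟩
    · exact mul_ne_zero x.ne_zero (pow_ne_zero k hs) (congrArg Subtype.val h)
    · rw [map_pow]; rfl
  have hU : ∀ x : Additive (unitSubgroup R), IsNonzeroFraction D ((x.toMul : Lˣ) : L) := by
    intro x
    obtain ⟨k, a, ha, h⟩ := hfrac x.toMul x.toMul.2.1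
    exact ⟨a, _, ha, pow_ne_zero k hsD0, h⟩
  let v : S → Additive (unitSubgroup R) →+ ℤ := fun q =>
    AddMonoidHom.mk' (fun x => ordAt (f q) ((x.toMul : Lˣ) : L)) fun x y => by
      rw [← ordAt_mul (hfp q) (hU x) (hU y)]
      rfl
  have hfL : ∀ q, (f q : L) ≠ 0 := fun q h => (hfp q).ne_zero (Subtype.ext h)
  have hfinv : ∀ q, (f q : L)⁻¹ ∈ R := by
    intro q
    obtain ⟨c, hc⟩ := hfs q
    have hc' : (f q : L)⁻¹ = c * s⁻¹ := by
      have h1 : s = f q * c := congrArg Subtype.val hc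
      rw [eq_mul_inv_iff_mul_eq₀ hs, h1, inv_mul_cancel_left₀ (hfL q)]
    rw [hc']
    exact mul_mem (hDR c.2) hsR
  let g : S → Additive (unitSubgroup R) := fun q =>
    Additive.ofMul ⟨Units.mk0 (f q : L) (hfL q), hDR (f q).2, by simpa using hfinv q⟩
  have hvg : ∀ q q', v q (g q') = multiplicity (f q) (f q') := fun q q' =>
    ordAt_algebraMap (hfp q) (hfp q').ne_zero
  refine ⟨S, hfin, ⟨Equiv.ofBijective π (Finite.injective_iff_bijective.1 hπinj), v, g, ?_, ?_, ?_⟩,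
    ?_⟩
  · intro q
    rw [hvg, multiplicity_self, Nat.cast_one]
  · intro q q' hqq'
    rw [hvg, multiplicity_eq_zero.2, Nat.cast_zero]
    intro h
    exact hqq' (huniq _ _ ((hfp q).irreducible.associated_of_dvd (hfp q').irreducible h))
  · intro q x
    change ordAt (f (π q)) (((τ x).toMul : Lˣ) : L) = ordAt (f q) ((x.toMul : Lˣ) : L)
    have h1 := ordAt_map (hfp q) T TD hTDval (hU x)
    have h2 := ordAt_congr_associated (hfp _) (hπ q) (hU (τ x))
    rw [h2, ← h1, hτ]
    rfl
  · intro x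
    constructor
    · intro hx
      have key : ∀ y : Additive (unitSubgroup R), (∀ q, v q y = 0) → ((y.toMul : Lˣ) : L) ∈ D := by
        intro y hy
        obtain ⟨k, a, ha, hka⟩ := hfrac y.toMul y.toMul.2.1
        have hdvd : sD ^ k ∣ a := by
          refine dvd_of_multiplicity_le (pow_ne_zero k hsD0) ha fun p hp => ?_
          by_cases hps : p ∣ sD
          · obtain ⟨q, hq⟩ := hex p hp hps
            have h1 : ordAt (f q) ((y.toMul : Lˣ) : L) = 0 := hy q
            rw [ordAt_eq (hfp q) ha (pow_ne_zero k hsD0) hka] at h1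
            rw [multiplicity_eq_of_associated_left hq, multiplicity_eq_of_associated_left hq]
            omega
          · rw [multiplicity_eq_zero.2 fun h => hps (hp.dvd_of_dvd_pow h)]
            exact Nat.zero_le _
        obtain ⟨c, rfl⟩ := hdvd
        have hc : ((y.toMul : Lˣ) : L) = c := by
          have h2 : algebraMap D L (sD ^ k) ≠ 0 := by
            rw [map_pow]; exact pow_ne_zero k hs
          rw [map_mul, mul_comm] at hka
          exact mul_left_cancel₀ h2 hka
        rw [hc]
        exact c.2
      exact ⟨key x hx, key (-x) fun q => by rw [map_neg, hx q, neg_zero]⟩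
    · rintro ⟨h1, h2⟩ q
      let a : D := ⟨_, h1⟩
      let b : D := ⟨_, h2⟩
      have hab : a * b = 1 := Subtype.ext (by simp [a, b])
      have ha : IsUnit a := IsUnit.of_mul_eq_one _ hab
      change ordAt (f q) (algebraMap D L a) = 0
      rw [ordAt_algebraMap (hfp q) ha.ne_zero, multiplicity_eq_zero.2, Nat.cast_zero]
      exact fun h => (hfp q).not_isUnit (isUnit_of_dvd_unit h ha)

section FactorialModels

variable {K : Type*} {L : Type u} [CommRing K] [Field L] [Algebra K L]

theorem Subalgebra.clears_adjoin (A : Subalgebra K L) {a : L} (ha : a ∈ A) {G : Set L}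
    (hG : ∀ x ∈ G, ∃ k : ℕ, x * a ^ k ∈ A) {x : L} (hx : x ∈ Algebra.adjoin K G) :
    ∃ k : ℕ, x * a ^ k ∈ A := by
  induction hx using Algebra.adjoin_induction with
  | mem x hx => exact hG x hx
  | algebraMap r => exact ⟨0, by simp⟩
  | add x y _ _ hx hy =>
    obtain ⟨k, hk⟩ := hx
    obtain ⟨m, hm⟩ := hy
    refine ⟨k + m, ?_⟩
    have : (x + y) * a ^ (k + m) = x * a ^ k * a ^ m + y * a ^ m * a ^ k := by ring
    rw [this]
    exact add_mem (mul_mem hk (pow_mem ha m)) (mul_mem hm (pow_mem ha k))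
  | mul x y _ _ hx hy =>
    obtain ⟨k, hk⟩ := hx
    obtain ⟨m, hm⟩ := hy
    refine ⟨k + m, ?_⟩
    have : (x * y) * a ^ (k + m) = x * a ^ k * (y * a ^ m) := by ring
    rw [this]
    exact mul_mem hk hm

theorem Subalgebra.exists_clearing (A : Subalgebra K L) {G : Set L} (hGfin : G.Finite)
    (hG : ∀ x ∈ G, ∃ a ∈ A, a ≠ 0 ∧ x * a ∈ A) (T : L ≃+* L) {n : ℕ} (hn : 0 < n)
    (hTn : ∀ x, T^[n] x = x) (hTA : ∀ x ∈ A, T x ∈ A) :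
    ∃ a ∈ A, a ≠ 0 ∧ T a = a ∧ ∀ x ∈ Algebra.adjoin K G, ∃ k : ℕ, x * a ^ k ∈ A := by
  classical
  choose! d hdA hd0 hd using hG
  let a₀ := ∏ x ∈ hGfin.toFinset, d x
  have ha₀ : a₀ ∈ A := prod_mem fun x hx => hdA x (by simpa using hx)
  have ha₀0 : a₀ ≠ 0 := Finset.prod_ne_zero_iff.2 fun x hx => hd0 x (by simpa using hx)
  have hit : ∀ i : ℕ, T^[i] a₀ ∈ A ∧ T^[i] a₀ ≠ 0 := by
    intro i
    induction i with
    | zero => exact ⟨ha₀, ha₀0⟩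
    | succ i ih =>
      rw [Function.iterate_succ_apply']
      exact ⟨hTA _ ih.1, by simpa using ih.2⟩
  let a := ∏ i ∈ Finset.range n, T^[i] a₀
  have haA : a ∈ A := prod_mem fun i _ => (hit i).1
  obtain ⟨m, rfl⟩ : ∃ m, n = m + 1 := ⟨n - 1, by omega⟩
  refine ⟨a, haA, Finset.prod_ne_zero_iff.2 fun i _ => (hit i).2, ?_, fun x hx => ?_⟩
  · simp only [a, map_prod, ← Function.iterate_succ_apply' (⇑T)]
    rw [Finset.prod_range_succ, hTn, Finset.prod_range_succ']
    rfl
  · refine A.clears_adjoin haA (fun x hx => ⟨1, ?_⟩) hx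
    have h1 : x * a₀ ∈ A := by
      have hx' : x ∈ hGfin.toFinset := by simpa using hx
      rw [show a₀ = d x * ∏ y ∈ hGfin.toFinset.erase x, d y from
        (Finset.mul_prod_erase _ d hx').symm, ← mul_assoc]
      exact mul_mem (hd x hx) (prod_mem fun y hy => hdA y (by
        simpa using Finset.mem_of_mem_erase hy))
    rw [pow_one, show a = (∏ i ∈ Finset.range m, T^[i + 1] a₀) * a₀ from
      Finset.prod_range_succ' _ _, mul_comm (∏ i ∈ _, _), ← mul_assoc]
    exact mul_mem h1 (prod_mem fun i _ => (hit _).1)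

/-- The common localization of two subalgebras `A` and `B` at elements `a` and `b`. -/
def commonLocalization (A B : Subalgebra K L) (a b : L) : Subalgebra K L :=
  Algebra.adjoin K (A ∪ B ∪ {a⁻¹, b⁻¹})

theorem commonLocalization_comm (A B : Subalgebra K L) (a b : L) :
    commonLocalization B A b a = commonLocalization A B a b := by
  rw [commonLocalization, commonLocalization, Set.union_comm (A : Set L), Set.pair_comm a⁻¹]

theorem le_commonLocalization_left (A B : Subalgebra K L) (a b : L) :
    A ≤ commonLocalization A B a b :=
  fun _ hx => Algebra.subset_adjoin (Or.inl (Or.inl hx))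

theorem exists_valuationFrame_commonLocalization (A B : Subalgebra K L)
    [UniqueFactorizationMonoid A] {a b : L} (ha : a ∈ A) (ha0 : a ≠ 0) (hb : b ∈ B) (hb0 : b ≠ 0)
    (hBA : ∀ x ∈ B, ∃ k : ℕ, x * a ^ k ∈ A) (T : L ≃+* L) (hTa : T a = a) (hTb : T b = b)
    (hTA : ∀ x, x ∈ A ↔ T x ∈ A)
    (τ : Additive (unitSubgroup (commonLocalization A B a b)) →+
      Additive (unitSubgroup (commonLocalization A B a b)))
    (hτ : ∀ x, ((τ x).toMul : Lˣ) = Units.map (T : L →* L) (x.toMul : Lˣ)) :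
    ∃ (S : Type u) (_ : Finite S) (V : ValuationFrame τ S), ∀ x,
      (∀ P, V.ord P x = 0) ↔ (x.toMul : Lˣ) ∈ unitSubgroup A := by
  obtain ⟨k, hk⟩ := hBA b hb
  have hs : b * a ^ k * a ∈ A := mul_mem hk ha
  have hainv : a⁻¹ ∈ commonLocalization A B a b := Algebra.subset_adjoin (Or.inr (by simp))
  have hbinv : b⁻¹ ∈ commonLocalization A B a b := Algebra.subset_adjoin (Or.inr (by simp))
  refine exists_valuationFrame A _ (le_commonLocalization_left A B a b) hs
    (mul_ne_zero (mul_ne_zero hb0 (pow_ne_zero k ha0)) ha0) ?_ (fun x hx => ?_) T hTA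
    (by simp [hTa, hTb]) τ hτ
  · rw [mul_inv, mul_inv, ← inv_pow]
    exact mul_mem (mul_mem hbinv (pow_mem hainv k)) hainv
  · refine A.clears_adjoin hs ?_ hx
    rintro x ((hx | hx) | rfl | rfl)
    · exact ⟨0, by simpa using hx⟩
    · obtain ⟨m, hm⟩ := hBA x hx
      refine ⟨m, ?_⟩
      rw [mul_pow, mul_comm (_ ^ m) (a ^ m), ← mul_assoc]
      exact mul_mem hm (pow_mem hk m)
    · refine ⟨1, ?_⟩
      have : a⁻¹ * (b * a ^ k * a) ^ 1 = b * a ^ k := by field_simp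
      rwa [this]
    · refine ⟨1, ?_⟩
      have : b⁻¹ * (b * a ^ k * a) ^ 1 = a ^ k * a := by field_simp
      rw [this]
      exact mul_mem (pow_mem ha k) ha

/-- If two finitely generated factorial subalgebras of a field have the same fractions, then the
equivariant homomorphisms on their unit groups satisfy a divisibility constraint. -/
theorem exists_dvd_of_factorial_models {R F : Type*} [CommRing R] [IsDomain R] [CommRing F]
    [IsDomain F] (φ : R →+* F) {n : ℕ} (hn : 0 < n) {z : R} (hz : IsPrimitiveRoot z n)
    (hφz : IsPrimitiveRoot (φ z) n) (T : L ≃+* L) (hTn : ∀ x, T^[n] x = x)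
    (A B : Subalgebra K L) [UniqueFactorizationMonoid A] [UniqueFactorizationMonoid B]
    (hTA : ∀ x, x ∈ A ↔ T x ∈ A) (hTB : ∀ x, x ∈ B ↔ T x ∈ B)
    {G H : Set L} (hG : G.Finite) (hH : H.Finite) (hGA : Algebra.adjoin K G = A)
    (hHB : Algebra.adjoin K H = B) (hGB : ∀ x ∈ G, ∃ b ∈ B, b ≠ 0 ∧ x * b ∈ B)
    (hHA : ∀ x ∈ H, ∃ a ∈ A, a ≠ 0 ∧ x * a ∈ A) (hAB : unitSubgroup A ≤ unitSubgroup B)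
    (l : Additive Lˣ →+ R)
    (hl : ∀ x, l (Additive.ofMul (Units.map (T : L →* L) x)) = z * l (Additive.ofMul x))
    (hlA : ∀ x ∈ unitSubgroup A, l (Additive.ofMul x) = 0)
    (hφl : ∀ x ∈ unitSubgroup B, φ (l (Additive.ofMul x)) = 0)
    (hl0 : ∃ x ∈ unitSubgroup B, l (Additive.ofMul x) ≠ 0)
    (hrank : ∃ N : R, N ≠ 0 ∧ ∀ h : Additive (unitSubgroup B) →+ R,
      (∀ x y : unitSubgroup B, (y : Lˣ) = Units.map (T : L →* L) x →
        h (Additive.ofMul y) = z * h (Additive.ofMul x)) →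
      (∀ x : unitSubgroup B, (x : Lˣ) ∈ unitSubgroup A → h (Additive.ofMul x) = 0) →
      ∃ c, ∀ x : unitSubgroup B, N * h (Additive.ofMul x) = c * l (Additive.ofMul (x : Lˣ))) :
    ∃ α, φ α = 0 ∧ ∀ x ∈ unitSubgroup B, α ∣ l (Additive.ofMul x) := by
  obtain ⟨a, ha, ha0, hTa, haB⟩ := A.exists_clearing hH hHA T hn hTn fun x => (hTA x).1
  obtain ⟨b, hb, hb0, hTb, hbA⟩ := B.exists_clearing hG hGB T hn hTn fun x => (hTB x).1
  rw [hHB] at haB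
  rw [hGA] at hbA
  let E := commonLocalization A B a b
  have hBE : B ≤ E := by
    have := le_commonLocalization_left B A b a
    rwa [commonLocalization_comm] at this
  have hTE : ∀ x ∈ E, T x ∈ E := by
    intro x hx
    induction hx using Algebra.adjoin_induction with
    | mem x hx =>
      refine Algebra.subset_adjoin ?_
      rcases hx with (hx | hx) | rfl | rfl
      · exact Or.inl (Or.inl ((hTA x).1 hx))
      · exact Or.inl (Or.inr ((hTB x).1 hx))
      · exact Or.inr (by simp [hTa])
      · exact Or.inr (by simp [hTb])
    | algebraMap r =>
      exact le_commonLocalization_left A B a b ((hTA _).1 (A.algebraMap_mem r))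
    | add x y _ _ hx hy => rw [map_add]; exact add_mem hx hy
    | mul x y _ _ hx hy => rw [map_mul]; exact mul_mem hx hy
  have hTU : ∀ x ∈ unitSubgroup E, Units.map (T : L →* L) x ∈ unitSubgroup E :=
    fun x hx => ⟨hTE _ hx.1, hTE _ hx.2⟩
  let τ : Additive (unitSubgroup E) →+ Additive (unitSubgroup E) :=
    MonoidHom.toAdditive (((Units.map (T : L →* L)).comp (unitSubgroup E).subtype).codRestrict
      (unitSubgroup E) fun x => hTU x x.2)
  have hτ : ∀ x, ((τ x).toMul : Lˣ) = Units.map (T : L →* L) (x.toMul : Lˣ) := fun x => rfl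
  have hτn : ∀ x, τ^[n] x = x := by
    have h1 : ∀ (m : ℕ) x, (((τ^[m] x).toMul : Lˣ) : L) = T^[m] ((x.toMul : Lˣ) : L) := by
      intro m x
      induction m with
      | zero => rfl
      | succ m ih =>
        rw [Function.iterate_succ_apply', Function.iterate_succ_apply', ← ih]
        rfl
    intro x
    apply Additive.toMul.injective
    apply Subtype.ext
    apply Units.ext
    rw [h1, hTn]
  obtain ⟨SA, _, VA, hVA⟩ := exists_valuationFrame_commonLocalization A B ha ha0 hb hb0 haB T hTa
    hTb hTA τ hτ
  obtain ⟨SB, _, VB, hVB⟩ : ∃ (S : Type u) (_ : Finite S) (V : ValuationFrame τ S), ∀ x,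
      (∀ P, V.ord P x = 0) ↔ (x.toMul : Lˣ) ∈ unitSubgroup B := by
    have h := exists_valuationFrame_commonLocalization B A hb hb0 ha ha0 hbA T hTb hTa hTB
    rw [commonLocalization_comm] at h
    exact h τ hτ
  let ι : Additive (unitSubgroup E) →+ Additive Lˣ := MonoidHom.toAdditive (unitSubgroup E).subtype
  have hBE' : unitSubgroup B ≤ unitSubgroup E := fun x hx => ⟨hBE hx.1, hBE hx.2⟩
  obtain ⟨α, hα, hdvd⟩ := ValuationFrame.exists_dvd_of_frames φ hn hτn hz hφz VA VB (l.comp ι)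
    (fun x => hl _) (fun x hx => hlA _ ((hVA x).1 hx))
    (fun x hx => (hVB x).2 (hAB ((hVA x).1 hx))) (fun x hx => hφl _ ((hVB x).1 hx))
    (by
      obtain ⟨x, hx, h⟩ := hl0
      exact ⟨Additive.ofMul ⟨x, hBE' hx⟩, (hVB _).2 hx, h⟩)
    (by
      obtain ⟨N, hN, hrank⟩ := hrank
      refine ⟨N, hN, fun h hh hhA => ?_⟩
      obtain ⟨c, hc⟩ := hrank
        (h.comp (MonoidHom.toAdditive (Subgroup.inclusion hBE')))
        (fun x y hxy => by
          refine Eq.trans ?_ (hh (Additive.ofMul (Subgroup.inclusion hBE' x)))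
          exact congrArg h (Additive.toMul.injective (Subtype.ext hxy)))
        (fun x hx => hhA _ ((hVA _).2 hx))
      exact ⟨c, fun x hx => hc ⟨_, (hVB x).1 hx⟩⟩)
  exact ⟨α, hα, fun x hx => hdvd (Additive.ofMul ⟨x, hBE' hx⟩) ((hVB _).2 hx)⟩

end FactorialModels

section PolynomialAlgebras

open MvPolynomial

variable {ι K L : Type*} [Field K] [Field L] [Algebra K L]

theorem AlgebraicIndependent.uniqueFactorizationMonoid_adjoin {x : ι → L}
    (hx : AlgebraicIndependent K x) :
    UniqueFactorizationMonoid (Algebra.adjoin K (Set.range x)) :=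
  hx.aevalEquiv.toMulEquiv.uniqueFactorizationMonoid inferInstance

theorem AlgebraicIndependent.exists_algebraMap_eq_of_mem_unitSubgroup {x : ι → L}
    (hx : AlgebraicIndependent K x) {v : Lˣ}
    (hv : v ∈ unitSubgroup (Algebra.adjoin K (Set.range x))) : ∃ c, algebraMap K L c = v := by
  let a : Algebra.adjoin K (Set.range x) := ⟨_, hv.1⟩
  let b : Algebra.adjoin K (Set.range x) := ⟨_, hv.2⟩
  have hab : a * b = 1 := Subtype.ext (by simp [a, b])
  have ha : IsUnit (hx.aevalEquiv.symm a) := (IsUnit.of_mul_eq_one _ hab).map _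
  obtain ⟨c, -, hc⟩ := MvPolynomial.isUnit_iff_eq_C_of_isReduced.1 ha
  refine ⟨c, ?_⟩
  have h1 : (a : L) = aeval x (hx.aevalEquiv.symm a) := by
    rw [← hx.algebraMap_aevalEquiv, AlgEquiv.apply_symm_apply]
    rfl
  rw [hc, aeval_C] at h1
  exact h1.symm

theorem Subalgebra.uniqueFactorizationMonoid_of_clears {C B : Subalgebra K L}
    [UniqueFactorizationMonoid C] (hCB : C ≤ B) {w : L} (hw : w ∈ C) (hw0 : w ≠ 0) (hw' : w⁻¹ ∈ B)
    (hclear : ∀ x ∈ B, ∃ k : ℕ, x * w ^ k ∈ C) : UniqueFactorizationMonoid B := by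
  let wC : C := ⟨w, hw⟩
  let _ : Algebra C B := (Subalgebra.inclusion hCB).toRingHom.toAlgebra
  have hmap : ∀ c : C, ((algebraMap C B c : B) : L) = c := fun c => rfl
  have : IsLocalization.Away wC B := by
    refine ⟨⟨?_, ?_, ?_⟩⟩
    · rintro ⟨_, k, rfl⟩
      rw [map_pow]
      refine IsUnit.pow k (IsUnit.of_mul_eq_one ⟨_, hw'⟩ (Subtype.ext ?_))
      rw [MulMemClass.coe_mul, hmap]
      exact mul_inv_cancel₀ hw0
    · intro x
      obtain ⟨k, hk⟩ := hclear x x.2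
      refine ⟨⟨⟨_, hk⟩, ⟨wC ^ k, k, rfl⟩⟩, Subtype.ext ?_⟩
      rw [MulMemClass.coe_mul, hmap, hmap]
      rfl
    · intro x y h
      have h1 : x = y := Subtype.ext (by rw [← hmap, ← hmap, h])
      exact ⟨1, by rw [h1]⟩
  exact UniqueFactorizationMonoid.of_isLocalization (Submonoid.powers wC) B

theorem AlgebraicIndependent.uniqueFactorizationMonoid_adjoin_union_inv [Fintype ι] {v : ι → Lˣ}
    (hv : AlgebraicIndependent K fun i => (v i : L)) :
    UniqueFactorizationMonoid (Algebra.adjoin K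
      (Set.range (fun i => (v i : L)) ∪ Set.range fun i => ((v i)⁻¹ : Lˣ).val)) := by
  classical
  set C := Algebra.adjoin K (Set.range fun i => (v i : L)) with hC
  set B := Algebra.adjoin K
      (Set.range (fun i => (v i : L)) ∪ Set.range fun i => ((v i)⁻¹ : Lˣ).val)
  have hCB : C ≤ B := Algebra.adjoin_mono Set.subset_union_left
  have : UniqueFactorizationMonoid C := hv.uniqueFactorizationMonoid_adjoin
  let w : Lˣ := ∏ i, v i
  have hvC : ∀ i, (v i : L) ∈ C := fun i => Algebra.subset_adjoin ⟨i, rfl⟩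
  have hw : (w : L) ∈ C := by
    rw [Units.coe_prod]
    exact prod_mem fun i _ => hvC i
  have hw' : ((w⁻¹ : Lˣ) : L) ∈ B := by
    rw [← Finset.prod_inv_distrib, Units.coe_prod]
    exact prod_mem fun i _ => Algebra.subset_adjoin (Or.inr ⟨i, rfl⟩)
  have hclear : ∀ x ∈ B, ∃ k : ℕ, x * (w : L) ^ k ∈ C := by
    intro x hx
    refine C.clears_adjoin hw ?_ hx
    rintro _ (⟨i, rfl⟩ | ⟨i, rfl⟩)
    · exact ⟨0, by simpa using hvC i⟩
    · refine ⟨1, ?_⟩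
      have h1 : (v i)⁻¹ * w = ∏ j ∈ Finset.univ.erase i, v j := by
        rw [inv_mul_eq_iff_eq_mul, Finset.mul_prod_erase _ _ (Finset.mem_univ i)]
      dsimp only
      rw [pow_one, ← Units.val_mul, h1, Units.coe_prod]
      exact prod_mem fun i _ => hvC i
  exact Subalgebra.uniqueFactorizationMonoid_of_clears hCB hw w.ne_zero (by simpa using hw') hclear

variable [Algebra (MvPolynomial ι K) L] [IsScalarTower K (MvPolynomial ι K) L]
  [IsFractionRing (MvPolynomial ι K) L]

theorem IsFractionRing.adjoin_range_X_eq_top :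
    IntermediateField.adjoin K (Set.range fun i => algebraMap (MvPolynomial ι K) L (X i)) = ⊤ := by
  have h1 : ∀ q : MvPolynomial ι K, algebraMap (MvPolynomial ι K) L q ∈
      IntermediateField.adjoin K (Set.range fun i => algebraMap (MvPolynomial ι K) L (X i)) := by
    intro q
    induction q using MvPolynomial.induction_on with
    | C a =>
      rw [← algebraMap_eq, ← IsScalarTower.algebraMap_apply]
      exact IntermediateField.algebraMap_mem _ a
    | add p q hp hq => rw [map_add]; exact add_mem hp hq
    | mul_X p i hp =>
      rw [map_mul]
      exact mul_mem hp (IntermediateField.subset_adjoin _ _ ⟨i, rfl⟩)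
  rw [eq_top_iff]
  intro x _
  obtain ⟨a, b, -, rfl⟩ := IsFractionRing.div_surjective (A := MvPolynomial ι K) x
  exact div_mem (h1 a) (h1 b)

theorem IsFractionRing.algebraicIndependent_X :
    AlgebraicIndependent K fun i => algebraMap (MvPolynomial ι K) L (X i) := by
  rw [algebraicIndependent_iff_injective_aeval]
  convert IsFractionRing.injective (MvPolynomial ι K) L using 1
  have : aeval (fun i => algebraMap (MvPolynomial ι K) L (X i)) =
      IsScalarTower.toAlgHom K (MvPolynomial ι K) L := by
    ext i
    simp
  rw [this]
  rfl

open scoped IntermediateField.algebraAdjoinAdjoin in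
theorem IsFractionRing.algebraicIndependent_of_pow_mem [Finite ι] {x : ι → L}
    (hx : ∀ i, ∃ n > 0, algebraMap (MvPolynomial ι K) L (X i) ^ n ∈
      IntermediateField.adjoin K (Set.range x)) : AlgebraicIndependent K x := by
  let y : ι → L := fun i => algebraMap (MvPolynomial ι K) L (X i)
  have hy : AlgebraicIndependent K y := IsFractionRing.algebraicIndependent_X
  have halg : ∀ (z : ι → L), (∀ i, ∃ n > 0, y i ^ n ∈ IntermediateField.adjoin K (Set.range z)) →
      Algebra.IsAlgebraic (Algebra.adjoin K (Set.range z)) L := by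
    intro z hz
    let E := IntermediateField.adjoin K (Set.range z)
    have h1 : IntermediateField.adjoin E (Set.range y) = ⊤ := by
      apply IntermediateField.restrictScalars_injective K
      rw [IntermediateField.restrictScalars_top, eq_top_iff,
        ← IsFractionRing.adjoin_range_X_eq_top (ι := ι), IntermediateField.adjoin_le_iff]
      exact IntermediateField.subset_adjoin E (Set.range y)
    have h2 : Algebra.IsAlgebraic E L := by
      have : Algebra.IsAlgebraic E (IntermediateField.adjoin E (Set.range y)) := by
        apply IntermediateField.isAlgebraic_adjoin
        rintro _ ⟨i, rfl⟩
        obtain ⟨n, hn, h⟩ := hz i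
        refine IsIntegral.of_pow hn ?_
        exact isIntegral_algebraMap (R := E) (A := L) (x := ⟨_, h⟩)
      rw [h1] at this
      exact IntermediateField.topEquiv.isAlgebraic_iff.1 this
    exact (IsFractionRing.comap_isAlgebraic_iff (K := E)).2 h2
  have hyb : IsTranscendenceBasis K y := by
    rw [hy.isTranscendenceBasis_iff_isAlgebraic]
    exact halg y fun i => ⟨1, one_pos, IntermediateField.subset_adjoin _ _ ⟨i, by simp⟩⟩
  have := halg x hx
  exact (Algebra.IsAlgebraic.isTranscendenceBasis_of_lift_le_trdeg_of_finite K x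
    (by rw [← hyb.lift_cardinalMk_eq_trdeg])).1

end PolynomialAlgebras

section LaurentMonomials

open MvPolynomial

variable {ι : Type*} (K : Type*) {L : Type*} [Field K] [Field L] [Algebra (MvPolynomial ι K) L]
  [IsFractionRing (MvPolynomial ι K) L]

theorem algebraMap_X_ne_zero (i : ι) : algebraMap (MvPolynomial ι K) L (X i) ≠ 0 := by
  simp

/-- The variables as units of the field of rational functions. -/
noncomputable def coordUnit (i : ι) : Lˣ :=
  Units.mk0 (algebraMap (MvPolynomial ι K) L (X i)) (algebraMap_X_ne_zero K i)

/-- The order of vanishing along a coordinate hyperplane. -/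
noncomputable def coordOrd (i : ι) : Additive Lˣ →+ ℤ :=
  AddMonoidHom.mk' (fun x => ordAt (X i : MvPolynomial ι K) ((x.toMul : Lˣ) : L)) fun x y =>
    ordAt_mul X_prime (isNonzeroFraction_of_isFractionRing x.toMul.ne_zero)
      (isNonzeroFraction_of_isFractionRing y.toMul.ne_zero)

theorem coordOrd_ofMul (i : ι) (x : Lˣ) :
    coordOrd K i (Additive.ofMul x) = ordAt (X i : MvPolynomial ι K) (x : L) := rfl

theorem multiplicity_X_X [DecidableEq ι] (i j : ι) :
    multiplicity (X i : MvPolynomial ι K) (X j) = if i = j then 1 else 0 := by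
  split_ifs with h
  · rw [h, multiplicity_self]
  · rw [multiplicity_eq_zero]
    intro h'
    exact h (by simpa using (X_dvd_X (R := K)).1 h')

theorem coordOrd_coordUnit [DecidableEq ι] (i j : ι) :
    coordOrd K i (Additive.ofMul (coordUnit K j : Lˣ)) = if i = j then 1 else 0 := by
  change ordAt (X i : MvPolynomial ι K) (algebraMap (MvPolynomial ι K) L (X j)) = _
  rw [ordAt_algebraMap X_prime (X_ne_zero j), multiplicity_X_X]
  split_ifs <;> rfl

theorem coordOrd_map (T : L ≃+* L) (TP : MvPolynomial ι K ≃+* MvPolynomial ι K)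
    (hT : ∀ a, T (algebraMap _ L a) = algebraMap _ L (TP a)) (e : ι → ι)
    (hTP : ∀ i, TP (X i) = X (e i)) (i : ι) (x : Lˣ) :
    coordOrd K (e i) (Additive.ofMul (Units.map (T : L →* L) x)) =
      coordOrd K i (Additive.ofMul x) := by
  rw [coordOrd_ofMul, coordOrd_ofMul, ← hTP]
  exact ordAt_map X_prime T TP hT (isNonzeroFraction_of_isFractionRing x.ne_zero)

variable [Fintype ι]

/-- Monomials with integer exponents. -/
noncomputable def laurentMonomial (m : ι → ℤ) : Lˣ := ∏ i, coordUnit K i ^ m i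

theorem laurentMonomial_add (m m' : ι → ℤ) :
    (laurentMonomial K (m + m') : Lˣ) = laurentMonomial K m * laurentMonomial K m' := by
  simp [laurentMonomial, zpow_add, Finset.prod_mul_distrib]

theorem laurentMonomial_neg (m : ι → ℤ) :
    (laurentMonomial K (-m) : Lˣ) = (laurentMonomial K m)⁻¹ := by
  simp [laurentMonomial]

theorem laurentMonomial_zsmul (n : ℤ) (m : ι → ℤ) :
    (laurentMonomial K (n • m) : Lˣ) = laurentMonomial K m ^ n := by
  simp [laurentMonomial, ← Finset.prod_zpow, ← zpow_mul, mul_comm]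

theorem laurentMonomial_sum {κ : Type*} (s : Finset κ) (m : κ → ι → ℤ) :
    (laurentMonomial K (∑ k ∈ s, m k) : Lˣ) = ∏ k ∈ s, laurentMonomial K (m k) := by
  classical
  induction s using Finset.induction_on with
  | empty => simp [laurentMonomial]
  | insert a s ha ih => rw [Finset.sum_insert ha, Finset.prod_insert ha, laurentMonomial_add, ih]

theorem laurentMonomial_single [DecidableEq ι] (i : ι) (n : ℤ) :
    (laurentMonomial K (Pi.single i n) : Lˣ) = coordUnit K i ^ n := by
  rw [laurentMonomial, Finset.prod_eq_single i]
  · simp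
  · intro j _ hj
    simp [Pi.single_eq_of_ne hj]
  · simp

theorem coordOrd_laurentMonomial (i : ι) (m : ι → ℤ) :
    coordOrd K i (Additive.ofMul (laurentMonomial K m : Lˣ)) = m i := by
  classical
  rw [laurentMonomial, ofMul_prod, map_sum]
  simp [coordOrd_coordUnit]

variable [Algebra K L]

/-- The algebra of Laurent polynomials. -/
noncomputable def laurentAlgebra : Subalgebra K L :=
  Algebra.adjoin K (Set.range fun m : ι → ℤ => ((laurentMonomial K m : Lˣ) : L))

theorem laurentMonomial_mem_laurentAlgebra (m : ι → ℤ) :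
    ((laurentMonomial K m : Lˣ) : L) ∈ laurentAlgebra (ι := ι) (L := L) K :=
  Algebra.subset_adjoin ⟨m, rfl⟩

variable [IsScalarTower K (MvPolynomial ι K) L]

omit [Fintype ι] in
theorem coordOrd_of_algebraMap (i : ι) {x : Lˣ} {c : K} (hc : algebraMap K L c = x) :
    coordOrd K i (Additive.ofMul x) = 0 := by
  have hc0 : c ≠ 0 := by
    rintro rfl
    exact x.ne_zero (by rw [← hc, map_zero])
  have hC : (C c : MvPolynomial ι K) ≠ 0 := by simpa using hc0
  rw [coordOrd_ofMul, ← hc, IsScalarTower.algebraMap_apply K (MvPolynomial ι K) L, algebraMap_eq,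
    ordAt_algebraMap X_prime hC, multiplicity_eq_zero.2, Nat.cast_zero]
  intro h
  exact X_prime.not_isUnit (isUnit_of_dvd_unit h ((IsUnit.mk0 c hc0).map C))

theorem exists_mul_prod_X_pow_eq {x : L} (hx : x ∈ laurentAlgebra (ι := ι) (L := L) K) :
    ∃ (k : ℕ) (a : MvPolynomial ι K),
      x * algebraMap (MvPolynomial ι K) L ((∏ i, X i) ^ k) = algebraMap _ L a := by
  let D : Subalgebra K L := (IsScalarTower.toAlgHom K (MvPolynomial ι K) L).range
  have hD : ∀ a, algebraMap (MvPolynomial ι K) L a ∈ D := fun a => ⟨a, rfl⟩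
  obtain ⟨k, a, ha⟩ := D.clears_adjoin (hD (∏ i, X i)) (G := Set.range fun m : ι → ℤ =>
    ((laurentMonomial K m : Lˣ) : L)) (by
      rintro _ ⟨m, rfl⟩
      refine ⟨∑ i, (m i).natAbs, ?_⟩
      have h1 : algebraMap (MvPolynomial ι K) L (∏ i, X i) = ∏ i, (coordUnit K i : Lˣ).val :=
        map_prod _ _ _
      have h2 : ((laurentMonomial K m : Lˣ) : L) = ∏ i, ((coordUnit K i ^ m i : Lˣ) : L) :=
        Units.coe_prod _ _
      dsimp only
      rw [h1, ← Finset.prod_pow, h2, ← Finset.prod_mul_distrib]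
      refine prod_mem fun i _ => ?_
      obtain ⟨n, hn⟩ : ∃ n : ℕ, m i + (∑ i, (m i).natAbs : ℕ) = n := by
        refine ⟨(m i + (∑ i, (m i).natAbs : ℕ)).toNat, ?_⟩
        have : (m i).natAbs ≤ ∑ i, (m i).natAbs :=
          Finset.single_le_sum (f := fun i => (m i).natAbs) (fun _ _ => Nat.zero_le _)
            (Finset.mem_univ i)
        omega
      rw [← Units.val_pow_eq_pow_val, ← Units.val_mul, ← zpow_natCast, ← zpow_add, hn,
        zpow_natCast, Units.val_pow_eq_pow_val]
      exact pow_mem (hD _) n) hx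
  exact ⟨k, a, by rw [map_pow]; exact ha.symm⟩

theorem exists_algebraMap_eq_of_coordOrd_eq_zero {x : Lˣ}
    (hx : (x : L) ∈ laurentAlgebra (ι := ι) (L := L) K)
    (h0 : ∀ i : ι, coordOrd K i (Additive.ofMul x) = 0) :
    ∃ a, algebraMap (MvPolynomial ι K) L a = x := by
  obtain ⟨k, a, ha⟩ := exists_mul_prod_X_pow_eq K hx
  have hs : (∏ i, X i : MvPolynomial ι K) ≠ 0 := Finset.prod_ne_zero_iff.2 fun i _ => X_ne_zero i
  have hsk := pow_ne_zero k hs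
  have hskL : algebraMap (MvPolynomial ι K) L ((∏ i, X i) ^ k) ≠ 0 :=
    (map_ne_zero_iff _ (IsFractionRing.injective _ _)).2 hsk
  have ha0 : a ≠ 0 := by
    rintro rfl
    rw [map_zero] at ha
    exact mul_ne_zero x.ne_zero hskL ha
  have hdvd : (∏ i, X i : MvPolynomial ι K) ^ k ∣ a := by
    refine dvd_of_multiplicity_le hsk ha0 fun f hf => ?_
    by_cases hfs : f ∣ ∏ i, X i
    · obtain ⟨i, -, hi⟩ := (Prime.dvd_finsetProd_iff hf _).1 hfs
      have h1 : Associated f (X i) := hf.irreducible.associated_of_dvd X_prime.irreducible hi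
      have h2 := h0 i
      rw [coordOrd_ofMul, ordAt_eq X_prime ha0 hsk ha] at h2
      rw [multiplicity_eq_of_associated_left h1.symm, multiplicity_eq_of_associated_left h1.symm]
      omega
    · rw [multiplicity_eq_zero.2 fun h => hfs (hf.dvd_of_dvd_pow h)]
      exact Nat.zero_le _
  obtain ⟨b, rfl⟩ := hdvd
  refine ⟨b, ?_⟩
  rw [map_mul, mul_comm] at ha
  exact (mul_left_cancel₀ hskL ha).symm

theorem exists_eq_mul_laurentMonomial {x : Lˣ}
    (hx : x ∈ unitSubgroup (laurentAlgebra (ι := ι) (L := L) K)) :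
    ∃ c : K, (x : L) = algebraMap K L c *
      (laurentMonomial K fun i : ι => coordOrd K i (Additive.ofMul x) : Lˣ) := by
  set m : ι → ℤ := fun i => coordOrd K i (Additive.ofMul x) with hm
  have key : ∀ z : Lˣ, (z : L) ∈ laurentAlgebra (ι := ι) (L := L) K →
      z = x * (laurentMonomial K m)⁻¹ ∨
      z = x⁻¹ * laurentMonomial K m → ∃ a, algebraMap (MvPolynomial ι K) L a = z := by
    intro z hz hz'
    refine exists_algebraMap_eq_of_coordOrd_eq_zero K hz fun i => ?_
    rcases hz' with rfl | rfl <;>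
    · rw [ofMul_mul, ofMul_inv, map_add, map_neg, coordOrd_laurentMonomial]
      simp [m]
  obtain ⟨a, ha⟩ := key (x * (laurentMonomial K m)⁻¹) (by
    rw [Units.val_mul, ← laurentMonomial_neg]
    exact mul_mem hx.1 (laurentMonomial_mem_laurentAlgebra K _)) (Or.inl rfl)
  obtain ⟨b, hb⟩ := key (x⁻¹ * laurentMonomial K m) (by
    rw [Units.val_mul]
    exact mul_mem hx.2 (laurentMonomial_mem_laurentAlgebra K _)) (Or.inr rfl)
  have hab : a * b = 1 := by
    apply IsFractionRing.injective (MvPolynomial ι K) L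
    rw [map_mul, ha, hb, map_one, ← Units.val_mul]
    rw [show x * (laurentMonomial K m)⁻¹ * (x⁻¹ * laurentMonomial K m) = 1 by
      rw [mul_mul_mul_comm, mul_inv_cancel, inv_mul_cancel, one_mul], Units.val_one]
  obtain ⟨c, -, rfl⟩ := MvPolynomial.isUnit_iff_eq_C_of_isReduced.1 (IsUnit.of_mul_eq_one _ hab)
  refine ⟨c, ?_⟩
  rw [IsScalarTower.algebraMap_apply K (MvPolynomial ι K) L, algebraMap_eq, ha, ← Units.val_mul,
    inv_mul_cancel_right]

end LaurentMonomials

theorem AddChar.map_sum_eq_prod' {A M ι : Type*} [AddCommMonoid A] [CommMonoid M]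
    (χ : AddChar A M) (f : ι → A) (s : Finset ι) : χ (∑ i ∈ s, f i) = ∏ i ∈ s, χ (f i) := by
  classical
  induction s using Finset.induction_on with
  | empty => simp
  | insert a s ha ih => rw [Finset.sum_insert ha, Finset.prod_insert ha, map_add_eq_mul, ih]

section TorusInvariants

open MvPolynomial

variable {p : ℕ} [Fact p.Prime] (K : Type*) {L : Type*} [Field K] [Field L]
  [Algebra (MvPolynomial (ZMod p) K) L] [IsFractionRing (MvPolynomial (ZMod p) K) L]

/-- The weight of a monomial for the action of a cyclic group by a faithful character. -/
def monomialWeight (m : ZMod p → ℤ) : ZMod p := ∑ i, i * (m i : ZMod p)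

theorem monomialWeight_add (m m' : ZMod p → ℤ) :
    monomialWeight (m + m') = monomialWeight m + monomialWeight m' := by
  simp [monomialWeight, mul_add, Finset.sum_add_distrib]

theorem monomialWeight_neg (m : ZMod p → ℤ) :
    monomialWeight (-m) = -monomialWeight m := by
  simp [monomialWeight]

theorem monomialWeight_single (i : ZMod p) (n : ℤ) :
    monomialWeight (Pi.single i n) = i * n := by
  rw [monomialWeight, Finset.sum_eq_single i]
  · simp
  · intro j _ hj
    simp [Pi.single_eq_of_ne hj]
  · simp

/-- A basis of the lattice of monomials of weight zero. -/
def weightZeroBasis (j : ZMod p) : ZMod p → ℤ :=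
  if j = 1 then Pi.single 1 (p : ℤ) else Pi.single j 1 - Pi.single 1 (j.val : ℤ)

theorem monomialWeight_weightZeroBasis (j : ZMod p) : monomialWeight (weightZeroBasis j) = 0 := by
  unfold weightZeroBasis
  split_ifs with h
  · simp [monomialWeight_single]
  · rw [sub_eq_add_neg, monomialWeight_add, monomialWeight_neg, monomialWeight_single,
      monomialWeight_single]
    simp

theorem exists_eq_sum_weightZeroBasis {m : ZMod p → ℤ} (hm : monomialWeight m = 0) :
    ∃ n : ZMod p → ℤ, m = ∑ j, n j • weightZeroBasis j := by
  have h1 : ((∑ j : ZMod p, (j.val : ℤ) * m j : ℤ) : ZMod p) = 0 := by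
    rw [← hm, monomialWeight]
    push_cast
    simp
  obtain ⟨k, hk⟩ := (ZMod.intCast_zmod_eq_zero_iff_dvd _ p).1 h1
  have h1val : (1 : ZMod p).val = 1 := ZMod.val_one p
  refine ⟨Function.update m 1 k, ?_⟩
  funext i
  rw [Finset.sum_apply, ← Finset.add_sum_erase _ _ (Finset.mem_univ 1)]
  rw [← Finset.add_sum_erase _ _ (Finset.mem_univ 1), h1val] at hk
  have h2 : ∀ j ∈ Finset.univ.erase (1 : ZMod p),
      (Function.update m 1 k j • weightZeroBasis j) i =
        m j * (Pi.single j 1 : ZMod p → ℤ) i - m j * (Pi.single 1 (j.val : ℤ) : ZMod p → ℤ) i := by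
    intro j hj
    have hj1 := Finset.ne_of_mem_erase hj
    rw [Function.update_of_ne hj1, weightZeroBasis, if_neg hj1]
    simp [mul_sub]
  rw [Finset.sum_congr rfl h2]
  by_cases hi : i = 1
  · subst hi
    rw [Finset.sum_congr rfl (g := fun j => -((j.val : ℤ) * m j)) (fun j hj => by
      rw [Pi.single_eq_of_ne (Finset.ne_of_mem_erase hj).symm, Pi.single_eq_same]
      ring)]
    rw [Finset.sum_neg_distrib]
    simp [weightZeroBasis]
    simp at hk
    linarith
  · rw [Finset.sum_eq_single i]
    · simp [weightZeroBasis, Pi.single_eq_of_ne hi]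
    · intro j _ hj
      simp [Pi.single_eq_of_ne hi, Pi.single_eq_of_ne hj.symm]
    · simp [hi]

variable [Algebra K L]

/-- The Laurent polynomials of weight zero. -/
noncomputable def torusInvariants (p : ℕ) [Fact p.Prime] (K L : Type*) [Field K] [Field L]
    [Algebra (MvPolynomial (ZMod p) K) L] [IsFractionRing (MvPolynomial (ZMod p) K) L]
    [Algebra K L] : Subalgebra K L :=
  Algebra.adjoin K {x | ∃ m : ZMod p → ℤ, monomialWeight m = 0 ∧ x = (laurentMonomial K m : Lˣ)}

theorem laurentMonomial_mem_torusInvariants {m : ZMod p → ℤ} (hm : monomialWeight m = 0) :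
    ((laurentMonomial K m : Lˣ) : L) ∈ torusInvariants p K L :=
  Algebra.subset_adjoin ⟨m, hm, rfl⟩

theorem laurentMonomial_mem_unitSubgroup {m : ZMod p → ℤ} (hm : monomialWeight m = 0) :
    (laurentMonomial K m : Lˣ) ∈ unitSubgroup (torusInvariants p K L) := by
  refine ⟨laurentMonomial_mem_torusInvariants K hm, ?_⟩
  rw [← laurentMonomial_neg]
  exact laurentMonomial_mem_torusInvariants K (by rw [monomialWeight_neg, hm, neg_zero])

theorem torusInvariants_le_laurentAlgebra :
    torusInvariants p K L ≤ laurentAlgebra (ι := ZMod p) K := by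
  refine Algebra.adjoin_mono ?_
  rintro _ ⟨m, -, rfl⟩
  exact ⟨m, rfl⟩

theorem adjoin_weightZeroBasis :
    Algebra.adjoin K (Set.range
      (fun j : ZMod p => ((laurentMonomial K (weightZeroBasis j) : Lˣ) : L)) ∪
      Set.range fun j : ZMod p => ((laurentMonomial K (weightZeroBasis j) : Lˣ)⁻¹ : Lˣ).val) =
      torusInvariants p K L := by
  apply le_antisymm
  · rw [Algebra.adjoin_le_iff]
    rintro _ (⟨j, rfl⟩ | ⟨j, rfl⟩)
    · exact (laurentMonomial_mem_unitSubgroup K (monomialWeight_weightZeroBasis j)).1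
    · exact (laurentMonomial_mem_unitSubgroup K (monomialWeight_weightZeroBasis j)).2
  · refine Algebra.adjoin_le ?_
    rintro _ ⟨m, hm, rfl⟩
    obtain ⟨n, rfl⟩ := exists_eq_sum_weightZeroBasis hm
    rw [laurentMonomial_sum, Units.coe_prod]
    refine prod_mem fun j _ => ?_
    rw [laurentMonomial_zsmul]
    obtain ⟨k, hk | hk⟩ := Int.eq_nat_or_neg (n j)
    · rw [hk, zpow_natCast, Units.val_pow_eq_pow_val]
      refine Subalgebra.pow_mem _ (Algebra.subset_adjoin ?_) k
      exact Set.mem_union_left _ (Set.mem_range_self j)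
    · rw [hk, zpow_neg, zpow_natCast, ← inv_pow, Units.val_pow_eq_pow_val]
      refine Subalgebra.pow_mem _ (Algebra.subset_adjoin ?_) k
      exact Set.mem_union_right _ (Set.mem_range_self j)

variable [IsScalarTower K (MvPolynomial (ZMod p) K) L]

theorem algebraicIndependent_weightZeroBasis :
    AlgebraicIndependent K fun j : ZMod p =>
      ((laurentMonomial K (weightZeroBasis j) : Lˣ) : L) := by
  refine IsFractionRing.algebraicIndependent_of_pow_mem fun i => ⟨p, (Fact.out : p.Prime).pos, ?_⟩
  set E := IntermediateField.adjoin K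
    (Set.range fun j : ZMod p => ((laurentMonomial K (weightZeroBasis j) : Lˣ) : L))
  have h1 : torusInvariants p K L ≤ E.toSubalgebra := by
    rw [← adjoin_weightZeroBasis, Algebra.adjoin_le_iff]
    rintro _ (⟨j, rfl⟩ | ⟨j, rfl⟩)
    · exact IntermediateField.subset_adjoin _ _ ⟨j, rfl⟩
    · dsimp only
      rw [Units.val_inv_eq_inv_val]
      exact inv_mem (S := IntermediateField K L) (IntermediateField.subset_adjoin _ _ ⟨j, rfl⟩)
  have h2 : ((laurentMonomial K (Pi.single i (p : ℤ)) : Lˣ) : L) ∈ torusInvariants p K L :=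
    laurentMonomial_mem_torusInvariants K (by rw [monomialWeight_single]; simp)
  rw [laurentMonomial_single, zpow_natCast, Units.val_pow_eq_pow_val] at h2
  exact h1 h2

theorem uniqueFactorizationMonoid_torusInvariants :
    UniqueFactorizationMonoid (torusInvariants p K L) := by
  rw [← adjoin_weightZeroBasis]
  exact (algebraicIndependent_weightZeroBasis K).uniqueFactorizationMonoid_adjoin_union_inv

end TorusInvariants

section CharacterAction

open MvPolynomial

variable {p : ℕ} [Fact p.Prime] {K L : Type*} [Field K] [Field L]
  [Algebra (MvPolynomial (ZMod p) K) L] [IsFractionRing (MvPolynomial (ZMod p) K) L] [Algebra K L]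
  [IsScalarTower K (MvPolynomial (ZMod p) K) L] (χ : AddChar (ZMod p) K)

/-- The diagonal action of a character of `ZMod p` on polynomials. -/
noncomputable def characterAction : MvPolynomial (ZMod p) K →ₐ[K] MvPolynomial (ZMod p) K :=
  aeval fun j => C (χ j) * X j

theorem coeff_characterAction (m : ZMod p →₀ ℕ) (q : MvPolynomial (ZMod p) K) :
    coeff m (characterAction χ q) = χ (monomialWeight fun i => (m i : ℤ)) * coeff m q := by
  classical
  induction q using MvPolynomial.induction_on' with
  | monomial d a =>
    have h1 : characterAction χ (monomial d a) =
        C (χ (monomialWeight fun i => (d i : ℤ))) * monomial d a := by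
      rw [characterAction, aeval_monomial, Finsupp.prod_fintype _ _ (fun i => by simp)]
      rw [monomial_eq, Finsupp.prod_fintype _ _ (fun i => by simp), algebraMap_eq]
      simp only [mul_pow, Finset.prod_mul_distrib]
      have h2 : χ (monomialWeight fun i => (d i : ℤ)) = ∏ i, χ i ^ d i := by
        rw [monomialWeight, AddChar.map_sum_eq_prod']
        refine Finset.prod_congr rfl fun i _ => ?_
        rw [← AddChar.map_nsmul_eq_pow, nsmul_eq_mul, mul_comm]
        simp
      rw [h2, map_prod]
      simp only [map_pow]
      ring
    rw [h1, coeff_C_mul, coeff_monomial]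
    split_ifs with h
    · rw [h]
    · simp
  | add a b ha hb => rw [map_add, coeff_add, ha, hb, coeff_add, mul_add]

theorem algebraMap_mem_torusInvariants (hχ : ∀ a, χ a = 1 → a = 0)
    {q : MvPolynomial (ZMod p) K} (hq : characterAction χ q = q) :
    algebraMap _ L q ∈ torusInvariants p K L := by
  rw [q.as_sum, map_sum]
  refine sum_mem fun m hm => ?_
  have h1 : monomialWeight (fun i => (m i : ℤ)) = 0 := by
    apply hχ
    have h2 := coeff_characterAction χ m q
    rw [hq] at h2
    exact (mul_eq_right₀ (mem_support_iff.1 hm)).1 h2.symm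
  have h3 : algebraMap (MvPolynomial (ZMod p) K) L (monomial m (coeff m q)) =
      algebraMap K L (coeff m q) * (laurentMonomial K (fun i => (m i : ℤ)) : Lˣ) := by
    rw [monomial_eq, Finsupp.prod_fintype _ _ (fun i => by simp), map_mul, ← algebraMap_eq,
      ← IsScalarTower.algebraMap_apply, map_prod, laurentMonomial, Units.coe_prod]
    simp [coordUnit]
  rw [h3]
  exact mul_mem (Subalgebra.algebraMap_mem _ _) (laurentMonomial_mem_torusInvariants K h1)

variable (c : L →+* L)

theorem exists_mul_mem_torusInvariants (hχ : ∀ a, χ a = 1 → a = 0)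
    (hc : ∀ q, c (algebraMap _ L q) = algebraMap _ L (characterAction χ q)) {x : L}
    (hx : c x = x) :
    ∃ b ∈ torusInvariants p K L, b ≠ 0 ∧ x * b ∈ torusInvariants p K L := by
  obtain ⟨a, b, hb, rfl⟩ := IsFractionRing.div_surjective (A := MvPolynomial (ZMod p) K) x
  have hb0 : b ≠ 0 := nonZeroDivisors.ne_zero hb
  have hinv : ∀ q : MvPolynomial (ZMod p) K, c (algebraMap _ L q) = algebraMap _ L q →
      algebraMap _ L q ∈ torusInvariants p K L := by
    intro q hq
    rw [hc] at hq
    exact algebraMap_mem_torusInvariants χ hχ (IsFractionRing.injective _ L hq)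
  have hcoeff : ∀ (k : ℕ) (m : ZMod p →₀ ℕ) (q : MvPolynomial (ZMod p) K),
      coeff m ((characterAction χ)^[k] q) =
        χ (monomialWeight fun i => (m i : ℤ)) ^ k * coeff m q := by
    intro k m q
    induction k with
    | zero => simp
    | succ k ih => rw [Function.iterate_succ_apply', coeff_characterAction, ih, pow_succ']; ring
  have hp : ∀ q, (characterAction χ)^[p] q = q := by
    intro q
    ext m
    rw [hcoeff, ← AddChar.map_nsmul_eq_pow]
    simp
  obtain ⟨r, hr⟩ : ∃ r, p = r + 1 := ⟨p - 1, (Nat.succ_pred_prime Fact.out).symm⟩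
  have hp' : ∀ q, (characterAction χ)^[r + 1] q = q := fun q => hr ▸ hp q
  have hne : ∀ k, (characterAction χ)^[k] b ≠ 0 := by
    intro k
    have hinj : Function.Injective (characterAction χ) := by
      intro q q' h
      rw [← hp' q, ← hp' q', Function.iterate_succ_apply, Function.iterate_succ_apply, h]
    induction k with
    | zero => exact hb0
    | succ k ih =>
      rw [Function.iterate_succ_apply']
      exact (map_ne_zero_iff _ hinj).2 ih
  let N := ∏ k ∈ Finset.range (r + 1), (characterAction χ)^[k] b
  have hN : characterAction χ N = N := by
    simp only [N, map_prod, ← Function.iterate_succ_apply' (⇑(characterAction χ))]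
    rw [Finset.prod_range_succ, hp', Finset.prod_range_succ']
    rfl
  have hN' : N = (∏ k ∈ Finset.range r, (characterAction χ)^[k + 1] b) * b := by
    simp only [N]
    rw [Finset.prod_range_succ']
    rfl
  have hN0 : N ≠ 0 := Finset.prod_ne_zero_iff.2 fun k _ => hne k
  have hbL : algebraMap _ L b ≠ 0 := (map_ne_zero_iff _ (IsFractionRing.injective _ _)).2 hb0
  refine ⟨algebraMap _ L N, hinv N (by rw [hc, hN]),
    (map_ne_zero_iff _ (IsFractionRing.injective _ _)).2 hN0, ?_⟩
  have h1 : algebraMap _ L a / algebraMap _ L b * algebraMap _ L N =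
      algebraMap _ L (a * ∏ k ∈ Finset.range r, (characterAction χ)^[k + 1] b) := by
    rw [hN', map_mul, map_mul]
    field_simp
  rw [h1]
  apply hinv
  rw [← h1, map_mul, hx, hc, hN]

theorem map_laurentMonomial_of_character
    (hc : ∀ q, c (algebraMap _ L q) = algebraMap _ L (characterAction χ q))
    (m : ZMod p → ℤ) : c (laurentMonomial K m : Lˣ) =
      algebraMap K L (χ (monomialWeight m)) * (laurentMonomial K m : Lˣ) := by
  have h1 : ∀ i : ZMod p, c (coordUnit K i : Lˣ) = algebraMap K L (χ i) * (coordUnit K i : Lˣ) := by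
    intro i
    change c (algebraMap _ L (X i)) = _ * algebraMap _ L (X i)
    rw [hc, characterAction, aeval_X, map_mul, ← algebraMap_eq, ← IsScalarTower.algebraMap_apply]
  rw [laurentMonomial, Units.coe_prod, map_prod, monomialWeight, AddChar.map_sum_eq_prod', map_prod,
    ← Finset.prod_mul_distrib]
  refine Finset.prod_congr rfl fun i _ => ?_
  rw [Units.val_zpow_eq_zpow_val, map_zpow₀, h1, mul_zpow, ← map_zpow₀, ← AddChar.map_zsmul_eq_zpow,
    zsmul_eq_mul, mul_comm i]

theorem map_eq_of_mem_torusInvariants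
    (hc : ∀ q, c (algebraMap _ L q) = algebraMap _ L (characterAction χ q)) {x : L}
    (hx : x ∈ torusInvariants p K L) : c x = x := by
  induction hx using Algebra.adjoin_induction with
  | mem x hx =>
    obtain ⟨m, hm, rfl⟩ := hx
    rw [map_laurentMonomial_of_character χ c hc, hm]
    simp
  | algebraMap r =>
    rw [IsScalarTower.algebraMap_apply K (MvPolynomial (ZMod p) K) L, hc, algebraMap_eq,
      characterAction, aeval_C, algebraMap_eq]
  | add x y _ _ hx hy => rw [map_add, hx, hy]
  | mul x y _ _ hx hy => rw [map_mul, hx, hy]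

theorem monomialWeight_coordOrd_eq_zero (hχ : ∀ a, χ a = 1 → a = 0)
    (hc : ∀ q, c (algebraMap _ L q) = algebraMap _ L (characterAction χ q)) {x : Lˣ}
    (hx : x ∈ unitSubgroup (torusInvariants p K L)) :
    monomialWeight (fun i : ZMod p => coordOrd K i (Additive.ofMul x)) = 0 := by
  obtain ⟨a, ha⟩ := exists_eq_mul_laurentMonomial K (ι := ZMod p) (x := x)
    ⟨torusInvariants_le_laurentAlgebra K hx.1, torusInvariants_le_laurentAlgebra K hx.2⟩
  set m : ZMod p → ℤ := fun i => coordOrd K i (Additive.ofMul x)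
  have hca : c (algebraMap K L a) = algebraMap K L a :=
    map_eq_of_mem_torusInvariants χ c hc (Subalgebra.algebraMap_mem _ a)
  have h1 : c x = x := map_eq_of_mem_torusInvariants χ c hc hx.1
  rw [ha, map_mul, hca, map_laurentMonomial_of_character χ c hc, mul_left_comm, ← ha] at h1
  apply hχ
  apply FaithfulSMul.algebraMap_injective K L
  rw [map_one]
  exact (mul_eq_right₀ x.ne_zero).1 h1

end CharacterAction

section TorusTheorem

open MvPolynomial

theorem IsPrimitiveRoot.sum_zmod_eq {p : ℕ} [Fact p.Prime] {M : Type*} [AddCommMonoid M]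
    {g : ZMod p} (hg : IsPrimitiveRoot g (p - 1)) (f : ZMod p → M) :
    ∑ j, f j = f 0 + ∑ k ∈ Finset.range (p - 1), f (g ^ k) := by
  have hp := (Fact.out : p.Prime).one_lt
  have hg0 : g ≠ 0 := hg.ne_zero (by omega)
  have hinj : Set.InjOn (g ^ ·) (Finset.range (p - 1) : Set ℕ) := by
    intro a ha b hb hab
    exact hg.pow_inj (by simpa using ha) (by simpa using hb) hab
  have himage : (Finset.range (p - 1)).image (g ^ ·) = Finset.univ.erase 0 := by
    apply Finset.eq_of_subset_of_card_le
    · intro x hx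
      obtain ⟨k, -, rfl⟩ := Finset.mem_image.1 hx
      exact Finset.mem_erase.2 ⟨pow_ne_zero _ hg0, Finset.mem_univ _⟩
    · rw [Finset.card_image_of_injOn hinj, Finset.card_erase_of_mem (Finset.mem_univ _)]
      simp [ZMod.card]
  rw [← Finset.add_sum_erase _ _ (Finset.mem_univ 0), ← himage, Finset.sum_image hinj]

theorem mem_unitSubgroup_of_algebraMap {K L : Type*} [Field K] [Field L] [Algebra K L]
    (A : Subalgebra K L) {x : Lˣ} {a : K} (ha : algebraMap K L a = x) : x ∈ unitSubgroup A := by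
  refine ⟨ha ▸ A.algebraMap_mem a, ?_⟩
  rw [Units.val_inv_eq_inv_val, ← ha, ← map_inv₀]
  exact A.algebraMap_mem _

theorem IntermediateField.exists_mul_mem_of_mem_adjoin {K L : Type*} [Field K] [Field L]
    [Algebra K L] {S : Set L} {x : L} (hx : x ∈ IntermediateField.adjoin K S) :
    ∃ a ∈ Algebra.adjoin K S, a ≠ 0 ∧ x * a ∈ Algebra.adjoin K S := by
  obtain ⟨r, hr, s, hs, rfl⟩ := IntermediateField.mem_adjoin_iff_div.1 hx
  rcases eq_or_ne s 0 with rfl | hs0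
  · exact ⟨1, one_mem _, one_ne_zero, by simp⟩
  · exact ⟨s, hs, hs0, by rwa [div_mul_cancel₀ _ hs0]⟩

theorem Subalgebra.mem_iff_map_mem_of_iterate {K L : Type*} [CommRing K] [CommRing L] [Algebra K L]
    (A : Subalgebra K L) (T : L → L) {n : ℕ} (hn : 0 < n) (hTn : ∀ x, T^[n] x = x)
    (h : ∀ x ∈ A, T x ∈ A) (x : L) : x ∈ A ↔ T x ∈ A := by
  refine ⟨h x, fun hx => ?_⟩
  obtain ⟨m, rfl⟩ := Nat.exists_eq_succ_of_ne_zero hn.ne'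
  rw [← hTn x, Function.iterate_succ_apply]
  exact Set.MapsTo.iterate (s := (A : Set L)) h m hx

variable {p : ℕ} [Fact p.Prime] (K : Type*) {L : Type*} [Field K] [Field L]
  [Algebra (MvPolynomial (ZMod p) K) L] [IsFractionRing (MvPolynomial (ZMod p) K) L]
  {R : Type*} [CommRing R] (z : R) (g : ZMod p)

/-- The equivariant functional on units given by orders along the coordinate hyperplanes. -/
noncomputable def coordFunctional : Additive Lˣ →+ R :=
  ∑ k ∈ Finset.range (p - 1),
    (AddMonoidHom.mulLeft (z ^ k)).comp ((Int.castAddHom R).comp (coordOrd K (g ^ k)))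

theorem coordFunctional_apply (x : Additive Lˣ) :
    coordFunctional K z g x =
      ∑ k ∈ Finset.range (p - 1), z ^ k * (coordOrd K (g ^ k) x : R) := by
  simp [coordFunctional]

theorem coordFunctional_map {z : R} (hz : z ^ (p - 1) = 1) {g : ZMod p} (hg : g ^ (p - 1) = 1)
    (T : L ≃+* L) (TP : MvPolynomial (ZMod p) K ≃+* MvPolynomial (ZMod p) K)
    (hT : ∀ a, T (algebraMap _ L a) = algebraMap _ L (TP a)) (hTP : ∀ i, TP (X i) = X (g * i))
    (x : Lˣ) : coordFunctional K z g (Additive.ofMul (Units.map (T : L →* L) x)) =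
      z * coordFunctional K z g (Additive.ofMul x) := by
  let f : ℕ → R := fun k =>
    z ^ k * (coordOrd K (g ^ k) (Additive.ofMul (Units.map (T : L →* L) x)) : R)
  have h1 : ∑ k ∈ Finset.range (p - 1), f k = ∑ k ∈ Finset.range (p - 1), f (k + 1) := by
    have h0 : f (p - 1) = f 0 := by simp [f, hz, hg]
    have h2 := (Finset.sum_range_succ f (p - 1)).symm.trans (Finset.sum_range_succ' f (p - 1))
    rw [h0] at h2
    exact add_right_cancel h2
  rw [coordFunctional_apply, coordFunctional_apply]
  refine h1.trans ?_
  rw [Finset.mul_sum]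
  refine Finset.sum_congr rfl fun k _ => ?_
  simp only [f]
  rw [pow_succ' g, coordOrd_map K T TP hT (g * ·) hTP, pow_succ', mul_assoc]

theorem coordFunctional_laurentMonomial_single_one (hp : 1 < p) {g : ZMod p}
    (hg : IsPrimitiveRoot g (p - 1)) (n : ℤ) :
    coordFunctional K z g
      (Additive.ofMul (laurentMonomial K (Pi.single (1 : ZMod p) n) : Lˣ)) = n := by
  rw [coordFunctional_apply, Finset.sum_eq_single 0]
  · simp [coordOrd_laurentMonomial]
  · intro k hk hk0
    rw [coordOrd_laurentMonomial, Pi.single_eq_of_ne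
      (hg.pow_ne_one_of_pos_of_lt hk0 (Finset.mem_range.1 hk))]
    simp
  · intro h
    exact absurd (Finset.mem_range.2 (by omega)) h

variable {K}

theorem map_laurentMonomial_of_mul (hg : g ≠ 0) (T : L ≃+* L)
    (TP : MvPolynomial (ZMod p) K ≃+* MvPolynomial (ZMod p) K)
    (hT : ∀ a, T (algebraMap _ L a) = algebraMap _ L (TP a)) (hTP : ∀ i, TP (X i) = X (g * i))
    (m : ZMod p → ℤ) : Units.map (T : L →* L) (laurentMonomial K m) =
      laurentMonomial K (m ∘ (Equiv.mulLeft₀ g hg).symm) := by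
  have h1 : ∀ i : ZMod p, Units.map (T : L →* L) (coordUnit K i) = coordUnit K (g * i) := by
    intro i
    ext
    change T (algebraMap _ L (X i)) = algebraMap _ L (X (g * i))
    rw [hT, hTP]
  rw [laurentMonomial, laurentMonomial, map_prod,
    ← Equiv.prod_comp (Equiv.mulLeft₀ g hg)
      (fun i => coordUnit K i ^ (m ∘ (Equiv.mulLeft₀ g hg).symm) i)]
  refine Finset.prod_congr rfl fun i _ => ?_
  rw [map_zpow, h1, Function.comp_apply, Equiv.symm_apply_apply]
  rfl

theorem monomialWeight_comp_mulLeft_symm (hg : g ≠ 0) (m : ZMod p → ℤ) :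
    monomialWeight (m ∘ (Equiv.mulLeft₀ g hg).symm) = g * monomialWeight m := by
  rw [monomialWeight, monomialWeight,
    ← Equiv.sum_comp (Equiv.mulLeft₀ g hg)
      (fun i => i * (((m ∘ (Equiv.mulLeft₀ g hg).symm) i : ℤ) : ZMod p)), Finset.mul_sum]
  refine Finset.sum_congr rfl fun i _ => ?_
  rw [Function.comp_apply, Equiv.symm_apply_apply]
  simp [mul_assoc]

variable [Algebra K L]

theorem map_mem_torusInvariants (hg : g ≠ 0) (T : L ≃+* L)
    (TP : MvPolynomial (ZMod p) K ≃+* MvPolynomial (ZMod p) K)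
    (hT : ∀ a, T (algebraMap _ L a) = algebraMap _ L (TP a)) (hTP : ∀ i, TP (X i) = X (g * i))
    (hTK : ∀ a, ∃ b, T (algebraMap K L a) = algebraMap K L b) (x : L)
    (hx : x ∈ torusInvariants p K L) : T x ∈ torusInvariants p K L := by
  induction hx using Algebra.adjoin_induction with
  | mem x hx =>
    obtain ⟨m, hm, rfl⟩ := hx
    have h1 := congrArg Units.val (map_laurentMonomial_of_mul g hg T TP hT hTP m)
    change T _ = _ at h1
    rw [h1]
    exact laurentMonomial_mem_torusInvariants K
      (by rw [monomialWeight_comp_mulLeft_symm, hm, mul_zero])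
  | algebraMap r =>
    obtain ⟨b, hb⟩ := hTK r
    rw [hb]
    exact Subalgebra.algebraMap_mem _ b
  | add x y _ _ hx hy => rw [map_add]; exact add_mem hx hy
  | mul x y _ _ hx hy => rw [map_mul]; exact mul_mem hx hy

end TorusTheorem

section TorusDivisibility

open MvPolynomial

variable {p : ℕ} [Fact p.Prime] {K : Type*} {L : Type u} [Field K] [Field L]
  [Algebra (MvPolynomial (ZMod p) K) L] [IsFractionRing (MvPolynomial (ZMod p) K) L] [Algebra K L]
  [IsScalarTower K (MvPolynomial (ZMod p) K) L]

omit [Algebra K L] [IsScalarTower K (MvPolynomial (ZMod p) K) L] in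
theorem map_laurentMonomial_single {g : ZMod p} (hg : g ≠ 0) (T : L ≃+* L)
    (TP : MvPolynomial (ZMod p) K ≃+* MvPolynomial (ZMod p) K)
    (hT : ∀ a, T (algebraMap _ L a) = algebraMap _ L (TP a)) (hTP : ∀ i, TP (X i) = X (g * i))
    (j : ZMod p) (n : ℤ) : Units.map (T : L →* L) (laurentMonomial K (Pi.single j n)) =
      laurentMonomial K (Pi.single (g * j) n) := by
  rw [map_laurentMonomial_of_mul g hg T TP hT hTP]
  congr 1
  ext i
  rw [Function.comp_apply, Pi.single_apply, Pi.single_apply]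
  exact if_congr (Equiv.symm_apply_eq _) rfl rfl

theorem exists_mul_eq_mul_coordFunctional {R : Type*} [CommRing R] [IsDomain R] (hp : 2 < p)
    {z : R} (hz : IsPrimitiveRoot z (p - 1)) {g : ZMod p} (hg : IsPrimitiveRoot g (p - 1))
    (T : L ≃+* L) (TP : MvPolynomial (ZMod p) K ≃+* MvPolynomial (ZMod p) K)
    (hT : ∀ a, T (algebraMap _ L a) = algebraMap _ L (TP a)) (hTP : ∀ i, TP (X i) = X (g * i))
    (h : Additive (unitSubgroup (torusInvariants p K L)) →+ R)
    (hh : ∀ x y : unitSubgroup (torusInvariants p K L), (y : Lˣ) = Units.map (T : L →* L) x →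
      h (Additive.ofMul y) = z * h (Additive.ofMul x))
    (h0 : ∀ (x : unitSubgroup (torusInvariants p K L)) (a : K), algebraMap K L a = (x : Lˣ) →
      h (Additive.ofMul x) = 0) :
    ∃ c, ∀ x : unitSubgroup (torusInvariants p K L),
      p * h (Additive.ofMul x) = c * coordFunctional K z g (Additive.ofMul (x : Lˣ)) := by
  have hg0 : g ≠ 0 := hg.ne_zero (by omega)
  let y : ZMod p → unitSubgroup (torusInvariants p K L) := fun j =>
    ⟨laurentMonomial K (Pi.single j (p : ℤ)),
      laurentMonomial_mem_unitSubgroup K (by rw [monomialWeight_single]; simp)⟩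
  have hy : ∀ j, h (Additive.ofMul (y (g * j))) = z * h (Additive.ofMul (y j)) := by
    intro j
    apply hh
    exact (map_laurentMonomial_single hg0 T TP hT hTP j p).symm
  have hy0 : h (Additive.ofMul (y 0)) = 0 := by
    have h1 := hy 0
    rw [mul_zero, ← sub_eq_zero, ← one_sub_mul] at h1
    exact (mul_eq_zero.1 h1).resolve_left (sub_ne_zero.2 (hz.ne_one (by omega)).symm)
  have hyk : ∀ k, h (Additive.ofMul (y (g ^ k))) = z ^ k * h (Additive.ofMul (y 1)) := by
    intro k
    induction k with
    | zero => simp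
    | succ k ih => rw [pow_succ', hy, ih, pow_succ']; ring
  refine ⟨h (Additive.ofMul (y 1)), fun x => ?_⟩
  obtain ⟨a, ha⟩ := exists_eq_mul_laurentMonomial K (ι := ZMod p) (x := (x : Lˣ))
    ⟨torusInvariants_le_laurentAlgebra K x.2.1, torusInvariants_le_laurentAlgebra K x.2.2⟩
  set m : ZMod p → ℤ := fun i => coordOrd K i (Additive.ofMul (x : Lˣ)) with hm
  have hyprod : ((∏ j, y j ^ m j : unitSubgroup (torusInvariants p K L)) : Lˣ) =
      laurentMonomial K m ^ p := by
    have h1 : m = ∑ j, Pi.single j (m j) := (Finset.univ_sum_single m).symm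
    rw [Subgroup.val_finsetProd, h1, laurentMonomial_sum, ← Finset.prod_pow, ← h1]
    refine Finset.prod_congr rfl fun j _ => ?_
    simp only [y, SubgroupClass.coe_zpow, laurentMonomial_single]
    rw [← zpow_natCast, ← zpow_mul, ← zpow_mul, mul_comm]
  have h2 : h (Additive.ofMul (x ^ p * (∏ j, y j ^ m j)⁻¹)) = 0 := by
    apply h0 _ (a ^ p)
    rw [Subgroup.coe_mul, Subgroup.coe_inv, hyprod, Units.val_mul, SubgroupClass.coe_pow,
      Units.val_pow_eq_pow_val, Units.val_inv_eq_inv_val, Units.val_pow_eq_pow_val, ha, mul_pow,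
      map_pow, mul_inv_cancel_right₀ (pow_ne_zero _ (Units.ne_zero _))]
  rw [ofMul_mul, ofMul_inv, map_add, map_neg, add_neg_eq_zero, ofMul_pow, map_nsmul, nsmul_eq_mul,
    ofMul_prod, map_sum] at h2
  simp only [ofMul_zpow, map_zsmul, zsmul_eq_mul] at h2
  rw [h2, hg.sum_zmod_eq, hy0, mul_zero, zero_add, coordFunctional_apply, Finset.mul_sum]
  refine Finset.sum_congr rfl fun k _ => ?_
  rw [hyk]
  ring

/-- If the invariants of the torus with character group the monomials of weight zero, descended
along `T`, are purely transcendental, then the ideal `(p, z - g)` has a generator up to a factor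
prime to the kernel of `φ`. -/
theorem exists_dvd_of_algebraicIndependent_invariants {R : Type*} [CommRing R] [IsDomain R]
    [CharZero R] (hp : 2 < p) {z : R} (hz : IsPrimitiveRoot z (p - 1)) {g : ZMod p}
    (hg : IsPrimitiveRoot g (p - 1)) (φ : R →+* ZMod p) (hφ : φ z = g) (T : L ≃+* L)
    (hTn : ∀ x, T^[p - 1] x = x) (TP : MvPolynomial (ZMod p) K ≃+* MvPolynomial (ZMod p) K)
    (hT : ∀ a, T (algebraMap _ L a) = algebraMap _ L (TP a)) (hTP : ∀ i, TP (X i) = X (g * i))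
    (hTK : ∀ a, ∃ b, T (algebraMap K L a) = algebraMap K L b) (χ : AddChar (ZMod p) K)
    (hχ : ∀ a, χ a = 1 → a = 0) (c : L →+* L)
    (hc : ∀ q, c (algebraMap _ L q) = algebraMap _ L (characterAction χ q))
    {κ : Type*} [Finite κ] {t : κ → L} (ht : AlgebraicIndependent K t) (hTt : ∀ i, T (t i) = t i)
    (hct : ∀ i, c (t i) = t i)
    (hfix : ∀ x, c x = x → x ∈ IntermediateField.adjoin K (Set.range t)) :
    ∃ α, φ α = 0 ∧ α ∣ (p : R) ∧ α ∣ z - (g.val : R) := by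
  have hg0 : g ≠ 0 := hg.ne_zero (by omega)
  have hp0 : 0 < p - 1 := by omega
  have := ht.uniqueFactorizationMonoid_adjoin
  have : UniqueFactorizationMonoid (torusInvariants p K L) :=
    uniqueFactorizationMonoid_torusInvariants K
  have hTA : ∀ x ∈ Algebra.adjoin K (Set.range t), T x ∈ Algebra.adjoin K (Set.range t) := by
    intro x hx
    induction hx using Algebra.adjoin_induction with
    | mem x hx =>
      obtain ⟨i, rfl⟩ := hx
      rw [hTt]
      exact Algebra.subset_adjoin ⟨i, rfl⟩
    | algebraMap r =>
      obtain ⟨b, hb⟩ := hTK r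
      rw [hb]
      exact Subalgebra.algebraMap_mem _ b
    | add x y _ _ hx hy => rw [map_add]; exact add_mem hx hy
    | mul x y _ _ hx hy => rw [map_mul]; exact mul_mem hx hy
  have hsingle : (laurentMonomial K (Pi.single (1 : ZMod p) (p : ℤ)) : Lˣ) ∈
      unitSubgroup (torusInvariants p K L) :=
    laurentMonomial_mem_unitSubgroup K (by rw [monomialWeight_single]; simp)
  have hl1 : coordFunctional K z g
      (Additive.ofMul (laurentMonomial K (Pi.single (1 : ZMod p) (p : ℤ)) : Lˣ)) = (p : R) := by
    rw [coordFunctional_laurentMonomial_single_one K z (by omega) hg]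
    simp
  have hp0R : (p : R) ≠ 0 := Nat.cast_ne_zero.2 (by omega)
  obtain ⟨α, hα, hdvd⟩ := exists_dvd_of_factorial_models φ hp0 hz (hφ ▸ hg) T hTn
    (Algebra.adjoin K (Set.range t)) (torusInvariants p K L)
    (Subalgebra.mem_iff_map_mem_of_iterate _ T hp0 hTn hTA)
    (Subalgebra.mem_iff_map_mem_of_iterate _ T hp0 hTn
      (map_mem_torusInvariants g hg0 T TP hT hTP hTK))
    (Set.finite_range t) ((Set.finite_range _).union (Set.finite_range _)) rfl
    (adjoin_weightZeroBasis K)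
    (by
      rintro _ ⟨i, rfl⟩
      exact exists_mul_mem_torusInvariants χ c hχ hc (hct i))
    (by
      intro x hx
      refine IntermediateField.exists_mul_mem_of_mem_adjoin (hfix x ?_)
      apply map_eq_of_mem_torusInvariants χ c hc
      rw [← adjoin_weightZeroBasis]
      exact Algebra.subset_adjoin hx)
    (by
      intro x hx
      obtain ⟨a, ha⟩ := ht.exists_algebraMap_eq_of_mem_unitSubgroup hx
      exact mem_unitSubgroup_of_algebraMap _ ha)
    (coordFunctional K z g)
    (coordFunctional_map K hz.pow_eq_one hg.pow_eq_one T TP hT hTP)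
    (by
      intro x hx
      obtain ⟨a, ha⟩ := ht.exists_algebraMap_eq_of_mem_unitSubgroup hx
      rw [coordFunctional_apply]
      exact Finset.sum_eq_zero fun k _ => by rw [coordOrd_of_algebraMap K _ ha]; simp)
    (by
      intro x hx
      rw [← monomialWeight_coordOrd_eq_zero χ c hχ hc hx, monomialWeight, hg.sum_zmod_eq, zero_mul,
        zero_add, coordFunctional_apply, map_sum]
      exact Finset.sum_congr rfl fun k _ => by rw [map_mul, map_pow, hφ, map_intCast])
    ⟨_, hsingle, hl1 ▸ hp0R⟩
    ⟨p, hp0R, fun h hh h0 => exists_mul_eq_mul_coordFunctional hp hz hg T TP hT hTP h hh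
      fun x a ha => h0 x (mem_unitSubgroup_of_algebraMap _ ha)⟩
  refine ⟨α, hα, hl1 ▸ hdvd _ hsingle, ?_⟩
  have h1 : (laurentMonomial K (Pi.single g 1 + Pi.single 1 (-(g.val : ℤ))) : Lˣ) ∈
      unitSubgroup (torusInvariants p K L) :=
    laurentMonomial_mem_unitSubgroup K (by
      rw [monomialWeight_add, monomialWeight_single, monomialWeight_single]
      simp)
  have h2 : (laurentMonomial K (Pi.single g 1) : Lˣ) =
      Units.map (T : L →* L) (laurentMonomial K (Pi.single (1 : ZMod p) 1)) := by
    rw [map_laurentMonomial_single hg0 T TP hT hTP, mul_one]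
  have h3 := hdvd _ h1
  rw [laurentMonomial_add, ofMul_mul, map_add, h2,
    coordFunctional_map K hz.pow_eq_one hg.pow_eq_one T TP hT hTP,
    coordFunctional_laurentMonomial_single_one K z (by omega) hg,
    coordFunctional_laurentMonomial_single_one K z (by omega) hg] at h3
  convert h3 using 1
  push_cast
  ring

end TorusDivisibility

theorem natCast_finRotate {p : ℕ} [NeZero p] (i : Fin p) :
    ((finRotate p i : ℕ) : ZMod p) = (i : ℕ) + 1 := by
  rw [finRotate_apply, Fin.val_add, ZMod.natCast_mod, Nat.cast_add, Fin.val_one', ZMod.natCast_mod,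
    Nat.cast_one]

section FourierEmbedding

open MvPolynomial

variable {p : ℕ} [Fact p.Prime] {K L : Type*} [Field K] [Field L]
  [Algebra (MvPolynomial (ZMod p) K) L] [Algebra K L]
  [IsScalarTower K (MvPolynomial (ZMod p) K) L] (χ : AddChar (ZMod p) K)

/-- The Fourier transforms of the variables. -/
noncomputable def fourierSum (L : Type*) [Field L] [Algebra (MvPolynomial (ZMod p) K) L]
    [Algebra K L] (i : ZMod p) : L :=
  ∑ j, algebraMap K L (χ (i * j)) * algebraMap (MvPolynomial (ZMod p) K) L (X j)

omit [IsScalarTower K (MvPolynomial (ZMod p) K) L] in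
theorem sum_mul_fourierSum (hχ : χ.IsPrimitive) (k : ZMod p) :
    ∑ i, algebraMap K L (χ (-(i * k))) * fourierSum χ L i =
      p * algebraMap (MvPolynomial (ZMod p) K) L (X k) := by
  simp only [fourierSum, Finset.mul_sum]
  rw [Finset.sum_comm]
  have h1 : ∀ j : ZMod p, ∑ i, algebraMap K L (χ (-(i * k))) *
      (algebraMap K L (χ (i * j)) * algebraMap (MvPolynomial (ZMod p) K) L (X j)) =
      algebraMap K L (if j - k = 0 then p else 0 : ℕ) *
        algebraMap (MvPolynomial (ZMod p) K) L (X j) := by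
    intro j
    have h2 := AddChar.sum_mulShift (j - k) hχ
    rw [ZMod.card] at h2
    rw [← h2, map_sum, Finset.sum_mul]
    refine Finset.sum_congr rfl fun i _ => ?_
    rw [← mul_assoc, ← map_mul, ← AddChar.map_add_eq_mul]
    congr 3
    ring
  simp only [h1, sub_eq_zero]
  rw [Finset.sum_eq_single k]
  · simp
  · intro j _ hj
    simp [hj]
  · simp

omit [IsScalarTower K (MvPolynomial (ZMod p) K) L] in
theorem algebraMap_X_mem_adjoin_fourierSum [CharZero L] (hχ : χ.IsPrimitive) (E : Subfield L)
    (hK : ∀ a, algebraMap K L a ∈ E) (hE : ∀ i, fourierSum χ L i ∈ E) (k : ZMod p) :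
    algebraMap (MvPolynomial (ZMod p) K) L (X k) ∈ E := by
  have h1 : (p : L) ≠ 0 := Nat.cast_ne_zero.2 (Fact.out : p.Prime).ne_zero
  rw [← mul_div_cancel_left₀ (algebraMap (MvPolynomial (ZMod p) K) L (X k)) h1,
    ← sum_mul_fourierSum χ hχ]
  exact div_mem (sum_mem fun i _ => mul_mem (hK _) (hE i)) (natCast_mem E p)

omit [Fact p.Prime] in
theorem eq_top_of_algebraMap_mem [IsFractionRing (MvPolynomial (ZMod p) K) L] (E : Subfield L)
    (hK : ∀ a, algebraMap K L a ∈ E)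
    (hX : ∀ i, algebraMap (MvPolynomial (ZMod p) K) L (X i) ∈ E) (x : L) : x ∈ E := by
  let E' : IntermediateField K L := { E with algebraMap_mem' := hK }
  have h1 : (⊤ : IntermediateField K L) ≤ E' := by
    rw [← IsFractionRing.adjoin_range_X_eq_top (ι := ZMod p), IntermediateField.adjoin_le_iff]
    rintro _ ⟨i, rfl⟩
    exact hX i
  exact h1 (IntermediateField.mem_top (x := x))

variable [IsFractionRing (MvPolynomial (ZMod p) K) L]

theorem algebraicIndependent_fourierSum [CharZero L] (hχ : χ.IsPrimitive) :
    AlgebraicIndependent K (fourierSum χ L) := by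
  refine IsFractionRing.algebraicIndependent_of_pow_mem fun i => ⟨1, one_pos, ?_⟩
  rw [pow_one]
  exact algebraMap_X_mem_adjoin_fourierSum χ hχ
    (IntermediateField.adjoin K (Set.range (fourierSum χ L))).toSubfield
    (fun a => IntermediateField.algebraMap_mem _ a)
    (fun i => IntermediateField.subset_adjoin _ _ ⟨i, rfl⟩) i

theorem ringHom_ext_of_fractionRing {σ k F E : Type*} [Field k] [Field F] [Field E]
    [Algebra (MvPolynomial σ k) F]
    [IsFractionRing (MvPolynomial σ k) F] {f g : F →+* E}
    (hC : ∀ a, f (algebraMap (MvPolynomial σ k) F (C a)) =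
      g (algebraMap (MvPolynomial σ k) F (C a)))
    (hX : ∀ i, f (algebraMap (MvPolynomial σ k) F (X i)) =
      g (algebraMap (MvPolynomial σ k) F (X i))) : f = g := by
  apply IsLocalization.ringHom_ext (nonZeroDivisors (MvPolynomial σ k))
  exact MvPolynomial.ringHom_ext hC hX

theorem eval₂Hom_fourierSum_injective [CharZero K] [CharZero L] (hχ : χ.IsPrimitive) :
    Function.Injective (eval₂Hom (algebraMap ℚ L) fun i : Fin p =>
      fourierSum χ L ((i : ℕ) : ZMod p)) := by
  have h1 := ((algebraicIndependent_fourierSum χ (L := L) hχ).restrictScalars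
    (algebraMap ℚ K).injective).comp (fun i : Fin p => ((i : ℕ) : ZMod p)) (by
      intro i j hij
      have := (ZMod.natCast_eq_natCast_iff' _ _ p).1 hij
      rwa [Nat.mod_eq_of_lt i.2, Nat.mod_eq_of_lt j.2, Fin.val_inj] at this)
  rw [algebraicIndependent_iff_injective_aeval] at h1
  exact h1

/-- The embedding of the rational function field diagonalizing the cyclic permutation. -/
noncomputable def fourierEmbedding [CharZero K] [CharZero L] (hχ : χ.IsPrimitive) :
    FractionRing (MvPolynomial (Fin p) ℚ) →+* L :=
  IsFractionRing.lift (eval₂Hom_fourierSum_injective χ (L := L) hχ)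

theorem fourierEmbedding_X [CharZero K] [CharZero L] (hχ : χ.IsPrimitive) (i : Fin p) :
    fourierEmbedding χ (L := L) hχ (algebraMap (MvPolynomial (Fin p) ℚ) _ (X i)) =
      fourierSum χ L ((i : ℕ) : ZMod p) := by
  rw [fourierEmbedding, IsFractionRing.lift_algebraMap]
  simp

theorem ringHom_ext_of_rat {σ E : Type*} [Field E] {f g : FractionRing (MvPolynomial σ ℚ) →+* E}
    (hX : ∀ i, f (algebraMap (MvPolynomial σ ℚ) _ (X i)) =
      g (algebraMap (MvPolynomial σ ℚ) _ (X i))) : f = g :=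
  ringHom_ext_of_fractionRing (fun a => DFunLike.congr_fun (RingHom.ext_rat
    (f.comp ((algebraMap (MvPolynomial σ ℚ) _).comp C))
    (g.comp ((algebraMap (MvPolynomial σ ℚ) _).comp C))) a) hX

theorem fourierEmbedding_of_semilinear [CharZero K] [CharZero L] (hχ : χ.IsPrimitive) {g : ZMod p}
    (hg : g ≠ 0) (T : L →+* L)
    (hTX : ∀ i, T (algebraMap _ L (X i : MvPolynomial (ZMod p) K)) =
      algebraMap _ L (X (g * i) : MvPolynomial (ZMod p) K))
    (hTK : ∀ a, T (algebraMap K L (χ a)) = algebraMap K L (χ (g * a)))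
    (x : FractionRing (MvPolynomial (Fin p) ℚ)) :
    T (fourierEmbedding χ hχ x) = fourierEmbedding χ hχ x := by
  revert x
  apply DFunLike.congr_fun (F := FractionRing (MvPolynomial (Fin p) ℚ) →+* L)
    (f := T.comp (fourierEmbedding χ hχ))
  apply ringHom_ext_of_rat
  intro i
  rw [RingHom.comp_apply, fourierEmbedding_X, fourierSum, map_sum]
  refine Eq.trans ?_ (Equiv.sum_comp (Equiv.mulLeft₀ g hg) _)
  refine Finset.sum_congr rfl fun j _ => ?_
  rw [map_mul, hTX, hTK, mul_left_comm]
  rfl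

theorem fourierEmbedding_of_character [CharZero K] [CharZero L] (hχ : χ.IsPrimitive) (c : L →+* L)
    (hc : ∀ q, c (algebraMap _ L q) = algebraMap _ L (characterAction χ q))
    (σ : FractionRing (MvPolynomial (Fin p) ℚ) →+* FractionRing (MvPolynomial (Fin p) ℚ))
    (hσ : ∀ i : Fin p, σ (algebraMap (MvPolynomial (Fin p) ℚ) _ (X i)) =
      algebraMap (MvPolynomial (Fin p) ℚ) _ (X (finRotate p i)))
    (x : FractionRing (MvPolynomial (Fin p) ℚ)) :
    c (fourierEmbedding χ hχ x) = fourierEmbedding χ hχ (σ x) := by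
  have hcC : ∀ a, c (algebraMap K L a) = algebraMap K L a := by
    intro a
    rw [IsScalarTower.algebraMap_apply K (MvPolynomial (ZMod p) K) L, hc, algebraMap_eq,
      characterAction, aeval_C, algebraMap_eq]
  revert x
  apply DFunLike.congr_fun (F := FractionRing (MvPolynomial (Fin p) ℚ) →+* L)
    (f := c.comp (fourierEmbedding χ hχ)) (g := (fourierEmbedding χ hχ).comp σ)
  apply ringHom_ext_of_rat
  intro i
  rw [RingHom.comp_apply, RingHom.comp_apply, hσ, fourierEmbedding_X, fourierEmbedding_X,
    natCast_finRotate,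
    fourierSum, fourierSum, map_sum]
  refine Finset.sum_congr rfl fun j _ => ?_
  rw [map_mul, hcC, hc, characterAction, aeval_X, map_mul (algebraMap _ L), ← algebraMap_eq,
    ← IsScalarTower.algebraMap_apply K (MvPolynomial (ZMod p) K) L, add_mul, one_mul,
    AddChar.map_add_eq_mul, map_mul (algebraMap K L), mul_assoc]

end FourierEmbedding

section Averaging

theorem map_sum_iterate_eq {F : Type*} [Field F] (σ : F →+* F) {n : ℕ} (hσ : ∀ x, σ^[n] x = x)
    (x : F) : σ (∑ m ∈ Finset.range n, σ^[m] x) = ∑ m ∈ Finset.range n, σ^[m] x := by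
  simp only [map_sum, ← Function.iterate_succ_apply' (⇑σ)]
  have h1 := (Finset.sum_range_succ (fun m => σ^[m] x) n).symm.trans
    (Finset.sum_range_succ' (fun m => σ^[m] x) n)
  rw [hσ x, Function.iterate_zero_apply] at h1
  exact (add_right_cancel h1).symm

theorem mem_of_map_eq_of_averaging {K L F : Type*} [Field K] [CharZero K] [Algebra.IsAlgebraic ℚ K]
    [Field L] [CharZero L] [Algebra K L] [Field F] (j : F →+* L) (c : L →+* L)
    (hcK : ∀ a, c (algebraMap K L a) = algebraMap K L a) (σ : F →+* F)
    (hcj : ∀ x, c (j x) = j (σ x)) {n : ℕ} (hn : 0 < n) (hσ : ∀ x, σ^[n] x = x)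
    (hgen : ∀ M : Subfield L, (∀ a, algebraMap K L a ∈ M) → (∀ x, j x ∈ M) → ∀ x, x ∈ M)
    (E : Subfield L) (hKE : ∀ a, algebraMap K L a ∈ E) (hjE : ∀ x, σ x = x → j x ∈ E)
    {x : L} (hx : c x = x) : x ∈ E := by
  have hcj' : ∀ (m : ℕ) (y : F), c^[m] (j y) = j (σ^[m] y) := by
    intro m y
    induction m with
    | zero => rfl
    | succ m ih => rw [Function.iterate_succ_apply', ih, hcj, Function.iterate_succ_apply']
  have hcK' : ∀ (m : ℕ) (a : K), c^[m] (algebraMap K L a) = algebraMap K L a := by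
    intro m a
    exact Function.iterate_fixed (hcK a) m
  let F' := j.fieldRange
  have h1 : x ∈ IntermediateField.adjoin F' (Set.range (algebraMap K L)) :=
    hgen (IntermediateField.adjoin F' (Set.range (algebraMap K L))).toSubfield
      (fun a => IntermediateField.subset_adjoin _ _ ⟨a, rfl⟩)
      (fun y => IntermediateField.algebraMap_mem _ (⟨j y, y, rfl⟩ : F')) x
  have h2 : x ∈ Algebra.adjoin F' (Set.range (algebraMap K L)) := by
    rw [← IntermediateField.adjoin_toSubalgebra_of_isAlgebraic]
    · exact h1
    · rintro _ ⟨a, rfl⟩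
      have h3 : IsAlgebraic ℚ (algebraMap K L a) :=
        (Algebra.IsAlgebraic.isAlgebraic (R := ℚ) a).algebraMap
      exact h3.tower_top F'
  have h3 : x ∈ Submodule.span F' (Set.range (algebraMap K L)) := by
    have h4 : (Submonoid.closure (Set.range (algebraMap K L)) : Set L) =
        Set.range (algebraMap K L) := by
      have h5 : Set.range (algebraMap K L) =
          (MonoidHom.mrange ((algebraMap K L : K →+* L) : K →* L) : Set L) := rfl
      rw [h5, Submonoid.closure_eq]
    rwa [← Subalgebra.mem_toSubmodule, Algebra.adjoin_eq_span, h4] at h2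
  have h4 : ∀ f : F, ∑ m ∈ Finset.range n, c^[m] (j f * x) ∈ E := by
    clear hx h1 h2
    induction h3 using Submodule.span_induction with
    | mem x hx =>
      obtain ⟨a, rfl⟩ := hx
      intro f
      simp only [iterate_map_mul, hcj', hcK']
      rw [← Finset.sum_mul, ← map_sum]
      exact mul_mem (hjE _ (map_sum_iterate_eq σ hσ f)) (hKE a)
    | zero => intro f; simp
    | add x y _ _ hx hy =>
      intro f
      simp only [mul_add, iterate_map_add, Finset.sum_add_distrib]
      exact add_mem (hx f) (hy f)
    | smul b x _ hx =>
      intro f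
      obtain ⟨_, b, rfl⟩ := b
      have h5 := hx (f * b)
      rw [map_mul] at h5
      have h6 : j f * ((⟨j b, b, rfl⟩ : F') • x) = j f * j b * x := (mul_assoc _ _ _).symm
      rw [← h6] at h5
      exact h5
  have h5 := h4 1
  have h6 : ∀ m, c^[m] x = x := fun m => Function.iterate_fixed hx m
  simp only [map_one, one_mul, h6, Finset.sum_const, Finset.card_range, nsmul_eq_mul] at h5
  rw [← mul_div_cancel_left₀ x (Nat.cast_ne_zero.2 hn.ne' : (n : L) ≠ 0)]
  exact div_mem h5 (natCast_mem E n)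

end Averaging

section NoetherProblem

open MvPolynomial

theorem characterAction_injective {p : ℕ} [Fact p.Prime] {K : Type*} [Field K]
    (χ : AddChar (ZMod p) K) : Function.Injective (characterAction χ) := by
  rw [injective_iff_map_eq_zero]
  intro q hq
  ext m
  have h1 := coeff_characterAction χ m q
  rw [hq, coeff_zero] at h1
  rw [coeff_zero]
  refine (mul_eq_zero.1 h1.symm).resolve_left fun h0 => ?_
  have h2 := χ.map_add_eq_mul (monomialWeight fun i => (m i : ℤ))
      (-monomialWeight fun i => (m i : ℤ))
  rw [h0, zero_mul, add_neg_cancel, χ.map_zero_eq_one] at h2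
  exact one_ne_zero h2

/-- Permuting the variables by a multiplication and acting on the coefficients. -/
noncomputable def galoisTwist {p : ℕ} [Fact p.Prime] {K : Type*} [Field K] (θ : K ≃+* K)
    {g : ZMod p} (hg : g ≠ 0) : MvPolynomial (ZMod p) K ≃+* MvPolynomial (ZMod p) K :=
  (mapEquiv (ZMod p) θ).trans (renameEquiv K (Equiv.mulLeft₀ g hg)).toRingEquiv

theorem galoisTwist_X {p : ℕ} [Fact p.Prime] {K : Type*} [Field K] (θ : K ≃+* K)
    {g : ZMod p} (hg : g ≠ 0) (i : ZMod p) : galoisTwist θ hg (X i) = X (g * i) := by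
  simp [galoisTwist]

theorem galoisTwist_C {p : ℕ} [Fact p.Prime] {K : Type*} [Field K] (θ : K ≃+* K)
    {g : ZMod p} (hg : g ≠ 0) (a : K) : galoisTwist θ hg (C a) = C (θ a) := by
  simp [galoisTwist]

end NoetherProblem

section CyclicInvariants

open MvPolynomial

theorem finRotate_iterate_self {p : ℕ} [NeZero p] (i : Fin p) : (finRotate p)^[p] i = i := by
  have h1 : ∀ m : ℕ, (((finRotate p)^[m] i : ℕ) : ZMod p) = (i : ℕ) + m := by
    intro m
    induction m with
    | zero => simp
    | succ m ih => rw [Function.iterate_succ_apply', natCast_finRotate, ih]; push_cast; ring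
  have h2 := h1 p
  rw [ZMod.natCast_self, add_zero, ZMod.natCast_eq_natCast_iff', Nat.mod_eq_of_lt (Fin.is_lt _),
    Nat.mod_eq_of_lt (Fin.is_lt _), Fin.val_inj] at h2
  exact h2

theorem iterate_cyclicPermutation {p : ℕ} [NeZero p]
    (σ : FractionRing (MvPolynomial (Fin p) ℚ) →+* FractionRing (MvPolynomial (Fin p) ℚ))
    (hσ : ∀ i : Fin p, σ (algebraMap (MvPolynomial (Fin p) ℚ) _ (X i)) =
      algebraMap (MvPolynomial (Fin p) ℚ) _ (X (finRotate p i)))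
    (x : FractionRing (MvPolynomial (Fin p) ℚ)) : σ^[p] x = x := by
  have h1 : ∀ (m : ℕ) (i : Fin p), σ^[m] (algebraMap (MvPolynomial (Fin p) ℚ) _ (X i)) =
      algebraMap (MvPolynomial (Fin p) ℚ) _ (X ((finRotate p)^[m] i)) := by
    intro m i
    induction m with
    | zero => rfl
    | succ m ih => rw [Function.iterate_succ_apply', ih, hσ, Function.iterate_succ_apply']
  have h2 : σ ^ p = RingHom.id _ := by
    apply ringHom_ext_of_rat
    intro i
    rw [RingHom.coe_pow, h1, finRotate_iterate_self, RingHom.id_apply]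
  rw [← RingHom.coe_pow, h2, RingHom.id_apply]

theorem mem_fixedField_zpowers {F : Type*} [Field F] [Algebra ℚ F] {σ : F ≃ₐ[ℚ] F} {x : F} :
    x ∈ IntermediateField.fixedField (Subgroup.zpowers σ) ↔ σ x = x := by
  rw [IntermediateField.mem_fixedField_iff]
  refine ⟨fun h => h σ (Subgroup.mem_zpowers σ), fun h f hf => ?_⟩
  have h1 : Subgroup.zpowers σ ≤ MulAction.stabilizer (F ≃ₐ[ℚ] F) x := by
    rw [Subgroup.zpowers_le, MulAction.mem_stabilizer_iff]
    exact h
  exact MulAction.mem_stabilizer_iff.1 (h1 hf)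

variable {p : ℕ} [Fact p.Prime] {K L : Type*} [Field K] [CharZero K] [Field L] [CharZero L]
  [Algebra (MvPolynomial (ZMod p) K) L] [Algebra K L]
  [IsScalarTower K (MvPolynomial (ZMod p) K) L] [IsFractionRing (MvPolynomial (ZMod p) K) L]
  {χ : AddChar (ZMod p) K} (hχ : χ.IsPrimitive)
  {σ : FractionRing (MvPolynomial (Fin p) ℚ) ≃ₐ[ℚ] FractionRing (MvPolynomial (Fin p) ℚ)}
  (e : IntermediateField.fixedField (Subgroup.zpowers σ) ≃ₐ[ℚ]
    FractionRing (MvPolynomial (Fin p) ℚ))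

/-- The images of the generators of a rational field of cyclic invariants. -/
noncomputable def invariantGenerator (L : Type*) [Field L] [CharZero L]
    [Algebra (MvPolynomial (ZMod p) K) L] [Algebra K L]
    [IsScalarTower K (MvPolynomial (ZMod p) K) L] [IsFractionRing (MvPolynomial (ZMod p) K) L]
    (i : ZMod p) : L :=
  fourierEmbedding χ (L := L) hχ (e.symm (algebraMap (MvPolynomial (Fin p) ℚ) _
    (X ((ZMod.finEquiv p).symm i))))

theorem fourierEmbedding_mem_of_invariantGenerator_mem (E : Subfield L)
    (hE : ∀ i, invariantGenerator hχ e L i ∈ E) {x : FractionRing (MvPolynomial (Fin p) ℚ)}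
    (hx : σ x = x) : fourierEmbedding χ (L := L) hχ x ∈ E := by
  let g : FractionRing (MvPolynomial (Fin p) ℚ) →+* L :=
    (fourierEmbedding χ (L := L) hχ).comp ((algebraMap
      (IntermediateField.fixedField (Subgroup.zpowers σ)) _).comp (e.symm : _ →+* _))
  have h1 : ∀ y, g y ∈ E := by
    intro y
    let M : IntermediateField ℚ (FractionRing (MvPolynomial (Fin p) ℚ)) :=
      { E.comap g with
        algebraMap_mem' := fun q => by
          rw [eq_ratCast]
          exact SubfieldClass.ratCast_mem (E.comap g) q }
    have h2 : (⊤ : IntermediateField ℚ (FractionRing (MvPolynomial (Fin p) ℚ))) ≤ M := by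
      rw [← IsFractionRing.adjoin_range_X_eq_top (ι := Fin p), IntermediateField.adjoin_le_iff]
      rintro _ ⟨i, rfl⟩
      have h3 := hE (ZMod.finEquiv p i)
      rw [invariantGenerator, RingEquiv.symm_apply_apply] at h3
      exact h3
    exact h2 (IntermediateField.mem_top (x := y))
  have h2 := h1 (e ⟨x, mem_fixedField_zpowers.2 hx⟩)
  have h3 : g (e ⟨x, mem_fixedField_zpowers.2 hx⟩) = fourierEmbedding χ (L := L) hχ x := by
    simp [g]
  rwa [h3] at h2

variable (c : L →+* L) (hc : ∀ q, c (algebraMap _ L q) = algebraMap _ L (characterAction χ q))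
  (hσ : ∀ i : Fin p, σ (algebraMap (MvPolynomial (Fin p) ℚ) _ (X i)) =
      algebraMap (MvPolynomial (Fin p) ℚ) _ (X (finRotate p i)))

omit [CharZero K] [CharZero L] [IsFractionRing (MvPolynomial (ZMod p) K) L] in
include hc in
theorem map_algebraMap_of_character (a : K) : c (algebraMap K L a) = algebraMap K L a := by
  rw [IsScalarTower.algebraMap_apply K (MvPolynomial (ZMod p) K) L, hc, algebraMap_eq,
    characterAction, aeval_C, algebraMap_eq]

include hc hσ in
theorem mem_adjoin_invariantGenerator [Algebra.IsAlgebraic ℚ K] {x : L} (hx : c x = x) :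
    x ∈ IntermediateField.adjoin K (Set.range (invariantGenerator hχ e L)) := by
  let τ : FractionRing (MvPolynomial (Fin p) ℚ) →+* FractionRing (MvPolynomial (Fin p) ℚ) :=
    (σ : _ →+* _)
  have hτ : ∀ y, τ y = σ y := fun _ => rfl
  have hτX : ∀ i : Fin p, τ (algebraMap (MvPolynomial (Fin p) ℚ) _ (X i)) =
      algebraMap (MvPolynomial (Fin p) ℚ) _ (X (finRotate p i)) := hσ
  clear_value τ
  have h1 := fourierEmbedding_of_character χ (L := L) hχ c hc τ hτX
  have hK : ∀ (S : Set L) (a : K), algebraMap K L a ∈ (IntermediateField.adjoin K S).toSubfield :=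
    fun S a => IntermediateField.algebraMap_mem _ a
  have hgen : ∀ M : Subfield L, (∀ a, algebraMap K L a ∈ M) →
      (∀ x, fourierEmbedding χ (L := L) hχ x ∈ M) → ∀ x, x ∈ M := by
    intro M hM hj
    refine eq_top_of_algebraMap_mem M hM fun k =>
      algebraMap_X_mem_adjoin_fourierSum χ hχ M hM (fun i => ?_) k
    have h2 := hj (algebraMap (MvPolynomial (Fin p) ℚ) _ (X ⟨i.val, i.val_lt⟩))
    rw [fourierEmbedding_X] at h2
    simpa using h2
  have hinv : ∀ y, τ y = y → fourierEmbedding χ (L := L) hχ y ∈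
      (IntermediateField.adjoin K (Set.range (invariantGenerator hχ e L))).toSubfield := by
    intro y hy
    rw [hτ] at hy
    exact fourierEmbedding_mem_of_invariantGenerator_mem hχ e _
      (fun i => IntermediateField.subset_adjoin K _ (Set.mem_range_self i)) hy
  exact mem_of_map_eq_of_averaging (fourierEmbedding χ (L := L) hχ) c
    (map_algebraMap_of_character c hc) τ h1 (Fact.out : p.Prime).pos
    (iterate_cyclicPermutation τ hτX) hgen _ (hK _) hinv hx

include hc hσ in
theorem map_invariantGenerator (i : ZMod p) :
    c (invariantGenerator hχ e L i) = invariantGenerator hχ e L i := by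
  rw [invariantGenerator, fourierEmbedding_of_character χ (L := L) hχ c hc (σ : _ →+* _) hσ]
  congr 1
  exact mem_fixedField_zpowers.1 (Subtype.mem _)

include hc hσ in
theorem algebraicIndependent_invariantGenerator [Algebra.IsAlgebraic ℚ K] :
    AlgebraicIndependent K (invariantGenerator hχ e L) := by
  refine IsFractionRing.algebraicIndependent_of_pow_mem fun i =>
    ⟨p, (Fact.out : p.Prime).pos, mem_adjoin_invariantGenerator hχ e c hc hσ ?_⟩
  rw [map_pow, hc, characterAction, aeval_X, map_mul, mul_pow, ← map_pow, ← map_pow,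
    ← AddChar.map_nsmul_eq_pow, nsmul_eq_mul, CharP.cast_eq_zero, zero_mul, AddChar.map_zero_eq_one,
    map_one, map_one, one_mul]

end CyclicInvariants

section RationalInvariants

open MvPolynomial

theorem zmodChar_injective {p : ℕ} [NeZero p] {K : Type*} [Field K] {ζ : K}
    (hζ : IsPrimitiveRoot ζ p) {a : ZMod p} (ha : AddChar.zmodChar p hζ.pow_eq_one a = 1) :
    a = 0 := by
  rw [AddChar.zmodChar_apply] at ha
  rw [← ZMod.val_eq_zero]
  exact Nat.eq_zero_of_dvd_of_lt ((hζ.pow_eq_one_iff_dvd _).1 ha) a.val_lt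

theorem isPrimitiveRoot_zmodChar {p : ℕ} [Fact p.Prime] {K : Type*} [Field K] {ζ : K}
    (hζ : IsPrimitiveRoot ζ p) {g : ZMod p} (hg : g ≠ 0) :
    IsPrimitiveRoot (AddChar.zmodChar p hζ.pow_eq_one g) p := by
  rw [AddChar.zmodChar_apply]
  refine hζ.pow_of_coprime _ ?_
  exact (ZMod.isUnit_iff_coprime _ _).1 (by rw [ZMod.natCast_zmod_val]; exact hg.isUnit)

theorem exists_galois_zmodChar {p : ℕ} [Fact p.Prime] {K : Type*} [Field K] [CharZero K]
    [IsCyclotomicExtension {p} ℚ K] {ζ : K} (hζ : IsPrimitiveRoot ζ p) {g : ZMod p} (hg : g ≠ 0) :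
    ∃ θ : K ≃ₐ[ℚ] K, ∀ a, θ (AddChar.zmodChar p hζ.pow_eq_one a) =
      AddChar.zmodChar p hζ.pow_eq_one (g * a) := by
  have hirr : Irreducible (Polynomial.cyclotomic p ℚ) :=
    Polynomial.cyclotomic.irreducible_rat (Fact.out : p.Prime).pos
  let θ₁ := IsCyclotomicExtension.fromZetaAut (isPrimitiveRoot_zmodChar hζ hg) hirr
  let θ₂ := IsCyclotomicExtension.fromZetaAut hζ hirr
  refine ⟨θ₂.symm.trans θ₁, fun a => ?_⟩
  have h2 : (θ₂.symm.trans θ₁) ζ = AddChar.zmodChar p hζ.pow_eq_one g := by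
    rw [AlgEquiv.trans_apply, (AlgEquiv.symm_apply_eq θ₂).2
      (IsCyclotomicExtension.fromZetaAut_spec hζ hirr).symm]
    exact IsCyclotomicExtension.fromZetaAut_spec (isPrimitiveRoot_zmodChar hζ hg) hirr
  rw [AddChar.zmodChar_apply (a := a), map_pow, h2, ← AddChar.map_nsmul_eq_pow, nsmul_eq_mul,
    ZMod.natCast_zmod_val, mul_comm]

theorem iterate_eq_self_of_zmodChar {p : ℕ} [Fact p.Prime] {K : Type*} [Field K] [CharZero K]
    [IsCyclotomicExtension {p} ℚ K] {ζ : K} (hζ : IsPrimitiveRoot ζ p) {g : ZMod p}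
    (θ : K ≃ₐ[ℚ] K) (hθ : ∀ a, θ (AddChar.zmodChar p hζ.pow_eq_one a) =
      AddChar.zmodChar p hζ.pow_eq_one (g * a)) {n : ℕ} (hgn : g ^ n = 1) (a : K) :
    θ^[n] a = a := by
  have h1 : ∀ (m : ℕ) (a : ZMod p), θ^[m] (AddChar.zmodChar p hζ.pow_eq_one a) =
      AddChar.zmodChar p hζ.pow_eq_one (g ^ m * a) := by
    intro m a
    induction m with
    | zero => simp
    | succ m ih => rw [Function.iterate_succ_apply', ih, hθ, ← mul_assoc, pow_succ']
  have h2 : ((θ : K →ₐ[ℚ] K) ^ n) = AlgHom.id ℚ K := by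
    refine (hζ.powerBasis ℚ).algHom_ext ?_
    rw [hζ.powerBasis_gen ℚ, AlgHom.coe_pow, AlgHom.id_apply]
    have h3 := h1 n 1
    rw [hgn, one_mul] at h3
    have h4 : AddChar.zmodChar p hζ.pow_eq_one 1 = ζ := by
      rw [AddChar.zmodChar_apply, ZMod.val_one, pow_one]
    rw [h4] at h3
    exact h3
  have h3 := DFunLike.congr_fun h2 a
  rw [AlgHom.coe_pow] at h3
  exact h3

theorem exists_dvd_of_rational_of_cyclotomic (K : Type*) (L : Type u) {p : ℕ} [Fact p.Prime]
    [Field K] [CharZero K] [IsCyclotomicExtension {p} ℚ K] [Field L] [CharZero L]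
    [Algebra (MvPolynomial (ZMod p) K) L] [Algebra K L]
    [IsScalarTower K (MvPolynomial (ZMod p) K) L] [IsFractionRing (MvPolynomial (ZMod p) K) L]
    (hp : 2 < p)
    {σ : FractionRing (MvPolynomial (Fin p) ℚ) ≃ₐ[ℚ] FractionRing (MvPolynomial (Fin p) ℚ)}
    (hσ : ∀ i : Fin p, σ (algebraMap (MvPolynomial (Fin p) ℚ) _ (X i)) =
      algebraMap (MvPolynomial (Fin p) ℚ) _ (X (finRotate p i)))
    (e : IntermediateField.fixedField (Subgroup.zpowers σ) ≃ₐ[ℚ]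
      FractionRing (MvPolynomial (Fin p) ℚ))
    {R : Type*} [CommRing R] [IsDomain R] [CharZero R] {z : R} (hz : IsPrimitiveRoot z (p - 1))
    {g : ZMod p} (hg : IsPrimitiveRoot g (p - 1)) (φ : R →+* ZMod p) (hφ : φ z = g) :
    ∃ α, φ α = 0 ∧ α ∣ (p : R) ∧ α ∣ z - (g.val : R) := by
  have hg0 : g ≠ 0 := hg.ne_zero (by lia)
  have : Algebra.IsAlgebraic ℚ K := IsCyclotomicExtension.integral {p} ℚ K |>.isAlgebraic
  have hζ : IsPrimitiveRoot (IsCyclotomicExtension.zeta p ℚ K) p :=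
    IsCyclotomicExtension.zeta_spec p ℚ K
  obtain ⟨θ, hθ⟩ := exists_galois_zmodChar hζ hg0
  have hθn := iterate_eq_self_of_zmodChar hζ θ hθ hg.pow_eq_one
  have hχ1 : ∀ a, AddChar.zmodChar p hζ.pow_eq_one a = 1 → a = 0 := fun a => zmodChar_injective hζ
  have hχ : (AddChar.zmodChar p hζ.pow_eq_one).IsPrimitive :=
    AddChar.zmodChar_primitive_of_primitive_root p hζ
  generalize AddChar.zmodChar p hζ.pow_eq_one = χ at hθ hχ hχ1
  let TP := galoisTwist (θ : K ≃+* K) hg0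
  let T : L ≃+* L := IsFractionRing.ringEquivOfRingEquiv TP
  have hT : ∀ a, T (algebraMap _ L a) = algebraMap _ L (TP a) := fun a =>
    IsFractionRing.ringEquivOfRingEquiv_algebraMap TP a
  have hTP : ∀ i, TP (X i) = X (g * i) := galoisTwist_X (θ : K ≃+* K) hg0
  have hTC : ∀ a, TP (C a) = C (θ a) := galoisTwist_C (θ : K ≃+* K) hg0
  have hTK : ∀ a, T (algebraMap K L a) = algebraMap K L (θ a) := by
    intro a
    rw [IsScalarTower.algebraMap_apply K (MvPolynomial (ZMod p) K) L, hT, algebraMap_eq, hTC,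
      IsScalarTower.algebraMap_apply K (MvPolynomial (ZMod p) K) L, algebraMap_eq]
  clear_value TP T
  have hTn : ∀ x, T^[p - 1] x = x := by
    have h1 : (T : L →+* L) ^ (p - 1) = RingHom.id L := by
      apply ringHom_ext_of_fractionRing (σ := ZMod p) (k := K)
      · intro a
        rw [← algebraMap_eq, ← IsScalarTower.algebraMap_apply, RingHom.coe_pow, RingHom.id_apply]
        have h2 : ∀ m, (T : L →+* L)^[m] (algebraMap K L a) = algebraMap K L (θ^[m] a) := by
          intro m
          induction m with
          | zero => rfl
          | succ m ih =>
            rw [Function.iterate_succ_apply', ih, Function.iterate_succ_apply', ← hTK]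
            rfl
        rw [h2, hθn]
      · intro i
        rw [RingHom.coe_pow, RingHom.id_apply]
        have h2 : ∀ m, (T : L →+* L)^[m] (algebraMap _ L (X i : MvPolynomial (ZMod p) K)) =
            algebraMap _ L (X (g ^ m * i) : MvPolynomial (ZMod p) K) := by
          intro m
          induction m with
          | zero => rw [pow_zero, one_mul]; rfl
          | succ m ih =>
            rw [Function.iterate_succ_apply', ih, pow_succ', mul_assoc, ← hTP, ← hT]
            rfl
        rw [h2, hg.pow_eq_one, one_mul]
    intro x
    have h2 := DFunLike.congr_fun h1 x
    rw [RingHom.coe_pow] at h2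
    exact h2
  have hcinj : Function.Injective ((algebraMap (MvPolynomial (ZMod p) K) L).comp
      (characterAction χ : MvPolynomial (ZMod p) K →+* MvPolynomial (ZMod p) K)) := by
    rw [RingHom.coe_comp]
    exact (IsFractionRing.injective _ L).comp (characterAction_injective χ)
  let c : L →+* L := IsFractionRing.lift hcinj
  have hc : ∀ q, c (algebraMap _ L q) = algebraMap _ L (characterAction χ q) := fun q =>
    IsFractionRing.lift_algebraMap hcinj q
  clear_value c
  exact exists_dvd_of_algebraicIndependent_invariants hp hz hg φ hφ T hTn TP hT hTP
    (fun a => ⟨θ a, hTK a⟩) χ hχ1 c hc (algebraicIndependent_invariantGenerator hχ e c hc hσ)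
    (fun i => fourierEmbedding_of_semilinear χ hχ hg0 (T : L →+* L)
      (fun j => (hT _).trans (by rw [hTP])) (fun a => (hTK _).trans (by rw [hθ])) _)
    (map_invariantGenerator hχ e c hc hσ)
    (fun x hx => mem_adjoin_invariantGenerator hχ e c hc hσ hx)

/-- If the cyclic invariants are rational over `ℚ` then, in any domain `R` containing a primitive
root of unity `z` of order `p - 1`, the ideal `(p, z - g)` is principal up to elements outside of
a prime over `p`. -/
theorem exists_dvd_of_rational {p : ℕ} [Fact p.Prime] (hp : 2 < p)
    {σ : FractionRing (MvPolynomial (Fin p) ℚ) ≃ₐ[ℚ] FractionRing (MvPolynomial (Fin p) ℚ)}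
    (hσ : ∀ i : Fin p, σ (algebraMap (MvPolynomial (Fin p) ℚ) _ (X i)) =
      algebraMap (MvPolynomial (Fin p) ℚ) _ (X (finRotate p i)))
    (e : IntermediateField.fixedField (Subgroup.zpowers σ) ≃ₐ[ℚ]
      FractionRing (MvPolynomial (Fin p) ℚ))
    {R : Type*} [CommRing R] [IsDomain R] [CharZero R] {z : R} (hz : IsPrimitiveRoot z (p - 1))
    {g : ZMod p} (hg : IsPrimitiveRoot g (p - 1)) (φ : R →+* ZMod p) (hφ : φ z = g) :
    ∃ α, φ α = 0 ∧ α ∣ (p : R) ∧ α ∣ z - (g.val : R) := by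
  have : @IsCyclotomicExtension {p} ℚ (CyclotomicField p ℚ) _ _ DivisionRing.toRatAlgebra := by
    have h1 : IsCyclotomicExtension {p} ℚ (CyclotomicField p ℚ) :=
      CyclotomicField.isCyclotomicExtension p ℚ
    convert! h1
  exact exists_dvd_of_rational_of_cyclotomic (CyclotomicField p ℚ)
    (FractionRing (MvPolynomial (ZMod p) (CyclotomicField p ℚ))) hp hσ e hz hg φ hφ

end RationalInvariants

section CoefficientSums

/-- The value at `x` of the polynomial with coefficients `f 0, …, f (n - 1)`. -/
def evalCoeffs {S : Type*} [CommSemiring S] (f : ℕ → ℕ) (n : ℕ) (x : S) : S :=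
  ∑ k ∈ Finset.range n, (f k : S) * x ^ k

theorem map_evalCoeffs {S S' : Type*} [CommSemiring S] [CommSemiring S'] (g : S →+* S')
    (f : ℕ → ℕ) (n : ℕ) (x : S) : g (evalCoeffs f n x) = evalCoeffs f n (g x) := by
  simp [evalCoeffs]

theorem natCast_evalCoeffs {S : Type*} [CommSemiring S] (f : ℕ → ℕ) (n x : ℕ) :
    ((evalCoeffs f n x : ℕ) : S) = evalCoeffs f n (x : S) := by
  simp [evalCoeffs]

theorem dvd_evalCoeffs_sub {S : Type*} [CommRing S] (f : ℕ → ℕ) (n : ℕ) (x y : S) :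
    x - y ∣ evalCoeffs f n x - evalCoeffs f n y := by
  rw [evalCoeffs, evalCoeffs, ← Finset.sum_sub_distrib]
  refine Finset.dvd_sum fun k _ => ?_
  rw [← mul_sub]
  exact (sub_dvd_pow_sub_pow x y k).mul_left _

/-- The cyclic autocorrelation of the first `n` values of `f`. -/
def autocorrelation (f : ℕ → ℕ) (n k : ℕ) : ℕ :=
  ∑ j ∈ Finset.range n, f ((j + k) % n) * f j

theorem sum_range_eq_sum_zmod {M : Type*} [AddCommMonoid M] (n : ℕ) [NeZero n] (f : ℕ → M) :
    ∑ k ∈ Finset.range n, f k = ∑ a : ZMod n, f a.val := by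
  refine (Finset.sum_nbij' ZMod.val (fun k : ℕ => (k : ZMod n)) ?_ ?_ ?_ ?_ ?_).symm
  · intro a _; exact Finset.mem_range.2 a.val_lt
  · intro k _; exact Finset.mem_univ _
  · intro a _; exact ZMod.natCast_zmod_val a
  · intro k hk; exact ZMod.val_cast_of_lt (Finset.mem_range.1 hk)
  · intro a _; rfl

theorem evalCoeffs_mul_evalCoeffs {S : Type*} [CommRing S] [IsDomain S] {n : ℕ} [NeZero n]
    {x y : S} (hx : x ^ n = 1) (hxy : x * y = 1) {m : ℕ} (hm : x ^ m ≠ 1) (f : ℕ → ℕ) {p : ℕ}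
    (hf : ∀ k < n, autocorrelation f n (k + m) + (if k = 0 then p else 0) =
      autocorrelation f n k + (if (k + m) % n = 0 then p else 0)) :
    evalCoeffs f n x * evalCoeffs f n y = p := by
  let X : ZMod n → S := fun a => x ^ a.val
  have hX : ∀ k : ℕ, X k = x ^ k := by
    intro k
    simp only [X, ZMod.val_natCast]
    conv_rhs => rw [← Nat.mod_add_div k n, pow_add, pow_mul, hx, one_pow, mul_one]
  have hXadd : ∀ a b, X (a + b) = X a * X b := by
    intro a b
    rw [← ZMod.natCast_zmod_val a, ← ZMod.natCast_zmod_val b, ← Nat.cast_add, hX, hX, hX, pow_add]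
  have hX0 : X 0 = 1 := by simpa using hX 0
  have hY : ∀ a : ZMod n, y ^ a.val = X (-a) := by
    intro a
    have h1 : X a * y ^ a.val = 1 := by simp only [X]; rw [← mul_pow, hxy, one_pow]
    have h2 : X (-a) * X a = 1 := by rw [← hXadd, neg_add_cancel, hX0]
    calc y ^ a.val = X (-a) * X a * y ^ a.val := by rw [h2, one_mul]
      _ = X (-a) := by rw [mul_assoc, h1, mul_one]
  let A : ZMod n → S := fun a => ∑ j : ZMod n, (f (j + a).val : S) * f j.val
  have hA : ∀ k : ℕ, A k = (autocorrelation f n k : ℕ) := by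
    intro k
    rw [autocorrelation, sum_range_eq_sum_zmod, Nat.cast_sum]
    refine Finset.sum_congr rfl fun j _ => ?_
    rw [Nat.cast_mul, ZMod.val_add, ZMod.val_natCast, Nat.add_mod_mod]
  have h1 : evalCoeffs f n x * evalCoeffs f n y = ∑ a, A a * X a := by
    simp only [evalCoeffs, sum_range_eq_sum_zmod, hY, A]
    rw [Finset.sum_mul_sum, Finset.sum_comm]
    simp only [Finset.sum_mul]
    rw [Finset.sum_comm (s := (Finset.univ : Finset (ZMod n))) (t := Finset.univ)
      (f := fun a j => (f (j + a).val : S) * f j.val * X a)]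
    refine Finset.sum_congr rfl fun j _ => ?_
    refine Eq.trans ?_ (Equiv.sum_comp (Equiv.subRight j) _)
    refine Finset.sum_congr rfl fun i _ => ?_
    rw [Equiv.subRight_apply, add_sub_cancel, sub_eq_add_neg, hXadd]
    simp only [X]
    ring
  let u : ZMod n → S := fun a => A a - if a = 0 then (p : S) else 0
  have hu : ∀ a, u (a + m) = u a := by
    intro a
    have h2 := hf a.val a.val_lt
    have h3 := congrArg (Nat.cast : ℕ → S) h2
    have h4 : (a.val + m) % n = 0 ↔ a + m = 0 := by
      rw [← ZMod.natCast_zmod_val a, ← Nat.cast_add, ZMod.natCast_eq_zero_iff,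
        Nat.dvd_iff_mod_eq_zero, ZMod.natCast_zmod_val]
    rw [Nat.cast_add, Nat.cast_add, ← hA, ← hA, Nat.cast_add, ZMod.natCast_zmod_val] at h3
    simp only [h4, ZMod.val_eq_zero, Nat.cast_ite, Nat.cast_zero] at h3
    simp only [u]
    linear_combination h3
  have h2 : ∑ a, u a * X a = 0 := by
    have h3 : ∑ a, u a * X a = x ^ m * ∑ a, u a * X a := by
      conv_lhs => rw [← Equiv.sum_comp (Equiv.addRight (m : ZMod n))]
      rw [Finset.mul_sum]
      refine Finset.sum_congr rfl fun a _ => ?_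
      rw [Equiv.coe_addRight, hu, hXadd, hX]
      ring
    have h4 : (x ^ m - 1) * ∑ a, u a * X a = 0 := by rw [sub_mul, ← h3, one_mul, sub_self]
    exact (mul_eq_zero.1 h4).resolve_left (sub_ne_zero.2 hm)
  rw [h1, ← sub_eq_zero, ← h2]
  simp only [u, sub_mul, Finset.sum_sub_distrib, ite_mul, zero_mul, Finset.sum_ite_eq',
    Finset.mem_univ, if_true, hX0, mul_one]

end CoefficientSums

section StickelbergerFactorization

variable {O : Type*} [CommRing O] {n p : ℕ} [NeZero n] [Fact p.Prime] {ζ : O}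
    {σ : (ZMod n)ˣ → O →+* O}
  {t : ℕ} {α : O}

omit [NeZero n] in
theorem pow_val_pow_val {S : Type*} [CommRing S] {z : S} (hz : z ^ n = 1) (a b : (ZMod n)ˣ) :
    (z ^ (a : ZMod n).val) ^ (b : ZMod n).val = z ^ ((a * b : (ZMod n)ˣ) : ZMod n).val := by
  rw [← pow_mul, Units.val_mul, ZMod.val_mul]
  conv_lhs => rw [← Nat.mod_add_div ((a : ZMod n).val * (b : ZMod n).val) n, pow_add, pow_mul z n,
    hz, one_pow, mul_one]

omit [NeZero n] in
theorem pow_val_pow_val_inv {S : Type*} [CommRing S] {z : S} (hz : z ^ n = 1) (a : (ZMod n)ˣ) :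
    (z ^ (a : ZMod n).val) ^ ((a⁻¹ : (ZMod n)ˣ) : ZMod n).val = z := by
  rw [pow_val_pow_val hz, mul_inv_cancel, Units.val_one, ZMod.val_one_eq_one_mod,
    ← Nat.mod_add_div 1 n]
  conv_rhs => rw [← pow_one z, ← Nat.mod_add_div 1 n, pow_add, pow_mul, hz, one_pow, mul_one]
  simp

omit [NeZero n] [Fact p.Prime] in
theorem conjugate_dvd_natCast (hp : α ∣ (p : O)) (a : (ZMod n)ˣ) : σ a α ∣ (p : O) := by
  have := map_dvd (σ a) hp
  rwa [map_natCast] at this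

omit [NeZero n] in
theorem conjugate_dvd_sub_pow (hζ : ζ ^ n = 1) (hσ : ∀ a, σ a ζ = ζ ^ (a : ZMod n).val)
    (ht : α ∣ ζ - t) (a : (ZMod n)ˣ) :
    σ a α ∣ ζ - (t : O) ^ ((a⁻¹ : (ZMod n)ˣ) : ZMod n).val := by
  have h1 := map_dvd (σ a) ht
  rw [map_sub, map_natCast, hσ] at h1
  have h2 := h1.trans (sub_dvd_pow_sub_pow _ _ ((a⁻¹ : (ZMod n)ˣ) : ZMod n).val)
  rwa [pow_val_pow_val_inv hζ] at h2

omit [NeZero n] in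
theorem conjugate_dvd_evalCoeffs (hζ : ζ ^ n = 1) (hσ : ∀ a, σ a ζ = ζ ^ (a : ZMod n).val)
    (hp : α ∣ (p : O)) (ht : α ∣ ζ - t) (f : ℕ → ℕ) (a : (ZMod n)ˣ)
    (ha : evalCoeffs f n ((t : ZMod p) ^ ((a⁻¹ : (ZMod n)ˣ) : ZMod n).val) = 0) :
    σ a α ∣ evalCoeffs f n ζ := by
  have h1 := (conjugate_dvd_sub_pow hζ hσ ht a).trans (dvd_evalCoeffs_sub f n _ _)
  rw [← Nat.cast_pow, ← natCast_evalCoeffs] at h1 ha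
  rw [ZMod.natCast_eq_zero_iff] at ha
  have h2 : σ a α ∣ ((evalCoeffs f n (t ^ ((a⁻¹ : (ZMod n)ˣ) : ZMod n).val) : ℕ) : O) :=
    (conjugate_dvd_natCast hp a).trans (Nat.cast_dvd_cast ha)
  have h3 := dvd_add h1 h2
  rwa [sub_add_cancel] at h3

theorem isCoprime_conjugate (hζ : ζ ^ n = 1) (hσ : ∀ a, σ a ζ = ζ ^ (a : ZMod n).val)
    (hp : α ∣ (p : O)) (ht : α ∣ ζ - t) (htn : IsPrimitiveRoot (t : ZMod p) n) {a b : (ZMod n)ˣ}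
    (hab : a ≠ b) : IsCoprime (σ a α) (σ b α) := by
  have h1 := conjugate_dvd_sub_pow hζ hσ ht a
  have h2 := conjugate_dvd_sub_pow hζ hσ ht b
  set u := ((a⁻¹ : (ZMod n)ˣ) : ZMod n).val
  set v := ((b⁻¹ : (ZMod n)ˣ) : ZMod n).val
  have h3 : IsCoprime (p : ℤ) ((t : ℤ) ^ u - (t : ℤ) ^ v) := by
    rw [Prime.coprime_iff_not_dvd (Nat.prime_iff_prime_int.1 Fact.out),
      ← ZMod.intCast_zmod_eq_zero_iff_dvd]
    push_cast
    rw [sub_eq_zero]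
    intro h
    have h4 := htn.pow_inj (ZMod.val_lt _) (ZMod.val_lt _) h
    exact hab (inv_injective (Units.ext (ZMod.val_injective n h4)))
  have h4 := h3.map (Int.castRingHom O)
  simp only [eq_intCast, Int.cast_sub, Int.cast_pow, Int.cast_natCast] at h4
  obtain ⟨x, y, hxy⟩ := h4
  obtain ⟨c, hc⟩ := h1
  obtain ⟨d, hd⟩ := h2
  obtain ⟨q, hq⟩ := conjugate_dvd_natCast (σ := σ) hp a
  refine ⟨x * q - y * c, y * d, ?_⟩
  rw [← hxy, hq]
  linear_combination y * hc - y * hd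

/-- The exponents of the conjugates of `α` dividing the value at `ζ`. -/
noncomputable def rootSupport (p : ℕ) (f : ℕ → ℕ) (n : ℕ) [NeZero n] (t : ℕ) : Finset (ZMod n)ˣ :=
  open Classical in
  Finset.univ.filter fun a =>
    evalCoeffs f n ((t : ZMod p) ^ ((a⁻¹ : (ZMod n)ˣ) : ZMod n).val) = 0

theorem prod_conjugate_dvd_evalCoeffs (hζ : ζ ^ n = 1) (hσ : ∀ a, σ a ζ = ζ ^ (a : ZMod n).val)
    (hp : α ∣ (p : O)) (ht : α ∣ ζ - t) (htn : IsPrimitiveRoot (t : ZMod p) n) (f : ℕ → ℕ) :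
    ∏ a ∈ rootSupport p f n t, σ a α ∣ evalCoeffs f n ζ := by
  refine Finset.prod_dvd_of_coprime (fun a _ b _ hab => isCoprime_conjugate hζ hσ hp ht htn hab)
    fun a ha => conjugate_dvd_evalCoeffs hζ hσ hp ht f a ?_
  simpa [rootSupport] using ha

theorem prod_pow_prod_conjugate (hmul : ∀ a b x, σ a (σ b x) = σ (a * b) x) (α : O)
    (s : Finset (ZMod n)ˣ) (η : ℕ → ℕ) {ℓ : ℕ}
    (hη : ∀ d : (ZMod n)ˣ, ℓ ∣ ∑ b : (ZMod n)ˣ, if b⁻¹ * d ∈ s then η (b : ZMod n).val else 0) :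
    ∃ δ, ∏ b : (ZMod n)ˣ, (σ b (∏ a ∈ s, σ a α)) ^ η (b : ZMod n).val = δ ^ ℓ := by
  choose e he using hη
  refine ⟨∏ d : (ZMod n)ˣ, σ d α ^ e d, ?_⟩
  have h1 : ∀ b : (ZMod n)ˣ, (σ b (∏ a ∈ s, σ a α)) ^ η (b : ZMod n).val =
      ∏ d : (ZMod n)ˣ, σ d α ^ (if b⁻¹ * d ∈ s then η (b : ZMod n).val else 0) := by
    intro b
    rw [map_prod, ← Finset.prod_pow, ← Fintype.prod_ite_mem,
      ← Equiv.prod_comp (Equiv.mulLeft b⁻¹)]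
    refine Finset.prod_congr rfl fun a _ => ?_
    by_cases ha : b⁻¹ * a ∈ s <;> simp [ha, hmul]
  simp only [h1]
  rw [Finset.prod_comm, ← Finset.prod_pow]
  refine Finset.prod_congr rfl fun d _ => ?_
  rw [Finset.prod_pow_eq_pow_sum, he, ← pow_mul, mul_comm]

end StickelbergerFactorization

section CyclotomicIntegers

open NumberField

variable {n : ℕ} [NeZero n] {K : Type*} [Field K] [NumberField K] [IsCyclotomicExtension {n} ℚ K]
  {ζ : K} (hζ : IsPrimitiveRoot ζ n)

include hζ in
theorem exists_ringHom_ringOfIntegers {S : Type*} [CommRing S] [IsDomain S] {s : S}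
    (hs : IsPrimitiveRoot s n) : ∃ φ : 𝓞 K →+* S, φ hζ.toInteger = s := by
  have h0 : algebraMap (𝓞 K) K hζ.toInteger = ζ := rfl
  have h1 : Polynomial.aeval s (minpoly ℤ hζ.integralPowerBasis.gen) = 0 := by
    rw [hζ.integralPowerBasis_gen, ← minpoly.algebraMap_eq (B' := K) RingOfIntegers.coe_injective,
      h0, ← Polynomial.cyclotomic_eq_minpoly hζ
      (NeZero.pos n), Polynomial.aeval_def, ← Polynomial.eval_map, Polynomial.map_cyclotomic]
    exact hs.isRoot_cyclotomic (NeZero.pos n)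
  refine ⟨(hζ.integralPowerBasis.lift s h1 : 𝓞 K →+* S), ?_⟩
  have h2 := hζ.integralPowerBasis.lift_gen s h1
  rw [hζ.integralPowerBasis_gen] at h2
  exact h2

include hζ in
theorem ringHom_ext_ringOfIntegers {S : Type*} [CommRing S] {f g : 𝓞 K →+* S}
    (h : f hζ.toInteger = g hζ.toInteger) : f = g := by
  have h1 : f.toIntAlgHom = g.toIntAlgHom := by
    refine hζ.integralPowerBasis.algHom_ext ?_
    rw [hζ.integralPowerBasis_gen]
    exact h
  ext x
  exact DFunLike.congr_fun h1 x

/-- The Galois automorphism `ζ ↦ ζ ^ a` of the ring of integers of a cyclotomic field. -/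
noncomputable def cyclotomicConjugate (K : Type*) [Field K] [NumberField K]
    [IsCyclotomicExtension {n} ℚ K] (a : (ZMod n)ˣ) : 𝓞 K →+* 𝓞 K :=
  RingOfIntegers.mapRingHom ((IsCyclotomicExtension.autEquivPow K
    (Polynomial.cyclotomic.irreducible_rat (NeZero.pos n))).symm a : K ≃ₐ[ℚ] K)

theorem cyclotomicConjugate_mul (a b : (ZMod n)ˣ) (x : 𝓞 K) :
    cyclotomicConjugate K a (cyclotomicConjugate K b x) = cyclotomicConjugate K (a * b) x := by
  apply RingOfIntegers.ext
  simp only [cyclotomicConjugate, RingOfIntegers.mapRingHom_apply, map_mul]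
  rfl

theorem autEquivPow_symm_apply_of_isPrimitiveRoot (a : (ZMod n)ˣ) {z : K}
    (hz : IsPrimitiveRoot z n) :
    (IsCyclotomicExtension.autEquivPow K
      (Polynomial.cyclotomic.irreducible_rat (NeZero.pos n))).symm a z = z ^ (a : ZMod n).val := by
  set θ := (IsCyclotomicExtension.autEquivPow K
      (Polynomial.cyclotomic.irreducible_rat (NeZero.pos n))).symm a with hθ
  have h1 : IsCyclotomicExtension.autEquivPow K
      (Polynomial.cyclotomic.irreducible_rat (NeZero.pos n)) θ = a := by
    rw [hθ, MulEquiv.apply_symm_apply]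
  have h2 := (IsCyclotomicExtension.zeta_spec n ℚ K).autToPow_spec ℚ θ
  rw [IsCyclotomicExtension.autEquivPow_apply] at h1
  change IsPrimitiveRoot.autToPow ℚ _ θ = a at h1
  rw [h1] at h2
  obtain ⟨i, -, hi⟩ := (IsCyclotomicExtension.zeta_spec n ℚ K).eq_pow_of_pow_eq_one hz.pow_eq_one
  rw [← hi, map_pow, ← h2, ← pow_mul, ← pow_mul, mul_comm]

theorem cyclotomicConjugate_toInteger (a : (ZMod n)ˣ) :
    cyclotomicConjugate K a hζ.toInteger = hζ.toInteger ^ (a : ZMod n).val := by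
  apply RingOfIntegers.ext
  simp only [cyclotomicConjugate, RingOfIntegers.mapRingHom_apply, map_pow]
  exact autEquivPow_symm_apply_of_isPrimitiveRoot a hζ

theorem prod_cyclotomicConjugate (α : 𝓞 K) :
    ∏ a : (ZMod n)ˣ, cyclotomicConjugate K a α = (Algebra.norm ℤ α : ℤ) := by
  have : IsGalois ℚ K := IsCyclotomicExtension.isGalois {n} ℚ K
  apply RingOfIntegers.ext
  rw [RingOfIntegers.coe_eq_algebraMap, RingOfIntegers.coe_eq_algebraMap, map_prod, map_intCast,
    ← Rat.cast_intCast (α := K), Algebra.coe_norm_int, ← eq_ratCast (algebraMap ℚ K),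
    Algebra.norm_eq_prod_automorphisms, ← Equiv.prod_comp (IsCyclotomicExtension.autEquivPow K
    (Polynomial.cyclotomic.irreducible_rat (NeZero.pos n))).symm.toEquiv]
  rfl

include hζ in
theorem map_cyclotomicConjugate_neg_one (τ : 𝓞 K →+* ℂ) (x : 𝓞 K) :
    τ (cyclotomicConjugate K (-1 : (ZMod n)ˣ) x) = (starRingEnd ℂ) (τ x) := by
  have h1 : τ.comp (cyclotomicConjugate K (-1 : (ZMod n)ˣ)) = (starRingEnd ℂ).comp τ := by
    apply ringHom_ext_ringOfIntegers hζ
    rw [RingHom.comp_apply, RingHom.comp_apply, cyclotomicConjugate_toInteger, map_pow]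
    have h2 : (τ hζ.toInteger) ^ n = 1 := by
      rw [← map_pow, hζ.toInteger_isPrimitiveRoot.pow_eq_one, map_one]
    have h3 : ‖τ hζ.toInteger‖ = 1 := Complex.norm_eq_one_of_pow_eq_one h2 (NeZero.ne n)
    rw [← Complex.inv_eq_conj h3]
    apply eq_inv_of_mul_eq_one_left
    have h4 := pow_val_pow_val_inv h2 (-1 : (ZMod n)ˣ)
    rw [← pow_succ]
    rw [← Nat.mod_add_div (ZMod.val ((-1 : (ZMod n)ˣ) : ZMod n) + 1) n, pow_add, pow_mul, h2,
      one_pow, mul_one]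
    have h5 : (((-1 : (ZMod n)ˣ) : ZMod n).val + 1) % n = 0 := by
      rw [← Nat.dvd_iff_mod_eq_zero, ← ZMod.natCast_eq_zero_iff]
      simp
    rw [h5, pow_zero]
  exact DFunLike.congr_fun h1 x

end CyclotomicIntegers

section JacobiSumObstruction

open NumberField

variable {n : ℕ} [NeZero n] {K : Type*} [Field K] [NumberField K] [IsCyclotomicExtension {n} ℚ K]
  {ζ : K} (hζ : IsPrimitiveRoot ζ n)

theorem cyclotomicConjugate_one (x : 𝓞 K) : cyclotomicConjugate K (1 : (ZMod n)ˣ) x = x := by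
  apply RingOfIntegers.ext
  simp only [cyclotomicConjugate, RingOfIntegers.mapRingHom_apply, map_one]
  rfl

include hζ in
theorem norm_eq_one_of_mul_conjugate_eq_one {β : 𝓞 K}
    (hβ : β * cyclotomicConjugate K (-1 : (ZMod n)ˣ) β = 1) (τ : 𝓞 K →+* ℂ) : ‖τ β‖ = 1 := by
  have h1 := congrArg τ hβ
  rw [map_mul, map_cyclotomicConjugate_neg_one hζ, map_one, Complex.mul_conj'] at h1
  have h2 : ‖τ β‖ ^ 2 = 1 := by exact_mod_cast h1
  exact (pow_eq_one_iff_of_nonneg (norm_nonneg _) two_ne_zero).1 h2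

include hζ in
theorem pow_two_mul_eq_one_of_mul_conjugate_eq_one (hn : Odd n) {β : 𝓞 K}
    (hβ : β * cyclotomicConjugate K (-1 : (ZMod n)ˣ) β = 1) : β ^ (2 * n) = 1 := by
  obtain ⟨k, hk, h1⟩ := Embeddings.pow_eq_one_of_norm_eq_one K ℂ β.isIntegral_coe fun τ =>
    norm_eq_one_of_mul_conjugate_eq_one hζ hβ (τ.comp (algebraMap (𝓞 K) K))
  obtain ⟨s, hs⟩ := hζ.exists_neg_pow_of_isOfFinOrder hn
    (isOfFinOrder_iff_pow_eq_one.2 ⟨k, hk, h1⟩)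
  apply RingOfIntegers.ext
  have h2 : (-ζ) ^ (2 * n) = 1 := by
    rw [pow_mul, neg_sq, pow_right_comm, hζ.pow_eq_one, one_pow]
  rw [RingOfIntegers.coe_eq_algebraMap, map_pow, hs, pow_right_comm, h2, one_pow]
  simp

include hζ in
theorem eq_one_of_mul_conjugate_mul_eq_one {β : 𝓞 K} {μ : ℤ}
    (h : β * cyclotomicConjugate K (-1 : (ZMod n)ˣ) β * (μ : 𝓞 K) = 1) : μ = 1 := by
  have h1 : IsUnit μ := by
    have h2 : IsUnit (algebraMap ℤ (𝓞 K) μ) := IsUnit.of_mul_eq_one_right _ h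
    exact isUnit_of_map_unit (algebraMap ℤ (𝓞 K)) μ h2
  obtain ⟨τ, -⟩ := exists_ringHom_ringOfIntegers hζ (Complex.isPrimitiveRoot_exp n (NeZero.ne n))
  have h2 := congrArg τ h
  rw [map_mul, map_mul, map_cyclotomicConjugate_neg_one hζ, map_one, Complex.mul_conj',
    map_intCast] at h2
  have h3 : ‖τ β‖ ^ 2 * (μ : ℝ) = 1 := by exact_mod_cast h2
  rcases Int.isUnit_iff.1 h1 with h4 | h4
  · exact h4
  · rw [h4] at h3
    push_cast at h3
    nlinarith [sq_nonneg ‖τ β‖]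

/-- If `(p, ζ - t)` is principal, then the Jacobi sum with coefficients `f` is, up to a root of
unity, a product of conjugates of a generator. -/
theorem exists_evalCoeffs_eq_mul_prod (hn : Odd n) {p : ℕ} [Fact p.Prime] {t m : ℕ} {f : ℕ → ℕ}
    (htn : IsPrimitiveRoot (t : ZMod p) n) {α : 𝓞 K} (hp : α ∣ (p : 𝓞 K))
    (ht : α ∣ hζ.toInteger - t) (φ : 𝓞 K →+* ZMod p) (hφ : φ α = 0) (hm : ¬ n ∣ m)
    (hf : ∀ k < n, autocorrelation f n (k + m) + (if k = 0 then p else 0) =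
      autocorrelation f n k + (if (k + m) % n = 0 then p else 0))
    (hS : ∀ a, -a ∈ rootSupport p f n t ↔ a ∉ rootSupport p f n t) :
    ∃ β : 𝓞 K, β ^ (2 * n) = 1 ∧ evalCoeffs f n hζ.toInteger =
      (∏ a ∈ rootSupport p f n t, cyclotomicConjugate K a α) * β := by
  have hz := hζ.toInteger_isPrimitiveRoot
  obtain ⟨β, hβ⟩ := prod_conjugate_dvd_evalCoeffs hz.pow_eq_one
    (cyclotomicConjugate_toInteger hζ) hp ht htn f
  refine ⟨β, pow_two_mul_eq_one_of_mul_conjugate_eq_one hζ hn ?_, hβ⟩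
  set A := ∏ a ∈ rootSupport p f n t, cyclotomicConjugate K a α with hA
  let c := cyclotomicConjugate K (-1 : (ZMod n)ˣ)
  have h1 : evalCoeffs f n hζ.toInteger * c (evalCoeffs f n hζ.toInteger) = p := by
    rw [map_evalCoeffs]
    refine evalCoeffs_mul_evalCoeffs hz.pow_eq_one ?_ (m := m) ?_ f hf
    · simp only [c]
      rw [cyclotomicConjugate_toInteger, ← pow_succ', hz.pow_eq_one_iff_dvd,
        ← ZMod.natCast_eq_zero_iff]
      simp
    · rwa [Ne, hz.pow_eq_one_iff_dvd]
  have h2 : A * c A = (Algebra.norm ℤ α : ℤ) := by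
    rw [← prod_cyclotomicConjugate (n := n), hA, map_prod,
      ← Finset.prod_mul_prod_compl
        (rootSupport p f n t)
      fun a => cyclotomicConjugate K a α]
    congr 1
    refine Finset.prod_nbij' (fun a => -a) (fun a => -a) ?_ ?_ ?_ ?_ ?_
    · intro a ha
      rw [Finset.mem_compl, hS, not_not]
      exact ha
    · intro a ha
      rw [hS]
      exact Finset.mem_compl.1 ha
    · intro a _; exact neg_neg a
    · intro a _; exact neg_neg a
    · intro a _
      simp only [c]
      rw [cyclotomicConjugate_mul, neg_one_mul]
  have h3 : ((Algebra.norm ℤ α : ℤ) : ZMod p) = 0 := by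
    rw [← map_intCast φ, ← prod_cyclotomicConjugate (n := n), map_prod]
    refine Finset.prod_eq_zero (Finset.mem_univ 1) ?_
    rw [cyclotomicConjugate_one, hφ]
  obtain ⟨μ, hμ⟩ := (ZMod.intCast_zmod_eq_zero_iff_dvd _ _).1 h3
  have h4 : β * c β * (μ : 𝓞 K) = 1 := by
    have h5 : (p : 𝓞 K) ≠ 0 := Nat.cast_ne_zero.2 (Fact.out : p.Prime).ne_zero
    apply mul_left_cancel₀ h5
    rw [hμ] at h2
    push_cast at h2
    rw [hβ, map_mul] at h1
    linear_combination h1 - β * c β * h2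
  have h5 := eq_one_of_mul_conjugate_mul_eq_one hζ h4
  rwa [h5, Int.cast_one, mul_one] at h4

theorem prod_evalCoeffs_pow_eq_zero_or_one {p : ℕ} {t : ℕ} {f η : ℕ → ℕ} {α β : 𝓞 K}
    (hβ : β ^ (2 * n) = 1) (hJ : evalCoeffs f n hζ.toInteger =
      (∏ a ∈ rootSupport p f n t, cyclotomicConjugate K a α) * β)
    {ℓ M r : ℕ} [Fact r.Prime] (hM : 2 * n ∣ M) (hr : r - 1 = ℓ * M)
    (hη : ∀ d : (ZMod n)ˣ, ℓ ∣ ∑ b : (ZMod n)ˣ,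
      if b⁻¹ * d ∈ rootSupport p f n t then η (b : ZMod n).val else 0)
    {w : ZMod r} (hw : IsPrimitiveRoot w n) :
    (∏ b : (ZMod n)ˣ, evalCoeffs f n (w ^ (b : ZMod n).val) ^ η (b : ZMod n).val) ^ M = 0 ∨
    (∏ b : (ZMod n)ˣ, evalCoeffs f n (w ^ (b : ZMod n).val) ^ η (b : ZMod n).val) ^ M = 1 := by
  obtain ⟨ψ, hψ⟩ := exists_ringHom_ringOfIntegers hζ hw
  obtain ⟨δ, hδ⟩ := prod_pow_prod_conjugate cyclotomicConjugate_mul α (rootSupport p f n t) η hη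
  have h1 : ∀ b : (ZMod n)ˣ, evalCoeffs f n (w ^ (b : ZMod n).val) =
      ψ (cyclotomicConjugate K b (∏ a ∈ rootSupport p f n t, cyclotomicConjugate K a α)) *
        ψ (cyclotomicConjugate K b β) := by
    intro b
    rw [← map_mul, ← map_mul, ← hJ, map_evalCoeffs, map_evalCoeffs, cyclotomicConjugate_toInteger,
      map_pow, hψ]
  have h2 : ∀ b : (ZMod n)ˣ, ψ (cyclotomicConjugate K b β) ^ M = 1 := by
    intro b
    obtain ⟨k, rfl⟩ := hM
    rw [← map_pow, ← map_pow, pow_mul, hβ, one_pow, map_one, map_one]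
  have h3 : (∏ b : (ZMod n)ˣ, evalCoeffs f n (w ^ (b : ZMod n).val) ^ η (b : ZMod n).val) ^ M =
      ψ δ ^ (r - 1) := by
    simp only [h1, mul_pow]
    simp only [Finset.prod_mul_distrib, ← map_pow ψ]
    rw [← map_prod, hδ, mul_pow, hr, pow_mul]
    simp only [map_pow]
    rw [← Finset.prod_pow]
    simp only [pow_right_comm _ _ M, h2, one_pow, Finset.prod_const_one, mul_one]
  rw [h3]
  by_cases h4 : ψ δ = 0
  · rw [h4]
    rcases Nat.eq_zero_or_pos (r - 1) with h5 | h5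
    · exact Or.inr (by rw [h5, pow_zero])
    · exact Or.inl (zero_pow h5.ne')
  · exact Or.inr (ZMod.pow_card_sub_one_eq_one h4)

end JacobiSumObstruction

section NumericalCriterion

open NumberField

theorem val_coe_unit_injective (n : ℕ) [NeZero n] :
    Function.Injective fun b : (ZMod n)ˣ => (b : ZMod n).val :=
  fun _ _ h => Units.ext (ZMod.val_injective n h)

theorem image_val_coe_unit (n : ℕ) [NeZero n] :
    (Finset.univ.image fun b : (ZMod n)ˣ => (b : ZMod n).val) =
      (Finset.range n).filter fun k => k.Coprime n := by
  ext k
  simp only [Finset.mem_image, Finset.mem_univ, true_and, Finset.mem_filter, Finset.mem_range]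
  constructor
  · rintro ⟨b, rfl⟩
    exact ⟨ZMod.val_lt _, ZMod.val_coe_unit_coprime b⟩
  · rintro ⟨h1, h2⟩
    exact ⟨ZMod.unitOfCoprime k h2, by rw [ZMod.coe_unitOfCoprime, ZMod.val_cast_of_lt h1]⟩

theorem sum_units_eq_sum_range (n : ℕ) [NeZero n] (g : ℕ → ℕ) :
    ∑ b : (ZMod n)ˣ, g (b : ZMod n).val =
      ∑ k ∈ Finset.range n, if k.Coprime n then g k else 0 := by
  rw [← Finset.sum_filter, ← image_val_coe_unit,
    Finset.sum_image (val_coe_unit_injective n).injOn]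

theorem prod_units_eq_prod_range {M : Type*} [CommMonoid M] (n : ℕ) [NeZero n] (g : ℕ → M) :
    ∏ b : (ZMod n)ˣ, g (b : ZMod n).val =
      ∏ k ∈ Finset.range n, if k.Coprime n then g k else 1 := by
  rw [← Finset.prod_filter, ← image_val_coe_unit,
    Finset.prod_image (val_coe_unit_injective n).injOn]

theorem orderOf_neg_one_of_two_ne_zero {R : Type*} [Ring R] [NeZero (2 : R)] :
    orderOf (-1 : R) = 2 := by
  have : Nontrivial R := ⟨⟨2, 0, NeZero.ne 2⟩⟩
  rw [orderOf_neg_one, if_neg]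
  intro h
  have h1 := ringChar.Nat.cast_ringChar (R := R)
  rw [h] at h1
  exact NeZero.ne (2 : R) (by exact_mod_cast h1)

theorem isPrimitiveRoot_neg_of_odd {R : Type*} [CommRing R] [IsDomain R] [NeZero (2 : R)] {z : R}
    {n : ℕ} (hn : Odd n) (hz : IsPrimitiveRoot z n) : IsPrimitiveRoot (-z) (2 * n) := by
  convert! IsPrimitiveRoot.orderOf (-z)
  rw [neg_eq_neg_one_mul, (Commute.all _ _).orderOf_mul_eq_mul_orderOf_of_coprime]
  · rw [orderOf_neg_one_of_two_ne_zero, hz.eq_orderOf]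
  · rw [orderOf_neg_one_of_two_ne_zero, ← hz.eq_orderOf]
    exact Nat.coprime_two_left.2 hn

theorem not_nonempty_equiv_of_prod_evalCoeffs {p n : ℕ} [Fact p.Prime] [NeZero n]
    (hpn : p = 2 * n + 1) (hn : Odd n) (hn1 : 1 < n) {t m ℓ M r w : ℕ} [Fact r.Prime]
    {f η : ℕ → ℕ} {z : ℕ → Bool}
    (ht : IsPrimitiveRoot (t : ZMod p) n) (hw : IsPrimitiveRoot (w : ZMod r) n) (hm : ¬ n ∣ m)
    (hM : 2 * n ∣ M) (hr : r - 1 = ℓ * M)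
    (hf : ∀ k < n, autocorrelation f n (k + m) + (if k = 0 then p else 0) =
      autocorrelation f n k + (if (k + m) % n = 0 then p else 0))
    (hz : ∀ k < n, z k = true ↔ evalCoeffs f n ((t : ZMod p) ^ k) = 0)
    (hS : ∀ k < n, k.Coprime n → z (n - k) = !z k)
    (hη : ∀ d < n, d.Coprime n →
      ℓ ∣ ∑ b ∈ Finset.range n, if b.Coprime n then (if z (d * b % n) then η b else 0) else 0)
    (h0 : (∏ b ∈ Finset.range n,
      if b.Coprime n then evalCoeffs f n ((w : ZMod r) ^ b) ^ η b else 1) ^ M ≠ 0)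
    (h1 : (∏ b ∈ Finset.range n,
      if b.Coprime n then evalCoeffs f n ((w : ZMod r) ^ b) ^ η b else 1) ^ M ≠ 1)
    {σ : FractionRing (MvPolynomial (Fin p) ℚ) ≃ₐ[ℚ] FractionRing (MvPolynomial (Fin p) ℚ)}
    (hσ : ∀ i : Fin p,
      σ (algebraMap (MvPolynomial (Fin p) ℚ) (FractionRing (MvPolynomial (Fin p) ℚ))
          (MvPolynomial.X i)) =
        algebraMap (MvPolynomial (Fin p) ℚ) (FractionRing (MvPolynomial (Fin p) ℚ))
          (MvPolynomial.X (finRotate p i))) :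
    ¬ Nonempty ((IntermediateField.fixedField (Subgroup.zpowers σ)) ≃ₐ[ℚ]
        FractionRing (MvPolynomial (Fin p) ℚ)) := by
  rintro ⟨e⟩
  have hp2 : 2 < p := by omega
  have : Fact (2 < p) := ⟨hp2⟩
  have hcyc : @IsCyclotomicExtension {n} ℚ (CyclotomicField n ℚ) _ _
      DivisionRing.toRatAlgebra := by
    have h1 : IsCyclotomicExtension {n} ℚ (CyclotomicField n ℚ) :=
      CyclotomicField.isCyclotomicExtension n ℚ
    convert! h1
  have hζ := IsCyclotomicExtension.zeta_spec n ℚ (CyclotomicField n ℚ)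
  have hzneg : IsPrimitiveRoot (-hζ.toInteger) (p - 1) := by
    rw [show p - 1 = 2 * n by omega]
    exact isPrimitiveRoot_neg_of_odd hn hζ.toInteger_isPrimitiveRoot
  have htneg : IsPrimitiveRoot (-(t : ZMod p)) (p - 1) := by
    rw [show p - 1 = 2 * n by omega]
    have : NeZero (2 : ZMod p) := ⟨by
      intro h
      have h2 : ((2 : ℕ) : ZMod p) = 0 := by exact_mod_cast h
      exact absurd (Nat.le_of_dvd two_pos ((ZMod.natCast_eq_zero_iff 2 p).1 h2)) (by omega)⟩
    exact isPrimitiveRoot_neg_of_odd hn ht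
  obtain ⟨φ, hφ⟩ := exists_ringHom_ringOfIntegers hζ ht
  obtain ⟨α, hα0, hαp, hαz⟩ := exists_dvd_of_rational hp2 hσ e hzneg htneg φ
    (by rw [map_neg, hφ])
  have hαt : α ∣ hζ.toInteger - t := by
    have h2 : (p : ℤ) ∣ ((-(t : ZMod p)).val : ℤ) + t := by
      rw [← ZMod.intCast_zmod_eq_zero_iff_dvd]
      push_cast
      rw [ZMod.natCast_zmod_val, neg_add_cancel]
    obtain ⟨c, hc⟩ := h2
    have h3 : (((-(t : ZMod p)).val : 𝓞 (CyclotomicField n ℚ))) + t = p * c := by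
      exact_mod_cast congrArg (Int.cast : ℤ → 𝓞 (CyclotomicField n ℚ)) hc
    obtain ⟨x, hx⟩ := hαz
    obtain ⟨y, hy⟩ := hαp
    refine ⟨-x - y * c, ?_⟩
    linear_combination -hx - c * hy - h3
  have hmem : ∀ a : (ZMod n)ˣ, a ∈ rootSupport p f n t ↔
      z ((a⁻¹ : (ZMod n)ˣ) : ZMod n).val = true := by
    intro a
    rw [hz _ (ZMod.val_lt _)]
    simp [rootSupport]
  have hneg : ∀ a, -a ∈ rootSupport p f n t ↔ a ∉ rootSupport p f n t := by
    intro a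
    have : Fact (1 < n) := ⟨hn1⟩
    have h2 : ((a⁻¹ : (ZMod n)ˣ) : ZMod n) ≠ 0 := Units.ne_zero _
    have h3 := hS _ (ZMod.val_lt ((a⁻¹ : (ZMod n)ˣ) : ZMod n)) (ZMod.val_coe_unit_coprime _)
    rw [hmem, hmem, inv_neg, Units.val_neg, ZMod.neg_val, if_neg h2, h3]
    simp
  have hdvd : ∀ d : (ZMod n)ˣ, ℓ ∣ ∑ b : (ZMod n)ˣ,
      if b⁻¹ * d ∈ rootSupport p f n t then η (b : ZMod n).val else 0 := by
    intro d
    have h2 := hη _ (ZMod.val_lt ((d⁻¹ : (ZMod n)ˣ) : ZMod n)) (ZMod.val_coe_unit_coprime _)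
    rw [← sum_units_eq_sum_range n fun b =>
      if z (((d⁻¹ : (ZMod n)ˣ) : ZMod n).val * b % n) then η b else 0] at h2
    convert h2 using 4 with b
    rw [hmem, mul_inv_rev, inv_inv, Units.val_mul, ZMod.val_mul]
  obtain ⟨β, hβ, hJ⟩ := exists_evalCoeffs_eq_mul_prod hζ hn ht hαp hαt φ hα0 hm hf hneg
  have h2 := prod_evalCoeffs_pow_eq_zero_or_one hζ hβ hJ hM hr hdvd hw
  rw [prod_units_eq_prod_range n fun b => evalCoeffs f n ((w : ZMod r) ^ b) ^ η b] at h2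
  exact h2.elim h0 h1

end NumericalCriterion

section Certificate

/-- The sum of the first `n` values of `g`, by structural recursion. -/
def sumBelow (g : ℕ → ℕ) : ℕ → ℕ
  | 0 => 0
  | n + 1 => sumBelow g n + g n

theorem sumBelow_eq_sum_range (g : ℕ → ℕ) (n : ℕ) : sumBelow g n = ∑ k ∈ Finset.range n, g k := by
  induction n with
  | zero => rfl
  | succ n ih => rw [sumBelow, ih, Finset.sum_range_succ]

/-- The product of the first `n` values of `g`, reduced modulo `r` at each step. -/
def prodBelowMod (r : ℕ) (g : ℕ → ℕ) : ℕ → ℕ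
  | 0 => 1
  | n + 1 => prodBelowMod r g n * g n % r

theorem natCast_prodBelowMod (r : ℕ) (g : ℕ → ℕ) (n : ℕ) :
    (prodBelowMod r g n : ZMod r) = ∏ k ∈ Finset.range n, (g k : ZMod r) := by
  induction n with
  | zero => simp [prodBelowMod]
  | succ n ih => rw [prodBelowMod, ZMod.natCast_mod, Nat.cast_mul, ih, Finset.prod_range_succ]

/-- Whether `g` holds at every natural number below `n`. -/
def allBelow (g : ℕ → Bool) : ℕ → Bool
  | 0 => true
  | n + 1 => allBelow g n && g n

theorem apply_of_allBelow {g : ℕ → Bool} {n : ℕ} (h : allBelow g n = true) {k : ℕ} (hk : k < n) :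
    g k = true := by
  induction n with
  | zero => omega
  | succ n ih =>
    rw [allBelow, Bool.and_eq_true] at h
    rcases Nat.lt_succ_iff_lt_or_eq.1 hk with h1 | rfl
    · exact ih h.1 h1
    · exact h.2

/-- The digit of index `k` of `N` in base `B`. -/
def digitAt (B N k : ℕ) : ℕ := N / B ^ k % B

/-- The value at `x` of the polynomial with coefficients `f 0, …, f (n - 1)`, modulo `r`. -/
def evalMod (r : ℕ) (f : ℕ → ℕ) (n x : ℕ) : ℕ := sumBelow (fun k => f k * x ^ k) n % r

theorem natCast_evalMod (r : ℕ) (f : ℕ → ℕ) (n x : ℕ) :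
    (evalMod r f n x : ZMod r) = evalCoeffs f n (x : ZMod r) := by
  rw [evalMod, ZMod.natCast_mod, sumBelow_eq_sum_range, ← natCast_evalCoeffs]
  rfl

/-- The test that `t` has order exactly `q ^ (e + 1)` modulo `p`. -/
def checkPrimitiveRoot (p q e t : ℕ) : Bool :=
  t ^ q ^ (e + 1) % p == 1 && t ^ q ^ e % p != 1

theorem natCast_eq_one_iff_mod {p : ℕ} (hp : 1 < p) (t : ℕ) : (t : ZMod p) = 1 ↔ t % p = 1 := by
  rw [← Nat.cast_one, ZMod.natCast_eq_natCast_iff', Nat.mod_eq_of_lt hp]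

theorem isPrimitiveRoot_of_check {p q e t : ℕ} [Fact q.Prime] (hp : 1 < p)
    (h : checkPrimitiveRoot p q e t = true) : IsPrimitiveRoot (t : ZMod p) (q ^ (e + 1)) := by
  simp only [checkPrimitiveRoot, Bool.and_eq_true, beq_iff_eq, bne_iff_ne,
    ← natCast_eq_one_iff_mod hp, Nat.cast_pow, ne_eq] at h
  rw [← orderOf_eq_prime_pow h.2 h.1]
  exact IsPrimitiveRoot.orderOf _

/-- The test that `f` is the coefficient function of an element of absolute value `√p`. -/
def checkAutocorrelation (p n m : ℕ) (f : ℕ → ℕ) : Bool :=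
  let A := fun k => sumBelow (fun j => f ((j + k) % n) * f j) n
  allBelow (fun k => A (k + m) + (if k = 0 then p else 0) ==
    A k + (if (k + m) % n = 0 then p else 0)) n

/-- The test that `z` is the indicator of the exponents `k` such that `t ^ k` is a root modulo `p`,
and contains exactly one of any two opposite residues prime to `n`. -/
def checkSupport (p n t : ℕ) (f : ℕ → ℕ) (z : ℕ → Bool) : Bool :=
  allBelow (fun k => z k == (evalMod p f n (t ^ k % p) == 0)) n &&
    allBelow (fun k => Nat.gcd k n != 1 || z (n - k) == !z k) n

/-- The test that `η` annihilates modulo `ℓ` the translates of the support `z`. -/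
def checkAnnihilator (n ℓ : ℕ) (η : ℕ → ℕ) (z : ℕ → Bool) : Bool :=
  allBelow (fun d => Nat.gcd d n != 1 || sumBelow (fun b =>
    if Nat.gcd b n = 1 then (if z (d * b % n) then η b else 0) else 0) n % ℓ == 0) n

/-- A power of the value modulo `r` of the twisted product of conjugates. -/
def powerResidue (n M r w : ℕ) (f η : ℕ → ℕ) : ℕ :=
  prodBelowMod r (fun b => if Nat.gcd b n = 1 then evalMod r f n (w ^ b % r) ^ η b else 1) n ^ M % r

theorem not_nonempty_equiv_of_check {p q e : ℕ} [Fact p.Prime] [Fact q.Prime] (hq : Odd q)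
    (hp : p = 2 * q ^ (e + 1) + 1) {t ℓ M r w : ℕ} [Fact r.Prime] (f η : ℕ → ℕ) (z : ℕ → Bool)
    (ht : checkPrimitiveRoot p q e t = true) (hw : checkPrimitiveRoot r q e w = true)
    (hM : 2 * q ^ (e + 1) ∣ M) (hr : r - 1 = ℓ * M)
    (hf : checkAutocorrelation p (q ^ (e + 1)) (q ^ e) f = true)
    (hz : checkSupport p (q ^ (e + 1)) t f z = true)
    (hη : checkAnnihilator (q ^ (e + 1)) ℓ η z = true)
    (hv : 1 < powerResidue (q ^ (e + 1)) M r w f η)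
    {σ : FractionRing (MvPolynomial (Fin p) ℚ) ≃ₐ[ℚ] FractionRing (MvPolynomial (Fin p) ℚ)}
    (hσ : ∀ i : Fin p,
      σ (algebraMap (MvPolynomial (Fin p) ℚ) (FractionRing (MvPolynomial (Fin p) ℚ))
          (MvPolynomial.X i)) =
        algebraMap (MvPolynomial (Fin p) ℚ) (FractionRing (MvPolynomial (Fin p) ℚ))
          (MvPolynomial.X (finRotate p i))) :
    ¬ Nonempty ((IntermediateField.fixedField (Subgroup.zpowers σ)) ≃ₐ[ℚ]
        FractionRing (MvPolynomial (Fin p) ℚ)) := by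
  have hq1 : 1 < q := (Fact.out : q.Prime).one_lt
  have hp1 : 1 < p := (Fact.out : p.Prime).one_lt
  have hr1 : 1 < r := (Fact.out : r.Prime).one_lt
  set n := q ^ (e + 1) with hn
  have hn1 : 1 < n := Nat.one_lt_pow (Nat.succ_ne_zero e) hq1
  have : NeZero n := ⟨by omega⟩
  simp only [checkSupport, Bool.and_eq_true] at hz
  have hprod : ((powerResidue n M r w f η : ℕ) : ZMod r) = (∏ b ∈ Finset.range n,
      if b.Coprime n then evalCoeffs f n ((w : ZMod r) ^ b) ^ η b else 1) ^ M := by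
    rw [powerResidue, ZMod.natCast_mod, Nat.cast_pow, natCast_prodBelowMod]
    congr 1
    refine Finset.prod_congr rfl fun b _ => ?_
    simp only [Nat.Coprime, Nat.cast_ite, Nat.cast_one, Nat.cast_pow, natCast_evalMod,
      ZMod.natCast_mod]
  have hlt : powerResidue n M r w f η < r := Nat.mod_lt _ (by omega)
  refine not_nonempty_equiv_of_prod_evalCoeffs hp hq.pow hn1 (f := f) (η := η) (z := z)
    (isPrimitiveRoot_of_check hp1 ht) (isPrimitiveRoot_of_check hr1 hw) (m := q ^ e) ?_ hM hr
    ?_ ?_ ?_ ?_ ?_ ?_ hσ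
  · rw [hn, Nat.pow_dvd_pow_iff_le_right hq1]
    omega
  · intro k hk
    have h1 := apply_of_allBelow hf hk
    simpa only [beq_iff_eq, sumBelow_eq_sum_range, autocorrelation] using h1
  · intro k hk
    have h1 := apply_of_allBelow hz.1 hk
    rw [beq_iff_eq] at h1
    rw [h1, beq_iff_eq, ← Nat.cast_pow, ← ZMod.natCast_mod (t ^ k), ← natCast_evalMod,
      ZMod.natCast_eq_zero_iff, Nat.dvd_iff_mod_eq_zero, evalMod, Nat.mod_mod]
  · intro k hk hkn
    have h1 := apply_of_allBelow hz.2 hk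
    simpa [Nat.Coprime.gcd_eq_one hkn] using h1
  · intro d hd hdn
    have h1 := apply_of_allBelow hη hd
    simp only [Nat.Coprime.gcd_eq_one hdn, bne_self_eq_false, Bool.false_or, beq_iff_eq,
      sumBelow_eq_sum_range] at h1
    exact Nat.dvd_of_mod_eq_zero h1
  · rw [← hprod, Ne, ZMod.natCast_eq_zero_iff]
    exact Nat.not_dvd_of_pos_of_lt (by omega) hlt
  · rw [← hprod, Ne, natCast_eq_one_iff_mod hr1, Nat.mod_eq_of_lt hlt]
    omega

end Certificate

/-- For each prime `p ∈ {59, 83, 107, 163}`, with `σ` the `ℚ`-automorphism of the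
rational function field `ℚ(x₁, …, x_p) = Frac(ℚ[x₁, …, x_p])` cyclically permuting the
indeterminates (so that the cyclic group `C_p = ⟨σ⟩` acts regularly on `{x₁, …, x_p}`),
the fixed field `ℚ(x₁, …, x_p)^{C_p}` is not rational (not purely transcendental)
over `ℚ`. -/
theorem noether_problem_not_rational
    (p : ℕ) (hp : p.Prime) (hmem : p ∈ ({59, 83, 107, 163} : Finset ℕ))
    (σ : FractionRing (MvPolynomial (Fin p) ℚ) ≃ₐ[ℚ] FractionRing (MvPolynomial (Fin p) ℚ))
    (hσ : ∀ i : Fin p,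
      σ (algebraMap (MvPolynomial (Fin p) ℚ) (FractionRing (MvPolynomial (Fin p) ℚ))
          (MvPolynomial.X i)) =
        algebraMap (MvPolynomial (Fin p) ℚ) (FractionRing (MvPolynomial (Fin p) ℚ))
          (MvPolynomial.X (finRotate p i))) :
    ¬ Nonempty ((IntermediateField.fixedField (Subgroup.zpowers σ)) ≃ₐ[ℚ]
        FractionRing (MvPolynomial (Fin p) ℚ)) := by
  simp only [Finset.mem_insert, Finset.mem_singleton] at hmem
  rcases hmem with rfl | rfl | rfl | rfl
  · have : Fact (Nat.Prime 59) := ⟨hp⟩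
    have : Fact (Nat.Prime 29) := ⟨by norm_num⟩
    have : Fact (Nat.Prime 233) := ⟨by norm_num⟩
    exact not_nonempty_equiv_of_check (q := 29) (e := 0) (t := 4) (ℓ := 2) (M := 116) (r := 233)
      (w := 37) (by decide) (by norm_num)
      (digitAt 8
        41257271300213143916512402)
      (digitAt 4
        17843540)
      (fun k => 0 < k && 2 * k < 29)
      (by decide +kernel) (by decide +kernel) (by norm_num) (by norm_num) (by decide +kernel)
      (by decide +kernel) (by decide +kernel) (by decide +kernel) hσ
  · have : Fact (Nat.Prime 83) := ⟨hp⟩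
    have : Fact (Nat.Prime 41) := ⟨by norm_num⟩
    have : Fact (Nat.Prime 2707) := ⟨by norm_num⟩
    exact not_nonempty_equiv_of_check (q := 41) (e := 0) (t := 4) (ℓ := 11) (M := 246) (r := 2707)
      (w := 632) (by decide) (by norm_num)
      (digitAt 8
        2829885616955809258334290525578339600)
      (digitAt 16
        100412772181056074252432)
      (fun k => 0 < k && 2 * k < 41)
      (by decide +kernel) (by decide +kernel) (by norm_num) (by norm_num) (by decide +kernel)
      (by decide +kernel) (by decide +kernel) (by decide +kernel) hσ
  · have : Fact (Nat.Prime 107) := ⟨hp⟩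
    have : Fact (Nat.Prime 53) := ⟨by norm_num⟩
    have : Fact (Nat.Prime 4145873) := ⟨by norm_num⟩
    exact not_nonempty_equiv_of_check (q := 53) (e := 0) (t := 4) (ℓ := 4889) (M := 848)
      (r := 4145873)
      (w := 3649653) (by decide) (by norm_num)
      (digitAt 8
        194507819680724471775019948047152800397481027744)
      (digitAt 8192
        813128465386342107060355857017736040874189070206361136379898110843916760897325740236642439260598476800)
      (fun k => 0 < k && 2 * k < 53)
      (by decide +kernel) (by decide +kernel) (by norm_num) (by norm_num) (by decide +kernel)
      (by decide +kernel) (by decide +kernel) (by decide +kernel) hσ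
  · have : Fact (Nat.Prime 163) := ⟨hp⟩
    have : Fact (Nat.Prime 3) := ⟨by norm_num⟩
    have : Fact (Nat.Prime 3360529) := ⟨by norm_num⟩
    exact not_nonempty_equiv_of_check (q := 3) (e := 3) (t := 4) (ℓ := 2593) (M := 1296)
      (r := 3360529)
      (w := 1427019) (by decide) (by norm_num)
      (digitAt 8
        277055998588813497692082160006438427042460423540510472433247803664844834)
      (digitAt 4096
        3122051290274083488318328293306662930149711862201879266289672028701314833497964096776091037820029573452677146519101439111800179347863766419550208)
      (fun k => 0 < k && 2 * k < 81)
      (by decide +kernel) (by decide +kernel) (by norm_num) (by norm_num) (by decide +kernel)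
      (by decide +kernel) (by decide +kernel) (by decide +kernel) hσ
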